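/- arXiv:0708.2155 — 2 statements merged into one kernel-verified Lean document; each statement's English description precedes it below -/
import Mathlib

section
/- Let d ≥ 2, n ≥ d + 1, and q ≤ n − d be integers. Let ω be a domain in ℂⁿ, let ρ : ω → ℝ be a smooth function whose Levi form has at least n − q + 1 positive eigenvalues at every point of ω, and let K_ω be a compact subset of ω such that dρ(x) ≠ 0 for every x ∈ K_ω. Let D ⊂ ℂ^d be a bounded domain with smooth boundary and let p ∈ bD be a strongly pseudoconvex boundary point of D. Then there exist open balls V_p ⋐ U_p in ℂ^d with p ∈ V_p, and constants ε_p ∈ (0,1), μ₀ > 0, and γ₀ ∈ (0,1), such that the following holds. Given an open set D₁ ⊆ U_p ∩ D, a relatively open subset C of bD contained in V_p with dist(cl(C), bD₁ \ bD) > 0, a map f : cl(D₁) → ω that is smooth on cl(D₁) and holomorphic on D₁, a number ε > 0, and a continuous function γ : bD ∩ bD₁ → (0, γ₀], there is a map g : cl(D₁) → ω, smooth on cl(D₁) and holomorphic on D₁, such that: (i) ρ(g(z)) − ρ(f(z)) > μ₀|g(z) − f(z)|² − ε for all z ∈ cl(D₁); (ii) |g(z) − f(z)| > ε_p·γ(z)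 for all z ∈ C with f(z) ∈ K_ω; (iii) |g(z) − f(z)| < ε_p⁻¹·γ(z) for all z ∈ bD ∩ bD₁; and (iv) |g(z) − f(z)| < ε for all z ∈ cl(D₁) with dist(z, C) > ε. -/
open Set Metric Complex Bornology

noncomputable section

/-- The Levi form of a C² function `ρ` at `x` in direction `v`:
`L_ρ(x;v) = (1/4)(D²ρ(x)[v,v] + D²ρ(x)[iv,iv])`. -/
def leviForm {E : Type*} [NormedAddCommGroup E] [NormedSpace ℂ E]
    (ρ : E → ℝ) (x v : E) : ℝ :=
  (1 / 4) * (iteratedFDeriv ℝ 2 ρ x ![v, v] +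
    iteratedFDeriv ℝ 2 ρ x ![Complex.I • v, Complex.I • v])

/-- The Levi form of `ρ` at `x` has at least `r` positive eigenvalues: there is an
`r`-dimensional complex subspace on which it is positive on nonzero vectors. -/
def LeviPosEigenAtLeast {E : Type*} [NormedAddCommGroup E] [NormedSpace ℂ E]
    (ρ : E → ℝ) (x : E) (r : ℕ) : Prop :=
  ∃ V : Submodule ℂ E, Module.finrank ℂ V = r ∧ ∀ v ∈ V, v ≠ 0 → 0 < leviForm ρ x v

/-- A bounded strongly pseudoconvex domain in `ℂ^d` with boundary of class `C^ℓ`. -/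
def IsSPCDomain {d : ℕ} (D : Set (EuclideanSpace ℂ (Fin d))) (ℓ : ℕ∞) : Prop :=
  IsOpen D ∧ IsConnected D ∧ IsBounded D ∧
  ∃ (U : Set (EuclideanSpace ℂ (Fin d))) (rD : EuclideanSpace ℂ (Fin d) → ℝ),
    IsOpen U ∧ frontier D ⊆ U ∧ ContDiffOn ℝ ℓ rD U ∧
    D ∩ U = {x ∈ U | rD x < 0} ∧
    (∀ x ∈ frontier D, fderiv ℝ rD x ≠ 0) ∧
    (∀ x ∈ frontier D, ∀ v : EuclideanSpace ℂ (Fin d), v ≠ 0 →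
      fderiv ℝ rD x v = 0 → fderiv ℝ rD x (Complex.I • v) = 0 → 0 < leviForm rD x v)

section SpectralTruncation

variable {F : Type*} [NormedAddCommGroup F] [InnerProductSpace ℂ F] [CompleteSpace F]

/-- The positive part of `H - lam`, defined through the continuous functional calculus. -/
def spectralTruncation (lam : ℝ) (H : F →L[ℂ] F) : F →L[ℂ] F :=
  cfc (fun t : ℝ => max (t - lam) 0) H

lemma spectralTruncation_nonneg (lam : ℝ) (H : F →L[ℂ] F) : 0 ≤ spectralTruncation lam H :=
  cfc_nonneg fun _ _ => le_max_right _ _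

lemma re_inner_spectralTruncation_ge (lam : ℝ) {H : F →L[ℂ] F} (hH : IsSelfAdjoint H) (v : F) :
    (inner ℂ v (H v)).re - lam * ‖v‖ ^ 2 ≤ (inner ℂ v (spectralTruncation lam H v)).re := by
  have h : H - algebraMap ℝ _ lam ≤ spectralTruncation lam H := by
    have : H - algebraMap ℝ _ lam = cfc (fun t : ℝ => t - lam) H := by
      rw [cfc_sub (fun t : ℝ => t) (fun _ => lam) H, cfc_id' ℝ H, cfc_const lam H]
    rw [this]
    exact cfc_mono fun _ _ => le_max_left _ _
  have h2 := ((ContinuousLinearMap.le_def _ _).1 h).re_inner_nonneg_right v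
  simp only [sub_apply, inner_sub_right, map_sub,
    Algebra.algebraMap_eq_smul_one, smul_apply,
    one_apply_eq_self] at h2
  have h3 : RCLike.re (inner ℂ v (lam • v)) = lam * ‖v‖ ^ 2 := by
    rw [show lam • v = (lam : ℂ) • v from rfl, inner_smul_right, inner_self_eq_norm_sq_to_K]
    simp only [← RCLike.ofReal_pow]
    exact Complex.re_ofReal_mul _ _
  rw [h3] at h2
  have e : ∀ z : ℂ, RCLike.re z = z.re := fun _ => rfl
  simp only [e] at h2
  linarith

lemma spectralTruncation_mul_self (lam : ℝ) {H : F →L[ℂ] F} (hH : IsSelfAdjoint H) :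
    spectralTruncation lam H * spectralTruncation lam H
      = spectralTruncation lam H * H - lam • spectralTruncation lam H := by
  have hid : H = cfc (fun t : ℝ => t) H := (cfc_id' ℝ H).symm
  have h1 : spectralTruncation lam H * H
      = cfc (fun t : ℝ => max (t - lam) 0 * t) H := by
    conv_lhs => rw [hid]
    rw [cfc_mul _ _ H]
    rw [← hid]; rfl
  rw [h1, spectralTruncation, ← cfc_mul _ _ H, ← cfc_smul _ _ H, ← cfc_sub _ _ H]
  refine cfc_congr fun t _ => ?_
  simp only [smul_eq_mul]
  rcases le_total (t - lam) 0 with h | h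
  · simp [max_eq_right h]
  · rw [max_eq_left h]; ring

lemma re_inner_apply_spectralTruncation_ge (lam : ℝ) {H : F →L[ℂ] F} (hH : IsSelfAdjoint H)
    (v : F) :
    lam * ‖spectralTruncation lam H v‖ ^ 2 ≤
      (inner ℂ (spectralTruncation lam H v) (H (spectralTruncation lam H v))).re := by
  set Φ := spectralTruncation lam H with hΦ
  have hpos : Φ.IsPositive :=
    (ContinuousLinearMap.nonneg_iff_isPositive _).1 (spectralTruncation_nonneg lam H)
  have hsa : IsSelfAdjoint Φ := hpos.isSelfAdjoint
  have hsym : ∀ a b, inner ℂ (Φ a) b = inner ℂ a (Φ b) := fun a b => hpos.isSymmetric a b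
  have hcomm : Φ * H * Φ = Φ * Φ * Φ + lam • (Φ * Φ) := by
    have h := spectralTruncation_mul_self lam hH
    rw [← hΦ] at h
    have h' : Φ * H = Φ * Φ + lam • Φ := by rw [h]; abel
    rw [h', add_mul, smul_mul_assoc]
  have h1 : inner ℂ (Φ v) (H (Φ v)) = inner ℂ v ((Φ * H * Φ) v) := by
    rw [hsym]; rfl
  have h2 : inner ℂ v ((Φ * Φ * Φ) v) = inner ℂ (Φ v) (Φ (Φ v)) := by
    rw [hsym]; rfl
  have h3 : inner ℂ v ((lam • (Φ * Φ)) v) = (lam : ℂ) * inner ℂ (Φ v) (Φ v) := by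
    rw [hsym, smul_apply,
      show lam • ((Φ * Φ) v) = (lam : ℂ) • (Φ (Φ v)) from rfl, inner_smul_right]
  rw [h1, hcomm, add_apply, inner_add_right, h2, h3, Complex.add_re,
    inner_self_eq_norm_sq_to_K]
  have h4 : 0 ≤ (inner ℂ (Φ v) (Φ (Φ v))).re := hpos.re_inner_nonneg_right (Φ v)
  have h5 : ((lam : ℂ) * ((‖Φ v‖ : ℝ) : ℂ) ^ 2).re = lam * ‖Φ v‖ ^ 2 := by norm_cast
  have h6 : ((lam : ℂ) * ((RCLike.ofReal ‖Φ v‖ : ℂ)) ^ 2).re = lam * ‖Φ v‖ ^ 2 := h5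
  rw [h6]; linarith

lemma inner_spectralTruncation_eq_zero {lam : ℝ} (hlam : 0 < lam) {H : F →L[ℂ] F}
    (hH : IsSelfAdjoint H) {e : F} (he : H e = 0) (v : F) :
    inner ℂ e (spectralTruncation lam H v) = 0 := by
  set Φ := spectralTruncation lam H with hΦ
  have hpos : Φ.IsPositive :=
    (ContinuousLinearMap.nonneg_iff_isPositive _).1 (spectralTruncation_nonneg lam H)
  have hsym : ∀ a b, inner ℂ (Φ a) b = inner ℂ a (Φ b) := fun a b => hpos.isSymmetric a b
  have h1 : Φ (Φ e) = - ((lam : ℂ) • Φ e) := by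
    have := congrArg (fun T : F →L[ℂ] F => T e) (spectralTruncation_mul_self lam hH)
    simp only [mul_apply_eq_comp, sub_apply, he, map_zero,
      zero_sub] at this
    exact this
  have h2 : (inner ℂ e (Φ (Φ e))).re = ‖Φ e‖ ^ 2 := by
    rw [← hsym, inner_self_eq_norm_sq_to_K]; norm_cast
  have h3 : (inner ℂ e (Φ (Φ e))).re = - (lam * (inner ℂ e (Φ e)).re) := by
    rw [h1, inner_neg_right, inner_smul_right]; simp
  have h4 : 0 ≤ (inner ℂ e (Φ e)).re := hpos.re_inner_nonneg_right e
  have h5 : ‖Φ e‖ ^ 2 = 0 := le_antisymm (by nlinarith) (sq_nonneg _)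
  have h6 : Φ e = 0 := by simpa using h5
  rw [← hsym, h6, inner_zero_left]

lemma continuousOn_spectralTruncation (lam : ℝ) {X : Type*} [TopologicalSpace X] {K : Set X}
    (hK : IsCompact K) {H : X → F →L[ℂ] F} (hH : ContinuousOn H K)
    (hsa : ∀ x ∈ K, IsSelfAdjoint (H x)) :
    ContinuousOn (fun x => spectralTruncation lam (H x)) K := by
  obtain ⟨M, hM⟩ := hK.exists_bound_of_continuousOn hH
  have hc : ContinuousOn (fun t : ℝ => max (t - lam) 0) (closedBall (0 : ℝ) (M * ‖(1 : F →L[ℂ] F)‖)) := by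
    fun_prop
  refine ContinuousOn.cfc' (isCompact_closedBall (0 : ℝ) (M * ‖(1 : F →L[ℂ] F)‖)) _ hH ?_ hsa hc
  intro x hx t ht
  have := spectrum.norm_le_norm_mul_of_mem ht
  simp only [mem_closedBall, dist_zero_right]
  exact this.trans (mul_le_mul_of_nonneg_right (hM x hx) (norm_nonneg _))

end SpectralTruncation

section ComplexExtension

variable {E G : Type*} [NormedAddCommGroup E] [NormedSpace ℂ E]
  [NormedAddCommGroup G] [NormedSpace ℂ G]

/-- The complex linear map `v ↦ f v - i f (i v)` attached to a real linear map `f`. -/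
def complexify : (E →L[ℝ] G) →L[ℝ] (E →L[ℂ] G) :=
  LinearMap.mkContinuous
    { toFun := fun f =>
        { toFun := fun v => f v - Complex.I • f (Complex.I • v)
          map_add' := fun v w => by simp only [smul_add, map_add]; abel
          map_smul' := fun c v => by
            have hc : ∀ u : E, c • u = c.re • u + c.im • (Complex.I • u) := fun u => by
              conv_lhs => rw [← Complex.re_add_im c]
              rw [add_smul, mul_smul]; rfl
            have hc' : ∀ u : G, c • u = c.re • u + c.im • (Complex.I • u) := fun u => by
              conv_lhs => rw [← Complex.re_add_im c]
              rw [add_smul, mul_smul]; rfl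
            have hI : ∀ u : E, Complex.I • (Complex.I • u) = - u := fun u => by
              rw [smul_smul, Complex.I_mul_I, neg_one_smul]
            have hI' : ∀ u : G, Complex.I • (Complex.I • u) = - u := fun u => by
              rw [smul_smul, Complex.I_mul_I, neg_one_smul]
            rw [RingHom.id_apply, hc', hc v, smul_add, smul_comm Complex.I c.re v,
              smul_comm Complex.I c.im (Complex.I • v), hI]
            simp only [map_add, map_smul, smul_add, smul_sub, map_neg, smul_neg]
            rw [hI', smul_comm Complex.I c.re, smul_comm Complex.I c.im]
            simp only [smul_neg]
            abel
          cont := by fun_prop }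
      map_add' := fun f g => by
        ext v; simp only [add_apply, smul_add, ContinuousLinearMap.coe_mk', LinearMap.coe_mk,
          AddHom.coe_mk]; abel
      map_smul' := fun c f => by
        ext v
        simp only [smul_apply, ContinuousLinearMap.coe_mk', LinearMap.coe_mk, AddHom.coe_mk,
          RingHom.id_apply, smul_sub]
        rw [smul_comm Complex.I c] }
    2 (fun f => by
      refine ContinuousLinearMap.opNorm_le_bound _ (by positivity) fun v => ?_
      have h1 : ‖f (Complex.I • v)‖ ≤ ‖f‖ * ‖v‖ := by
        simpa [norm_smul] using f.le_opNorm (Complex.I • v)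
      have h2 := f.le_opNorm v
      calc ‖f v - Complex.I • f (Complex.I • v)‖
          ≤ ‖f v‖ + ‖Complex.I • f (Complex.I • v)‖ := norm_sub_le _ _
        _ = ‖f v‖ + ‖f (Complex.I • v)‖ := by simp [norm_smul]
        _ ≤ 2 * ‖f‖ * ‖v‖ := by linarith)

lemma complexify_apply (f : E →L[ℝ] G) (v : E) :
    complexify f v = f v - Complex.I • f (Complex.I • v) := rfl

/-- The complex linear functional whose real part is a given real linear functional. -/
def complexDual : (E →L[ℝ] ℝ) →L[ℝ] (E →L[ℂ] ℂ) :=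
  complexify.comp (ContinuousLinearMap.compL ℝ E ℝ ℂ Complex.ofRealCLM)

lemma complexDual_apply (f : E →L[ℝ] ℝ) (v : E) :
    complexDual f v = f v - Complex.I * f (Complex.I • v) := rfl

lemma re_complexDual (f : E →L[ℝ] ℝ) (v : E) : (complexDual f v).re = f v := by
  simp [complexDual_apply]

lemma im_complexDual (f : E →L[ℝ] ℝ) (v : E) : (complexDual f v).im = - f (Complex.I • v) := by
  simp [complexDual_apply]

/-- The complex bilinear part of a real bilinear form. -/
def bilinearPart (B : E →L[ℝ] E →L[ℝ] ℝ) : E →L[ℂ] E →L[ℂ] ℂ :=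
  (1 / 4 : ℝ) • complexify (complexDual.comp B)

lemma re_bilinearPart (B : E →L[ℝ] E →L[ℝ] ℝ) (v : E) :
    (bilinearPart B v v).re = (1 / 4) * (B v v - B (Complex.I • v) (Complex.I • v)) := by
  simp only [bilinearPart, smul_apply, complexify_apply, sub_apply,
    ContinuousLinearMap.comp_apply]
  simp [complexDual_apply]

lemma continuous_bilinearPart :
    Continuous (bilinearPart : (E →L[ℝ] E →L[ℝ] ℝ) → E →L[ℂ] E →L[ℂ] ℂ) := by
  unfold bilinearPart
  exact ((complexify (E := E) (G := E →L[ℂ] ℂ)).continuous.comp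
    ((continuous_const (y := complexDual (E := E))).clm_comp continuous_id)).const_smul (1 / 4 : ℝ)

end ComplexExtension

section LeviOperator

variable {F : Type*} [NormedAddCommGroup F] [InnerProductSpace ℂ F] [CompleteSpace F]

/-- The vector representing a real functional with respect to the real part of the inner
product. -/
def realRiesz : (F →L[ℝ] ℝ) →L[ℝ] F :=
  LinearMap.mkContinuous
    { toFun := fun f => (InnerProductSpace.toDual ℂ F).symm (complexDual f)
      map_add' := fun f g => by simp only [map_add]
      map_smul' := fun c f => by
        have : complexDual (c • f) = (c : ℂ) • complexDual f := by rw [map_smul]; rfl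
        rw [this, map_smulₛₗ, Complex.conj_ofReal]
        rfl }
    ‖complexDual (E := F)‖ (fun f => by
      change ‖(InnerProductSpace.toDual ℂ F).symm (complexDual f)‖ ≤ _
      rw [LinearIsometryEquiv.norm_map]
      exact complexDual.le_opNorm f)

lemma inner_realRiesz (f : F →L[ℝ] ℝ) (v : F) : inner ℂ (realRiesz f) v = complexDual f v :=
  InnerProductSpace.toDual_symm_apply

lemma re_inner_realRiesz (f : F →L[ℝ] ℝ) (v : F) : (inner ℂ (realRiesz f) v).re = f v := by
  rw [inner_realRiesz, re_complexDual]

lemma re_inner_realRiesz_right (f : F →L[ℝ] ℝ) (v : F) :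
    (inner ℂ v (realRiesz f)).re = f v := by
  rw [← inner_conj_symm, Complex.conj_re, re_inner_realRiesz]

/-- The Hermitian operator representing the Levi part of a real bilinear form. -/
def leviOp (B : F →L[ℝ] F →L[ℝ] ℝ) : F →L[ℂ] F :=
  (1 / 4 : ℝ) • complexify (realRiesz.comp B)

lemma continuous_leviOp : Continuous (leviOp : (F →L[ℝ] F →L[ℝ] ℝ) → F →L[ℂ] F) := by
  unfold leviOp
  exact ((complexify (E := F) (G := F)).continuous.comp
    ((continuous_const (y := realRiesz (F := F))).clm_comp continuous_id)).const_smul (1 / 4 : ℝ)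

lemma re_inner_leviOp (B : F →L[ℝ] F →L[ℝ] ℝ) (v w : F) :
    (inner ℂ w (leviOp B v)).re
      = (1 / 4) * (B v w + B (Complex.I • v) (Complex.I • w)) := by
  have h1 : leviOp B v = ((1 / 4 : ℝ) : ℂ) •
      (realRiesz (B v) - Complex.I • realRiesz (B (Complex.I • v))) := rfl
  have h2 : (inner ℂ w (Complex.I • realRiesz (B (Complex.I • v)))).re
      = - B (Complex.I • v) (Complex.I • w) := by
    rw [← re_inner_realRiesz_right (B (Complex.I • v)) (Complex.I • w), inner_smul_right,
      inner_smul_left]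
    simp
  rw [h1, inner_smul_right, Complex.re_ofReal_mul, inner_sub_right, Complex.sub_re, h2,
    re_inner_realRiesz_right]
  ring

lemma isSelfAdjoint_leviOp {B : F →L[ℝ] F →L[ℝ] ℝ} (hB : ∀ v w, B v w = B w v) :
    IsSelfAdjoint (leviOp B) := by
  rw [ContinuousLinearMap.isSelfAdjoint_iff_isSymmetric]
  have hre : ∀ v w, (inner ℂ (leviOp B v) w).re = (inner ℂ v (leviOp B w)).re := fun v w => by
    rw [← inner_conj_symm, Complex.conj_re, re_inner_leviOp, re_inner_leviOp, hB v w,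
      hB (Complex.I • v)]
  intro v w
  apply Complex.ext (hre v w)
  have := hre (Complex.I • v) w
  rw [map_smul, inner_smul_left, inner_smul_left] at this
  simpa using this

end LeviOperator

section Taylor

variable {E : Type*} [NormedAddCommGroup E] [NormedSpace ℝ E]

lemma exists_uniform_taylor_two {ω : Set E} (hω : IsOpen ω) {ρ : E → ℝ}
    (hρ : ContDiffOn ℝ 2 ρ ω) {K : Set E} (hK : IsCompact K) (hKω : K ⊆ ω) {κ : ℝ} (hκ : 0 < κ) :
    ∃ δ > 0, ∀ x ∈ K, ∀ w : E, ‖w‖ ≤ δ → x + w ∈ ω ∧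
      |ρ (x + w) - ρ x - fderiv ℝ ρ x w - (1 / 2) * fderiv ℝ (fderiv ℝ ρ) x w w|
        ≤ κ * ‖w‖ ^ 2 := by
  have h1 : ContDiffOn ℝ 1 (fderiv ℝ ρ) ω := hρ.fderiv_of_isOpen hω (by norm_num)
  have h2 : ContinuousOn (fderiv ℝ (fderiv ℝ ρ)) ω := h1.continuousOn_fderiv_of_isOpen hω le_rfl
  obtain ⟨δ₁, hδ₁, hδ₁ω⟩ := hK.exists_cthickening_subset_open hω hKω
  have huc : ∀ x ∈ K, ContinuousAt (fderiv ℝ (fderiv ℝ ρ)) x :=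
    fun x hx => h2.continuousAt (hω.mem_nhds (hKω hx))
  have := hK.uniformContinuousAt_of_continuousAt _ huc
    (Metric.dist_mem_uniformity (α := E →L[ℝ] E →L[ℝ] ℝ) hκ)
  obtain ⟨δ₂, hδ₂, hδ₂'⟩ := Metric.mem_uniformity_dist.1 this
  refine ⟨min δ₁ (δ₂ / 2), by positivity, fun x hx w hw => ?_⟩
  have hball : closedBall x (min δ₁ (δ₂ / 2)) ⊆ ω := fun y hy => hδ₁ω <|
    mem_cthickening_of_dist_le y x _ _ hx ((mem_closedBall.1 hy).trans (min_le_left _ _))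
  have hmem : ∀ y, ‖y‖ ≤ min δ₁ (δ₂ / 2) → x + y ∈ ω := fun y hy => hball (by simpa using hy)
  refine ⟨hmem w hw, ?_⟩
  set H := fderiv ℝ (fderiv ℝ ρ) x with hH
  have hsymm : ∀ a b, H a b = H b a := by
    intro a b
    have hc : ContDiffAt ℝ 2 ρ x := hρ.contDiffAt (hω.mem_nhds (hKω hx))
    exact (hc.isSymmSndFDerivAt (by simp)).eq a b
  have hd1 : ∀ y, ‖y‖ ≤ min δ₁ (δ₂ / 2) → ‖fderiv ℝ ρ (x + y) - fderiv ℝ ρ x - H y‖ ≤ κ * ‖y‖ := by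
    intro y hy
    have hconv : Convex ℝ (closedBall x ‖y‖) := convex_closedBall _ _
    have hsub : closedBall x ‖y‖ ⊆ closedBall x (min δ₁ (δ₂ / 2)) := closedBall_subset_closedBall hy
    have := hconv.norm_image_sub_le_of_norm_hasFDerivWithin_le' (f := fderiv ℝ ρ)
      (f' := fun z => fderiv ℝ (fderiv ℝ ρ) z) (φ := H) (C := κ) (x := x) (y := x + y)
      (fun z hz => by
        have hz' := hball (hsub hz)
        exact ((h1.differentiableOn (by norm_num)).differentiableAt
          (hω.mem_nhds hz')).hasFDerivAt.hasFDerivWithinAt)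
      (fun z hz => by
        have hz2 : dist x z < δ₂ := by
          rw [dist_comm]
          have : dist z x ≤ δ₂ / 2 := (mem_closedBall.1 (hsub hz)).trans (min_le_right _ _)
          linarith
        have := hδ₂' hz2 hx
        have this : dist (fderiv ℝ (fderiv ℝ ρ) x) (fderiv ℝ (fderiv ℝ ρ) z) < κ := this
        rw [dist_comm] at this
        exact (dist_eq_norm (fderiv ℝ (fderiv ℝ ρ) z) (fderiv ℝ (fderiv ℝ ρ) x)).symm.trans_le
          this.le)
      (by simp) (by simp)
    simpa using this
  have hφ : ∀ y, ‖y‖ ≤ min δ₁ (δ₂ / 2) → HasFDerivAt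
      (fun y => ρ (x + y) - ρ x - fderiv ℝ ρ x y - (1 / 2) * H y y)
      (fderiv ℝ ρ (x + y) - fderiv ℝ ρ x - H y) y := by
    intro y hy
    have e1 : HasFDerivAt (fun y => ρ (x + y)) (fderiv ℝ ρ (x + y)) y := by
      have : HasFDerivAt ρ (fderiv ℝ ρ (x + y)) (x + y) :=
        ((hρ.differentiableOn (by norm_num)).differentiableAt
          (hω.mem_nhds (hmem y hy))).hasFDerivAt
      exact (hasFDerivAt_comp_add_left x).2 this
    have e2 : HasFDerivAt (fun y => (1 / 2 : ℝ) * H y y) (H y) y := by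
      have := ((H.hasFDerivAt (x := y)).clm_apply (hasFDerivAt_id y)).const_mul (1 / 2 : ℝ)
      refine this.congr_fderiv ?_
      ext v
      simp [hsymm v y]
      ring
    have := ((e1.sub_const (ρ x)).sub ((fderiv ℝ ρ x).hasFDerivAt (x := y))).sub e2
    exact this
  have hconv : Convex ℝ (closedBall (0 : E) ‖w‖) := convex_closedBall _ _
  have := hconv.norm_image_sub_le_of_norm_hasFDerivWithin_le
    (f := fun y => ρ (x + y) - ρ x - fderiv ℝ ρ x y - (1 / 2) * H y y)
    (f' := fun y => fderiv ℝ ρ (x + y) - fderiv ℝ ρ x - H y) (C := κ * ‖w‖)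
    (x := 0) (y := w)
    (fun y hy => (hφ y ((by simpa using hy : ‖y‖ ≤ ‖w‖).trans hw)).hasFDerivWithinAt)
    (fun y hy => by
      have hy' : ‖y‖ ≤ ‖w‖ := by simpa using hy
      exact (hd1 y (hy'.trans hw)).trans (by gcongr))
    (by simp) (by simp)
  simp only [add_zero, sub_self, map_zero, mul_zero, sub_zero, Real.norm_eq_abs] at this
  rw [pow_two, ← mul_assoc]
  simpa using this

end Taylor

section Subspaces

lemma exists_le_finrank_eq {k V : Type*} [Field k] [AddCommGroup V] [Module k V]
    (W : Submodule k V) {d : ℕ} (hd : d ≤ Module.finrank k W) :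
    ∃ T ≤ W, Module.finrank k T = d := by
  obtain ⟨f, hf⟩ := exists_linearIndependent_of_le_finrank hd
  have hf' : LinearIndependent k (fun i => (f i : V)) := hf.map' W.subtype W.ker_subtype
  refine ⟨Submodule.span k (range fun i => (f i : V)), ?_, ?_⟩
  · rw [Submodule.span_le]
    rintro _ ⟨i, rfl⟩
    exact (f i).2
  · rw [finrank_span_eq_card hf', Fintype.card_fin]

lemma exists_le_ker_finrank_eq {k V : Type*} [Field k] [AddCommGroup V] [Module k V]
    [FiniteDimensional k V] (W : Submodule k V) (φ : V →ₗ[k] k) {d : ℕ}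
    (hd : d + 1 ≤ Module.finrank k W) :
    ∃ T ≤ W, Module.finrank k T = d ∧ ∀ v ∈ T, φ v = 0 := by
  have h1 := Submodule.finrank_sup_add_finrank_inf_eq W (LinearMap.ker φ)
  have h2 := LinearMap.finrank_range_add_finrank_ker φ
  have h3 := Submodule.finrank_le (W ⊔ LinearMap.ker φ)
  have h4 := Submodule.finrank_le (LinearMap.range φ)
  rw [Module.finrank_self] at h4
  obtain ⟨T, hT, hTd⟩ := exists_le_finrank_eq (W ⊓ LinearMap.ker φ) (d := d) (by omega)
  exact ⟨T, hT.trans inf_le_left, hTd, fun v hv => (hT hv).2⟩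

variable {F : Type*} [NormedAddCommGroup F] [InnerProductSpace ℂ F] [FiniteDimensional ℂ F]

lemma exists_pos_le_re_inner (T : Submodule ℂ F) (H : F →L[ℂ] F)
    (hT : ∀ v ∈ T, v ≠ 0 → 0 < (inner ℂ v (H v)).re) :
    ∃ c > 0, ∀ v ∈ T, c * ‖v‖ ^ 2 ≤ (inner ℂ v (H v)).re := by
  have : ProperSpace F := FiniteDimensional.proper ℂ F
  have hcont : Continuous fun v : F => (inner ℂ v (H v)).re := by fun_prop
  have hcomp : IsCompact (sphere (0 : F) 1 ∩ T) :=
    (isCompact_sphere 0 1).inter_right T.closed_of_finiteDimensional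
  have key : ∃ c > 0, ∀ v ∈ sphere (0 : F) 1 ∩ T, c ≤ (inner ℂ v (H v)).re := by
    rcases (sphere (0 : F) 1 ∩ T).eq_empty_or_nonempty with h | h
    · exact ⟨1, one_pos, by simp [h]⟩
    · obtain ⟨v₀, hv₀, hmin⟩ := hcomp.exists_isMinOn h hcont.continuousOn
      refine ⟨_, hT v₀ hv₀.2 ?_, fun v hv => hmin hv⟩
      rintro rfl
      simpa using hv₀.1
  obtain ⟨c, hc, hc'⟩ := key
  refine ⟨c, hc, fun v hv => ?_⟩
  rcases eq_or_ne v 0 with rfl | hv0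
  · simp
  have hn : ‖v‖ ≠ 0 := norm_ne_zero_iff.2 hv0
  have h := hc' (((‖v‖⁻¹ : ℝ) : ℂ) • v) ⟨by simp [norm_smul, hn], T.smul_mem _ hv⟩
  rw [map_smul, inner_smul_left, inner_smul_right, Complex.conj_ofReal, Complex.re_ofReal_mul,
    Complex.re_ofReal_mul] at h
  have : c * ‖v‖ ^ 2 ≤ (‖v‖⁻¹ * (‖v‖⁻¹ * (inner ℂ v (H v)).re)) * ‖v‖ ^ 2 := by gcongr
  calc c * ‖v‖ ^ 2 ≤ _ := this
    _ = _ := by field_simp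

lemma exists_uniform_pos_le_re_inner {X : Type*} [TopologicalSpace X] {K : Set X}
    (hK : IsCompact K) {H : X → F →L[ℂ] F} (hH : ContinuousOn H K) {d : ℕ}
    (hT : ∀ x ∈ K, ∃ T : Submodule ℂ F, Module.finrank ℂ T = d ∧
      ∀ v ∈ T, v ≠ 0 → 0 < (inner ℂ v (H x v)).re) :
    ∃ c > 0, ∀ x ∈ K, ∃ T : Submodule ℂ F, Module.finrank ℂ T = d ∧
      ∀ v ∈ T, c * ‖v‖ ^ 2 ≤ (inner ℂ v (H x v)).re := by
  refine hK.induction_on (p := fun s => ∃ c > 0, ∀ x ∈ s, ∃ T : Submodule ℂ F,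
      Module.finrank ℂ T = d ∧ ∀ v ∈ T, c * ‖v‖ ^ 2 ≤ (inner ℂ v (H x v)).re)
    ⟨1, one_pos, by simp⟩ ?_ ?_ ?_
  · rintro s t hst ⟨c, hc, h⟩
    exact ⟨c, hc, fun x hx => h x (hst hx)⟩
  · rintro s t ⟨c, hc, h⟩ ⟨c', hc', h'⟩
    refine ⟨min c c', lt_min hc hc', fun x hx => ?_⟩
    rcases hx with hx | hx
    · obtain ⟨T, hTd, hT⟩ := h x hx
      exact ⟨T, hTd, fun v hv => le_trans (by gcongr; exact min_le_left _ _) (hT v hv)⟩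
    · obtain ⟨T, hTd, hT⟩ := h' x hx
      exact ⟨T, hTd, fun v hv => le_trans (by gcongr; exact min_le_right _ _) (hT v hv)⟩
  · intro x hx
    obtain ⟨T, hTd, hpos⟩ := hT x hx
    obtain ⟨c, hc, hcT⟩ := exists_pos_le_re_inner T (H x) hpos
    have hnear := (hH x hx).eventually (Metric.ball_mem_nhds (H x) (half_pos hc))
    refine ⟨_, hnear, c / 2, half_pos hc, fun y hy => ⟨T, hTd, fun v hv => ?_⟩⟩
    have hy' : ‖H y - H x‖ ≤ c / 2 := by
      rw [← dist_eq_norm]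
      exact (Metric.mem_ball.1 hy).le
    have h1 := hcT v hv
    have h2 : (inner ℂ v (H y v)).re = (inner ℂ v (H x v)).re + (inner ℂ v ((H y - H x) v)).re := by
      rw [← Complex.add_re, ← inner_add_right]
      simp
    have h3 : |(inner ℂ v ((H y - H x) v)).re| ≤ c / 2 * ‖v‖ ^ 2 := by
      refine (Complex.abs_re_le_norm _).trans ((norm_inner_le_norm _ _).trans ?_)
      calc ‖v‖ * ‖(H y - H x) v‖ ≤ ‖v‖ * (c / 2 * ‖v‖) := by
            gcongr; exact (H y - H x).le_of_opNorm_le hy' v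
        _ = _ := by ring
    have h4 := (abs_le.1 h3).1
    rw [h2]; linarith

end Subspaces

section TargetPackage

variable {F : Type*} [NormedAddCommGroup F] [InnerProductSpace ℂ F]

/-- The orthogonal projection to the complement of `e`. -/
def projOrthogonal (e : F) : F →L[ℂ] F :=
  1 - ((‖e‖ ^ 2 : ℝ)⁻¹ : ℂ) • (innerSL ℂ e).smulRight e

lemma projOrthogonal_apply (e w : F) :
    projOrthogonal e w = w - ((‖e‖ ^ 2 : ℝ)⁻¹ : ℂ) • (inner ℂ e w) • e := by
  simp [projOrthogonal]

lemma projOrthogonal_of_inner_eq_zero {e w : F} (h : inner ℂ e w = 0) :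
    projOrthogonal e w = w := by
  simp [projOrthogonal_apply, h]

lemma projOrthogonal_self {e : F} (he : e ≠ 0) : projOrthogonal e e = 0 := by
  have : ((‖e‖ : ℂ)) ≠ 0 := by simpa using he
  rw [projOrthogonal_apply, smul_smul, inner_self_eq_norm_sq_to_K]
  push_cast
  simp [this]

lemma isSymmetric_projOrthogonal (e : F) : (projOrthogonal e : F →ₗ[ℂ] F).IsSymmetric := by
  intro v w
  simp only [ContinuousLinearMap.coe_coe, projOrthogonal_apply, inner_sub_left, inner_sub_right,
    inner_smul_left, inner_smul_right, inner_conj_symm, map_inv₀, Complex.conj_ofReal]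
  ring

variable [CompleteSpace F]

lemma re_inner_leviOp_self (ρ : F → ℝ) (x v : F) :
    (inner ℂ v (leviOp (fderiv ℝ (fderiv ℝ ρ) x) v)).re = leviForm ρ x v := by
  rw [re_inner_leviOp, leviForm, iteratedFDeriv_two_apply, iteratedFDeriv_two_apply]
  rfl

/-- The Levi operator compressed to the complex tangent space of the level set. -/
def tangentLeviOp (ρ : F → ℝ) (x : F) : F →L[ℂ] F :=
  (projOrthogonal (realRiesz (fderiv ℝ ρ x))).comp
    ((leviOp (fderiv ℝ (fderiv ℝ ρ) x)).comp (projOrthogonal (realRiesz (fderiv ℝ ρ x))))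

lemma re_inner_tangentLeviOp (ρ : F → ℝ) {x v : F}
    (hv : inner ℂ (realRiesz (fderiv ℝ ρ x)) v = 0) :
    (inner ℂ v (tangentLeviOp ρ x v)).re = leviForm ρ x v := by
  rw [← re_inner_leviOp_self]
  have := isSymmetric_projOrthogonal (realRiesz (fderiv ℝ ρ x)) v
    (leviOp (fderiv ℝ (fderiv ℝ ρ) x) v)
  simp only [ContinuousLinearMap.coe_coe, projOrthogonal_of_inner_eq_zero hv] at this
  simp only [tangentLeviOp, ContinuousLinearMap.comp_apply, projOrthogonal_of_inner_eq_zero hv]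
  rw [← this]

lemma isSelfAdjoint_tangentLeviOp {ρ : F → ℝ} {x : F} (hρ : ContDiffAt ℝ 2 ρ x) :
    IsSelfAdjoint (tangentLeviOp ρ x) := by
  have hL : IsSelfAdjoint (leviOp (fderiv ℝ (fderiv ℝ ρ) x)) :=
    isSelfAdjoint_leviOp fun v w => (hρ.isSymmSndFDerivAt (by simp)).eq v w
  rw [ContinuousLinearMap.isSelfAdjoint_iff_isSymmetric] at hL ⊢
  intro v w
  have hP := isSymmetric_projOrthogonal (realRiesz (fderiv ℝ ρ x))
  simp only [ContinuousLinearMap.coe_coe, tangentLeviOp, ContinuousLinearMap.comp_apply]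
  have h1 := fun a b => hP a b
  have h2 := fun a b => hL a b
  simp only [ContinuousLinearMap.coe_coe] at h1 h2
  rw [h1, h2, h1]

lemma realRiesz_ne_zero {f : F →L[ℝ] ℝ} (hf : f ≠ 0) : realRiesz f ≠ 0 := by
  intro h
  apply hf
  ext v
  rw [← re_inner_realRiesz f v, h]
  simp

lemma tangentLeviOp_realRiesz {ρ : F → ℝ} {x : F} (hx : fderiv ℝ ρ x ≠ 0) :
    tangentLeviOp ρ x (realRiesz (fderiv ℝ ρ x)) = 0 := by
  simp [tangentLeviOp, projOrthogonal_self (realRiesz_ne_zero hx)]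

/-- The complex bilinear correction, normal to the level set, which cancels the bilinear part of
the second derivative. -/
def normalCorrection (ρ : F → ℝ) (x : F) : F →L[ℂ] F →L[ℂ] F :=
  (ContinuousLinearMap.compL ℂ F ℂ F ((1 : ℂ →L[ℂ] ℂ).smulRight
      (-((‖realRiesz (fderiv ℝ ρ x)‖ ^ 2 : ℝ)⁻¹ : ℂ) • realRiesz (fderiv ℝ ρ x)))).comp
    (bilinearPart (fderiv ℝ (fderiv ℝ ρ) x))

lemma normalCorrection_apply (ρ : F → ℝ) (x u v : F) :
    normalCorrection ρ x u v = (bilinearPart (fderiv ℝ (fderiv ℝ ρ) x) u v) •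
      (-((‖realRiesz (fderiv ℝ ρ x)‖ ^ 2 : ℝ)⁻¹ : ℂ) • realRiesz (fderiv ℝ ρ x)) := rfl

lemma inner_normalCorrection {ρ : F → ℝ} {x : F} (hx : fderiv ℝ ρ x ≠ 0) (u v : F) :
    inner ℂ (realRiesz (fderiv ℝ ρ x)) (normalCorrection ρ x u v)
      = - bilinearPart (fderiv ℝ (fderiv ℝ ρ) x) u v := by
  have : ((‖realRiesz (fderiv ℝ ρ x)‖ : ℂ)) ≠ 0 := by simpa using realRiesz_ne_zero hx
  rw [normalCorrection_apply, inner_smul_right, inner_smul_right, inner_self_eq_norm_sq_to_K]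
  push_cast
  field_simp
  simp

section Continuity

variable {ω : Set F} {ρ : F → ℝ} (hω : IsOpen ω) (hρ : ContDiffOn ℝ 2 ρ ω)
include hω hρ

lemma continuousOn_realRiesz_fderiv : ContinuousOn (fun x => realRiesz (fderiv ℝ ρ x)) ω :=
  realRiesz.continuous.comp_continuousOn (hρ.continuousOn_fderiv_of_isOpen hω (by norm_num))

omit [CompleteSpace F] in
lemma continuousOn_fderiv_fderiv : ContinuousOn (fderiv ℝ (fderiv ℝ ρ)) ω :=
  (hρ.fderiv_of_isOpen (m := 1) hω (by norm_num)).continuousOn_fderiv_of_isOpen hω le_rfl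

lemma continuousOn_inv_norm_sq {K : Set F} (hK : K ⊆ ω) (hcrit : ∀ x ∈ K, fderiv ℝ ρ x ≠ 0) :
    ContinuousOn (fun x => (((‖realRiesz (fderiv ℝ ρ x)‖ ^ 2 : ℝ) : ℂ))⁻¹) K := by
  refine ContinuousOn.inv₀ (Complex.continuous_ofReal.comp_continuousOn
    (((continuousOn_realRiesz_fderiv hω hρ).mono hK).norm.pow 2)) fun x hx => ?_
  have := realRiesz_ne_zero (hcrit x hx)
  simpa using this

lemma continuousOn_tangentLeviOp {K : Set F} (hK : K ⊆ ω) (hcrit : ∀ x ∈ K, fderiv ℝ ρ x ≠ 0) :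
    ContinuousOn (tangentLeviOp ρ) K := by
  have he := (continuousOn_realRiesz_fderiv hω hρ).mono hK
  have hP : ContinuousOn (fun x => projOrthogonal (realRiesz (fderiv ℝ ρ x))) K := by
    refine continuousOn_const.sub ((continuousOn_inv_norm_sq hω hρ hK hcrit).smul ?_)
    have := ((ContinuousLinearMap.smulRightL ℂ F F).continuous₂.comp_continuousOn
      (((innerSL ℂ (E := F)).continuous.comp_continuousOn he).prodMk he))
    exact this
  exact hP.clm_comp (((continuous_leviOp.comp_continuousOn
    ((continuousOn_fderiv_fderiv hω hρ).mono hK))).clm_comp hP)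

lemma continuousOn_normalCorrection {K : Set F} (hK : K ⊆ ω)
    (hcrit : ∀ x ∈ K, fderiv ℝ ρ x ≠ 0) : ContinuousOn (normalCorrection ρ) K := by
  have he := (continuousOn_realRiesz_fderiv hω hρ).mono hK
  refine ContinuousOn.clm_comp ?_ (continuous_bilinearPart.comp_continuousOn
    ((continuousOn_fderiv_fderiv hω hρ).mono hK))
  refine (ContinuousLinearMap.compL ℂ F ℂ F).continuous.comp_continuousOn ?_
  exact ((ContinuousLinearMap.smulRightL ℂ ℂ F) 1).continuous.comp_continuousOn
    ((continuousOn_inv_norm_sq hω hρ hK hcrit).neg.smul he)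

end Continuity
end TargetPackage

section TargetGrowth

variable {F : Type*} [NormedAddCommGroup F] [InnerProductSpace ℂ F] [CompleteSpace F]

/-- Data producing displacements along which a function with many positive Levi eigenvalues grows
quadratically: `Φ x` maps onto a subspace of complex tangent directions, and `S x` is a quadratic
correction. -/
structure GrowthData (ρ : F → ℝ) (K : Set F) (d : ℕ) where
  Φ : F → F →L[ℂ] F
  S : F → F →L[ℂ] F →L[ℂ] F
  b : ℝ
  B : ℝ
  μ : ℝ
  δ : ℝ
  b_pos : 0 < b
  B_ge : 1 ≤ B
  μ_pos : 0 < μ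
  δ_pos : 0 < δ
  continuousOn_Φ : ContinuousOn Φ K
  continuousOn_S : ContinuousOn S K
  norm_Φ_le : ∀ x ∈ K, ‖Φ x‖ ≤ B
  norm_S_le : ∀ x ∈ K, ‖S x‖ ≤ B
  exists_subspace : ∀ x ∈ K, ∃ T : Submodule ℂ F, Module.finrank ℂ T = d ∧
    ∀ a ∈ T, b * ‖a‖ ≤ ‖Φ x a‖
  growth : ∀ x ∈ K, ∀ a, ‖Φ x a‖ ≤ δ →
    μ * ‖Φ x a + S x (Φ x a) (Φ x a)‖ ^ 2
      ≤ ρ (x + (Φ x a + S x (Φ x a) (Φ x a))) - ρ x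

lemma growth_pointwise {ρ : F → ℝ} {x u : F} {M lam δ : ℝ} (hM : 1 ≤ M) (hlam : 0 < lam)
    (hcrit : fderiv ℝ ρ x ≠ 0) (hS : ‖normalCorrection ρ x‖ ≤ M)
    (hL : ‖leviOp (fderiv ℝ (fderiv ℝ ρ) x)‖ ≤ M)
    (hβ : ‖bilinearPart (fderiv ℝ (fderiv ℝ ρ) x)‖ ≤ M)
    (hδ : 24 * M ^ 2 * δ ≤ lam) (hδM : M * δ ≤ 1)
    (hu : ‖u‖ ≤ δ) (hℓ : inner ℂ (realRiesz (fderiv ℝ ρ x)) u = 0)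
    (hpos : lam * ‖u‖ ^ 2 ≤ leviForm ρ x u)
    (htaylor : ∀ w : F, ‖w‖ ≤ 2 * δ →
      |ρ (x + w) - ρ x - fderiv ℝ ρ x w - (1 / 2) * fderiv ℝ (fderiv ℝ ρ) x w w|
        ≤ lam / 16 * ‖w‖ ^ 2) :
    lam / 8 * ‖u + normalCorrection ρ x u u‖ ^ 2
      ≤ ρ (x + (u + normalCorrection ρ x u u)) - ρ x := by
  set s := normalCorrection ρ x u u with hs
  set β := bilinearPart (fderiv ℝ (fderiv ℝ ρ) x) with hβdef
  set L := leviOp (fderiv ℝ (fderiv ℝ ρ) x) with hLdef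
  have hδ0 : 0 ≤ δ := (norm_nonneg u).trans hu
  have hMu : M * ‖u‖ ≤ 1 := (by gcongr : M * ‖u‖ ≤ M * δ).trans hδM
  have hsn : ‖s‖ ≤ M * ‖u‖ ^ 2 := by
    calc ‖s‖ ≤ ‖normalCorrection ρ x‖ * ‖u‖ * ‖u‖ := (normalCorrection ρ x).le_opNorm₂ u u
      _ ≤ M * ‖u‖ * ‖u‖ := by gcongr
      _ = _ := by ring
  have hsu : ‖s‖ ≤ ‖u‖ := by
    calc ‖s‖ ≤ M * ‖u‖ ^ 2 := hsn
      _ = (M * ‖u‖) * ‖u‖ := by ring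
      _ ≤ 1 * ‖u‖ := by gcongr
      _ = _ := one_mul _
  have hw : ‖u + s‖ ≤ 2 * ‖u‖ := (norm_add_le _ _).trans (by linarith)
  have ht := (abs_le.1 (htaylor (u + s) (hw.trans (by linarith)))).1
  -- splitting the second derivative into its Levi and bilinear parts
  have hsplit : (1 / 2) * fderiv ℝ (fderiv ℝ ρ) x (u + s) (u + s)
      = (β (u + s) (u + s)).re + (inner ℂ (u + s) (L (u + s))).re := by
    rw [hβdef, hLdef, re_bilinearPart, re_inner_leviOp]; ring
  have hlin : fderiv ℝ ρ x (u + s) = - (β u u).re := by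
    rw [← re_inner_realRiesz, inner_add_right, hℓ, hs, inner_normalCorrection hcrit]
    simp [hβdef]
  have hβb : ∀ a b : F, |(β a b).re| ≤ M * (‖a‖ * ‖b‖) := fun a b =>
    (Complex.abs_re_le_norm _).trans ((β.le_opNorm₂ a b).trans (by rw [mul_assoc]; gcongr))
  have hLb : ∀ a b : F, |(inner ℂ a (L b)).re| ≤ M * (‖a‖ * ‖b‖) := fun a b =>
    (Complex.abs_re_le_norm _).trans ((norm_inner_le_norm _ _).trans (by
      calc ‖a‖ * ‖L b‖ ≤ ‖a‖ * (M * ‖b‖) := by gcongr; exact L.le_of_opNorm_le hL b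
        _ = _ := by ring))
  have e1 : ‖u‖ * ‖s‖ ≤ M * δ * ‖u‖ ^ 2 := by
    calc ‖u‖ * ‖s‖ ≤ δ * (M * ‖u‖ ^ 2) := by gcongr
      _ = _ := by ring
  have e2 : ‖s‖ * ‖s‖ ≤ M * δ * ‖u‖ ^ 2 := (by gcongr : ‖s‖ * ‖s‖ ≤ ‖u‖ * ‖s‖).trans e1
  have e1' : M * (‖u‖ * ‖s‖) ≤ M ^ 2 * δ * ‖u‖ ^ 2 := by
    calc M * (‖u‖ * ‖s‖) ≤ M * (M * δ * ‖u‖ ^ 2) := by gcongr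
      _ = _ := by ring
  have e2' : M * (‖s‖ * ‖s‖) ≤ M ^ 2 * δ * ‖u‖ ^ 2 := by
    calc M * (‖s‖ * ‖s‖) ≤ M * (M * δ * ‖u‖ ^ 2) := by gcongr
      _ = _ := by ring
  have e3 : M ^ 2 * δ * ‖u‖ ^ 2 ≤ lam / 24 * ‖u‖ ^ 2 := by gcongr; linarith
  have b1 := (abs_le.1 (hβb u s)).1
  have b2 := (abs_le.1 (hβb s u)).1
  have b3 := (abs_le.1 (hβb s s)).1
  have l1 := (abs_le.1 (hLb u s)).1
  have l2 := (abs_le.1 (hLb s u)).1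
  have l3 := (abs_le.1 (hLb s s)).1
  rw [mul_comm ‖s‖ ‖u‖] at b2 l2
  have hβexp : (β (u + s) (u + s)).re
      = (β u u).re + (β u s).re + (β s u).re + (β s s).re := by
    simp only [map_add, add_apply, Complex.add_re]; ring
  have hLexp : (inner ℂ (u + s) (L (u + s))).re = (inner ℂ u (L u)).re + (inner ℂ u (L s)).re
      + (inner ℂ s (L u)).re + (inner ℂ s (L s)).re := by
    simp only [map_add, inner_add_left, inner_add_right, Complex.add_re]; ring
  have hLu : lam * ‖u‖ ^ 2 ≤ (inner ℂ u (L u)).re := by rwa [hLdef, re_inner_leviOp_self]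
  have hw2 : ‖u + s‖ ^ 2 ≤ 4 * ‖u‖ ^ 2 := by
    calc ‖u + s‖ ^ 2 ≤ (2 * ‖u‖) ^ 2 := by gcongr
      _ = _ := by ring
  have hlw : lam * ‖u + s‖ ^ 2 ≤ lam * (4 * ‖u‖ ^ 2) := by gcongr
  rw [hsplit, hlin, hβexp, hLexp] at ht
  linarith

lemma exists_growthData [FiniteDimensional ℂ F] {ω : Set F} (hω : IsOpen ω) {ρ : F → ℝ}
    (hρ : ContDiffOn ℝ 2 ρ ω) {K : Set F} (hK : IsCompact K) (hKω : K ⊆ ω)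
    (hcrit : ∀ x ∈ K, fderiv ℝ ρ x ≠ 0) {d : ℕ}
    (hlevi : ∀ x ∈ K, ∃ V : Submodule ℂ F, d + 1 ≤ Module.finrank ℂ V ∧
      ∀ v ∈ V, v ≠ 0 → 0 < leviForm ρ x v) :
    Nonempty (GrowthData ρ K d) := by
  have hcT := continuousOn_tangentLeviOp hω hρ hKω hcrit
  have hcS := continuousOn_normalCorrection hω hρ hKω hcrit
  have hc2 := (continuousOn_fderiv_fderiv hω hρ).mono hKω
  obtain ⟨c, hc, hcK⟩ := exists_uniform_pos_le_re_inner hK hcT (d := d) (fun x hx => by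
    obtain ⟨V, hV, hpos⟩ := hlevi x hx
    obtain ⟨T, hTV, hTd, hT⟩ := exists_le_ker_finrank_eq V
      (innerSL ℂ (realRiesz (fderiv ℝ ρ x)) : F →ₗ[ℂ] ℂ) hV
    refine ⟨T, hTd, fun v hv hv0 => ?_⟩
    rw [re_inner_tangentLeviOp ρ (by simpa using hT v hv)]
    exact hpos v (hTV hv) hv0)
  set lam := c / 2 with hlam
  have hlam0 : 0 < lam := half_pos hc
  have hsa : ∀ x ∈ K, IsSelfAdjoint (tangentLeviOp ρ x) := fun x hx =>
    isSelfAdjoint_tangentLeviOp (hρ.contDiffAt (hω.mem_nhds (hKω hx)))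
  have hcΦ : ContinuousOn (fun x => spectralTruncation lam (tangentLeviOp ρ x)) K :=
    continuousOn_spectralTruncation lam hK hcT hsa
  obtain ⟨M₁, hM₁⟩ := hK.exists_bound_of_continuousOn hcΦ
  obtain ⟨M₂, hM₂⟩ := hK.exists_bound_of_continuousOn hcS
  obtain ⟨M₃, hM₃⟩ := hK.exists_bound_of_continuousOn
    (continuous_leviOp.comp_continuousOn hc2)
  obtain ⟨M₄, hM₄⟩ := hK.exists_bound_of_continuousOn (E := F →L[ℂ] F →L[ℂ] ℂ)
    (continuous_bilinearPart.comp_continuousOn hc2)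
  obtain ⟨M, hM⟩ : ∃ M : ℝ, 1 ≤ M ∧ M₁ ≤ M ∧ M₂ ≤ M ∧ M₃ ≤ M ∧ M₄ ≤ M :=
    ⟨max 1 (max M₁ (max M₂ (max M₃ M₄))), by simp⟩
  obtain ⟨hM0, h1, h2, h3, h4⟩ := hM
  obtain ⟨δ₀, hδ₀, htaylor⟩ := exists_uniform_taylor_two hω hρ hK hKω
    (κ := lam / 16) (by positivity)
  obtain ⟨δ, hδ, hδ1, hδ2, hδ3⟩ : ∃ δ > 0, 24 * M ^ 2 * δ ≤ lam ∧ M * δ ≤ 1 ∧ 2 * δ ≤ δ₀ := by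
    refine ⟨min (lam / (24 * M ^ 2)) (min (1 / M) (δ₀ / 2)), by positivity, ?_, ?_, ?_⟩
    · calc 24 * M ^ 2 * _ ≤ 24 * M ^ 2 * (lam / (24 * M ^ 2)) := by gcongr; exact min_le_left _ _
        _ = lam := by field_simp
    · calc M * _ ≤ M * (1 / M) := by
            gcongr; exact (min_le_right _ _).trans (min_le_left _ _)
        _ = 1 := by field_simp
    · have := (min_le_right (lam / (24 * M ^ 2)) _).trans (min_le_right (1 / M) (δ₀ / 2))
      linarith
  exact ⟨{
    Φ := fun x => spectralTruncation lam (tangentLeviOp ρ x)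
    S := normalCorrection ρ
    b := lam
    B := M
    μ := lam / 8
    δ := δ
    b_pos := hlam0
    B_ge := hM0
    μ_pos := by positivity
    δ_pos := hδ
    continuousOn_Φ := hcΦ
    continuousOn_S := hcS
    norm_Φ_le := fun x hx => (hM₁ x hx).trans h1
    norm_S_le := fun x hx => (hM₂ x hx).trans h2
    exists_subspace := fun x hx => by
      obtain ⟨T, hTd, hT⟩ := hcK x hx
      refine ⟨T, hTd, fun a ha => ?_⟩
      have e1 := re_inner_spectralTruncation_ge lam (hsa x hx) a
      have e2 := hT a ha
      have e3 : (inner ℂ a (spectralTruncation lam (tangentLeviOp ρ x) a)).re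
          ≤ ‖a‖ * ‖spectralTruncation lam (tangentLeviOp ρ x) a‖ :=
        (Complex.re_le_norm _).trans (norm_inner_le_norm _ _)
      rcases eq_or_ne a 0 with rfl | ha0
      · simp
      · have hn : 0 < ‖a‖ := norm_pos_iff.2 ha0
        refine le_of_mul_le_mul_left ?_ hn
        have : c = 2 * lam := by rw [hlam]; ring
        rw [this] at e2
        nlinarith
    growth := fun x hx a ha => by
      have hℓ := inner_spectralTruncation_eq_zero hlam0 (hsa x hx)
        (tangentLeviOp_realRiesz (hcrit x hx)) a
      refine growth_pointwise hM0 hlam0 (hcrit x hx) ((hM₂ x hx).trans h2) ((hM₃ x hx).trans h3)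
        ((hM₄ x hx).trans h4) hδ1 hδ2 ha hℓ ?_ fun w hw => (htaylor x hx w (hw.trans hδ3)).2
      rw [← re_inner_tangentLeviOp ρ hℓ]
      exact re_inner_apply_spectralTruncation_ge lam (hsa x hx) a }⟩

end TargetGrowth

section SupportFunction

variable {E : Type*} [NormedAddCommGroup E] [NormedSpace ℂ E]

lemma leviForm_eq (r : E → ℝ) (x v : E) : leviForm r x v =
    (1 / 4) * (fderiv ℝ (fderiv ℝ r) x v v
      + fderiv ℝ (fderiv ℝ r) x (Complex.I • v) (Complex.I • v)) := by
  rw [leviForm, iteratedFDeriv_two_apply, iteratedFDeriv_two_apply]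
  rfl

lemma leviForm_smul (r : E → ℝ) (x v : E) (t : ℝ) :
    leviForm r x (t • v) = t ^ 2 * leviForm r x v := by
  rw [leviForm_eq, leviForm_eq, smul_comm Complex.I t v]
  simp only [map_smul, smul_apply, smul_eq_mul]
  ring

lemma continuous_leviForm (r : E → ℝ) (x : E) : Continuous (leviForm r x) := by
  simp only [funext (leviForm_eq r x)]
  fun_prop

lemma exists_levi_penalty [FiniteDimensional ℂ E] {r : E → ℝ} {p : E}
    (hspc : ∀ v : E, v ≠ 0 → fderiv ℝ r p v = 0 → fderiv ℝ r p (Complex.I • v) = 0 →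
      0 < leviForm r p v) :
    ∃ K > 0, ∃ lam > 0, ∀ v : E,
      lam * ‖v‖ ^ 2 ≤ leviForm r p v + K / 2 * ‖complexDual (fderiv ℝ r p) v‖ ^ 2 := by
  have : ProperSpace E := FiniteDimensional.proper ℂ E
  set ℓ := complexDual (fderiv ℝ r p)
  have key : ∃ K > 0, ∃ lam > 0, ∀ v ∈ sphere (0 : E) 1,
      lam ≤ leviForm r p v + K / 2 * ‖ℓ v‖ ^ 2 := by
    refine (isCompact_sphere (0 : E) 1).induction_on (p := fun s => ∃ K > 0, ∃ lam > 0, ∀ v ∈ s,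
      lam ≤ leviForm r p v + K / 2 * ‖ℓ v‖ ^ 2) ⟨1, one_pos, 1, one_pos, by simp⟩ ?_ ?_ ?_
    · rintro s t hst ⟨K, hK, lam, hlam, h⟩
      exact ⟨K, hK, lam, hlam, fun v hv => h v (hst hv)⟩
    · rintro s t ⟨K, hK, lam, hlam, h⟩ ⟨K', hK', lam', hlam', h'⟩
      refine ⟨max K K', lt_max_of_lt_left hK, min lam lam', lt_min hlam hlam', fun v hv => ?_⟩
      rcases hv with hv | hv
      · refine (min_le_left _ _).trans ((h v hv).trans ?_)
        gcongr
        exact le_max_left _ _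
      · refine (min_le_right _ _).trans ((h' v hv).trans ?_)
        gcongr
        exact le_max_right _ _
    · intro v hv
      have hv0 : v ≠ 0 := by rintro rfl; simp at hv
      have hloc : ∃ K > 0, 0 < leviForm r p v + K / 2 * ‖ℓ v‖ ^ 2 := by
        by_cases h0 : ℓ v = 0
        · refine ⟨1, one_pos, ?_⟩
          have h1 := re_complexDual (fderiv ℝ r p) v
          have h2 := im_complexDual (fderiv ℝ r p) v
          change (ℓ v).re = _ at h1
          change (ℓ v).im = _ at h2
          rw [h0] at h1 h2
          have := hspc v hv0 h1.symm (by simpa using h2.symm)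
          rw [h0]
          simpa using this
        · have hn : 0 < ‖ℓ v‖ ^ 2 := by positivity
          refine ⟨2 * (|leviForm r p v| + 1) / ‖ℓ v‖ ^ 2, by positivity, ?_⟩
          have : 2 * (|leviForm r p v| + 1) / ‖ℓ v‖ ^ 2 / 2 * ‖ℓ v‖ ^ 2
              = |leviForm r p v| + 1 := by field_simp
          rw [this]
          linarith [neg_abs_le (leviForm r p v)]
      obtain ⟨K, hK, hpos⟩ := hloc
      have hcont : Continuous fun v => leviForm r p v + K / 2 * ‖ℓ v‖ ^ 2 :=
        (continuous_leviForm r p).add (by fun_prop)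
      refine ⟨_, mem_nhdsWithin_of_mem_nhds
        (hcont.continuousAt.eventually (lt_mem_nhds (half_lt_self hpos))), K, hK, _,
        half_pos hpos, fun w hw => le_of_lt hw⟩
  obtain ⟨K, hK, lam, hlam, h⟩ := key
  refine ⟨K, hK, lam, hlam, fun v => ?_⟩
  rcases eq_or_ne v 0 with rfl | hv0
  · have : leviForm r p 0 = 0 := by simp [leviForm_eq]
    simp [this]
  have hn : 0 < ‖v‖ := norm_pos_iff.2 hv0
  have h1 := h (‖v‖⁻¹ • v) (by simp [norm_smul, hn.ne'])
  have h2 : ‖ℓ (‖v‖⁻¹ • v)‖ ^ 2 = (‖v‖⁻¹) ^ 2 * ‖ℓ v‖ ^ 2 := by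
    have : ℓ (‖v‖⁻¹ • v) = ((‖v‖⁻¹ : ℝ) : ℂ) • ℓ v := map_smul ℓ ((‖v‖⁻¹ : ℝ) : ℂ) v
    rw [this, norm_smul]; simp [mul_pow]
  rw [leviForm_smul, h2] at h1
  have h3 : lam * ‖v‖ ^ 2 ≤ (‖v‖⁻¹ ^ 2 * leviForm r p v + K / 2 * (‖v‖⁻¹ ^ 2 * ‖ℓ v‖ ^ 2))
    * ‖v‖ ^ 2 := by gcongr
  calc lam * ‖v‖ ^ 2 ≤ _ := h3
    _ = _ := by field_simp

/-- A family of holomorphic support functions at the boundary points near `p`. -/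
structure SupportData (D : Set E) (p : E) where
  P : E → E → ℂ
  c : ℝ
  C : ℝ
  rad : ℝ
  c_pos : 0 < c
  C_ge : 1 ≤ C
  rad_pos : 0 < rad
  contDiff : ∀ ζ, ContDiff ℂ (⊤ : ℕ∞) fun z => P z ζ
  re_le : ∀ z ∈ closure D, z ∈ closedBall p rad → ∀ ζ ∈ frontier D, ζ ∈ closedBall p rad →
    (P z ζ).re ≤ - (c * ‖z - ζ‖ ^ 2)
  re_ge : ∀ z ∈ frontier D, z ∈ closedBall p rad → ∀ ζ ∈ frontier D, ζ ∈ closedBall p rad →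
    - (C * ‖z - ζ‖ ^ 2) ≤ (P z ζ).re
  norm_sub_le : ∀ z ∈ closedBall p rad, ∀ z' ∈ closedBall p rad, ∀ ζ ∈ closedBall p rad,
    ∀ ζ' ∈ closedBall p rad,
    ‖(P z ζ - P z ζ') - (P z' ζ - P z' ζ')‖ ≤ C * (‖z - z'‖ * ‖ζ - ζ'‖)

section DefiningFunction

variable {D U : Set E} {r : E → ℝ}

omit [NormedSpace ℂ E] in
lemma definingFunction_nonpos (hU : IsOpen U) (hr : ContinuousOn r U)
    (hDU : D ∩ U = {x ∈ U | r x < 0}) {z : E} (hz : z ∈ closure D) (hzU : z ∈ U) : r z ≤ 0 := by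
  have hz' : z ∈ closure (D ∩ U) := by
    rw [inter_comm]; exact hU.inter_closure ⟨hzU, hz⟩
  have hc : ContinuousWithinAt r (D ∩ U) z := (hr.continuousAt (hU.mem_nhds hzU)).continuousWithinAt
  have := hc.mem_closure_image hz'
  refine closure_minimal (t := Iic (0 : ℝ)) ?_ isClosed_Iic this
  rintro _ ⟨x, hx, rfl⟩
  rw [hDU] at hx
  exact hx.2.le

omit [NormedSpace ℂ E] in
lemma definingFunction_eq_zero (hD : IsOpen D) (hU : IsOpen U) (hr : ContinuousOn r U)
    (hDU : D ∩ U = {x ∈ U | r x < 0}) (hfr : frontier D ⊆ U) {z : E} (hz : z ∈ frontier D) :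
    r z = 0 := by
  refine le_antisymm (definingFunction_nonpos hU hr hDU (frontier_subset_closure hz) (hfr hz)) ?_
  by_contra! h
  have : z ∈ D ∩ U := by rw [hDU]; exact ⟨hfr hz, h⟩
  rw [hD.frontier_eq] at hz
  exact hz.2 this.1

end DefiningFunction

/-- The quadratic part of the support function. -/
def supportQuadratic (r : E → ℝ) (p : E) (K : ℝ) : E →L[ℂ] E →L[ℂ] ℂ :=
  bilinearPart (fderiv ℝ (fderiv ℝ r) p) + ((K / 2 : ℝ) : ℂ) •
    (complexDual (fderiv ℝ r p)).smulRight (complexDual (fderiv ℝ r p))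

lemma re_supportQuadratic (r : E → ℝ) (p : E) (K : ℝ) (v : E) :
    (supportQuadratic r p K v v).re = (1 / 2) * fderiv ℝ (fderiv ℝ r) p v v
      + K * (fderiv ℝ r p v) ^ 2
      - (leviForm r p v + K / 2 * ‖complexDual (fderiv ℝ r p) v‖ ^ 2) := by
  have h1 : (supportQuadratic r p K v v) = bilinearPart (fderiv ℝ (fderiv ℝ r) p) v v
      + ((K / 2 : ℝ) : ℂ) * (complexDual (fderiv ℝ r p) v * complexDual (fderiv ℝ r p) v) := rfl
  rw [h1, Complex.add_re, re_bilinearPart, Complex.re_ofReal_mul, leviForm_eq, Complex.sq_norm,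
    Complex.normSq_apply, Complex.mul_re, re_complexDual]
  ring

set_option maxHeartbeats 1000000 in
lemma exists_supportData [FiniteDimensional ℂ E] {D U : Set E} {r : E → ℝ} {p : E}
    (hD : IsOpen D) (hU : IsOpen U) (hfr : frontier D ⊆ U) (hr : ContDiffOn ℝ 2 r U)
    (hDU : D ∩ U = {x ∈ U | r x < 0}) (hp : p ∈ frontier D)
    (hspc : ∀ v : E, v ≠ 0 → fderiv ℝ r p v = 0 → fderiv ℝ r p (Complex.I • v) = 0 →
      0 < leviForm r p v) :
    Nonempty (SupportData D p) := by
  have : ProperSpace E := FiniteDimensional.proper ℂ E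
  obtain ⟨K, hK, lam, hlam, hpen⟩ := exists_levi_penalty hspc
  have hpU := hfr hp
  have hrp : ContDiffAt ℝ 2 r p := hr.contDiffAt (hU.mem_nhds hpU)
  have h1 : ContDiffOn ℝ 1 (fderiv ℝ r) U := hr.fderiv_of_isOpen hU (by norm_num)
  have h2 : ContinuousOn (fderiv ℝ (fderiv ℝ r)) U := h1.continuousOn_fderiv_of_isOpen hU le_rfl
  obtain ⟨ρ₀, hρ₀, hρ₀U⟩ := Metric.nhds_basis_closedBall.mem_iff.1 (hU.mem_nhds hpU)
  obtain ⟨δ, hδ, htaylor⟩ := exists_uniform_taylor_two hU hr (isCompact_closedBall p ρ₀) hρ₀U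
    (κ := lam / 8) (by positivity)
  obtain ⟨ρ₁, hρ₁, hsnd⟩ : ∃ ρ₁ > 0, ∀ x ∈ closedBall p ρ₁,
      ‖fderiv ℝ (fderiv ℝ r) x - fderiv ℝ (fderiv ℝ r) p‖ ≤ lam / 4 := by
    have := (h2.continuousAt (hU.mem_nhds hpU)).eventually
      (Metric.closedBall_mem_nhds (fderiv ℝ (fderiv ℝ r) p) (ε := lam / 4) (by positivity))
    obtain ⟨ρ₁, hρ₁, h⟩ := Metric.nhds_basis_closedBall.mem_iff.1 this
    exact ⟨ρ₁, hρ₁, fun x hx => (dist_eq_norm (fderiv ℝ (fderiv ℝ r) x)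
      (fderiv ℝ (fderiv ℝ r) p)).symm.trans_le (h hx)⟩
  obtain ⟨M, s, hs, hlip⟩ := (h1.contDiffAt (hU.mem_nhds hpU)).exists_lipschitzOnWith
  obtain ⟨ρ₂, hρ₂, hρ₂s⟩ := Metric.nhds_basis_closedBall.mem_iff.1 hs
  have hη : ∃ η > 0, 2 * K * η ^ 2 ≤ lam / 4 := by
    refine ⟨Real.sqrt (lam / (8 * K)), by positivity, ?_⟩
    rw [Real.sq_sqrt (by positivity)]
    apply le_of_eq
    field_simp
    norm_num
  obtain ⟨η, hη0, hη⟩ := hη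
  obtain ⟨ρ₃, hρ₃, hstrict⟩ : ∃ ρ₃ > 0, ∀ x ∈ closedBall p ρ₃, ∀ y ∈ closedBall p ρ₃,
      ‖r x - r y - fderiv ℝ r p (x - y)‖ ≤ η * ‖x - y‖ := by
    have := (hrp.hasStrictFDerivAt (by norm_num)).isLittleO.def hη0
    rw [nhds_prod_eq] at this
    obtain ⟨t, ht, hsub⟩ := Filter.mem_prod_same_iff.1 this
    obtain ⟨ρ₃, hρ₃, hsub'⟩ := Metric.nhds_basis_closedBall.mem_iff.1 ht
    exact ⟨ρ₃, hρ₃, fun x hx y hy => hsub (mk_mem_prod (hsub' hx) (hsub' hy))⟩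
  obtain ⟨ρ₄, hρ₄, hsmall⟩ : ∃ ρ₄ > 0, ∀ x ∈ closedBall p ρ₄, -(1 / (2 * K)) ≤ r x := by
    have h0 := definingFunction_eq_zero hD hU hr.continuousOn hDU hfr hp
    have := (hrp.continuousAt).eventually (Ici_mem_nhds (a := -(1 / (2 * K)))
      (by rw [h0, neg_lt_zero]; positivity))
    exact Metric.nhds_basis_closedBall.mem_iff.1 this
  obtain ⟨R, hR, hR0, hRδ, hR1, hR2, hR3, hR4⟩ : ∃ R > 0, R ≤ ρ₀ ∧ 2 * R ≤ δ ∧ R ≤ ρ₁ ∧ R ≤ ρ₂ ∧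
      R ≤ ρ₃ ∧ R ≤ ρ₄ := by
    refine ⟨min ρ₀ (min (δ / 2) (min ρ₁ (min ρ₂ (min ρ₃ ρ₄)))), by positivity, by simp, ?_,
      by simp, by simp, by simp, by simp⟩
    have : min ρ₀ (min (δ / 2) (min ρ₁ (min ρ₂ (min ρ₃ ρ₄)))) ≤ δ / 2 := by simp
    linarith
  have hsub0 := closedBall_subset_closedBall (x := p) hR0
  have hsub1 := closedBall_subset_closedBall (x := p) hR1
  have hsub2 := closedBall_subset_closedBall (x := p) hR2
  have hsub3 := closedBall_subset_closedBall (x := p) hR3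
  have hsub4 := closedBall_subset_closedBall (x := p) hR4
  -- Taylor expansion with the second derivative frozen at `p`
  have hT : ∀ z ∈ closedBall p R, ∀ ζ ∈ closedBall p R,
      |r z - r ζ - fderiv ℝ r ζ (z - ζ) - (1 / 2) * fderiv ℝ (fderiv ℝ r) p (z - ζ) (z - ζ)|
        ≤ lam / 4 * ‖z - ζ‖ ^ 2 := by
    intro z hz ζ hζ
    have hd : ‖z - ζ‖ ≤ δ := by
      rw [← dist_eq_norm]
      have := dist_triangle_right z ζ p
      have a1 := mem_closedBall.1 hz
      have a2 := mem_closedBall.1 hζ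
      linarith
    have t1 := (htaylor ζ (hsub0 hζ) (z - ζ) hd).2
    rw [add_sub_cancel] at t1
    have t2 : |(fderiv ℝ (fderiv ℝ r) ζ - fderiv ℝ (fderiv ℝ r) p) (z - ζ) (z - ζ)|
        ≤ lam / 4 * ‖z - ζ‖ ^ 2 := by
      rw [← Real.norm_eq_abs]
      refine ((fderiv ℝ (fderiv ℝ r) ζ - fderiv ℝ (fderiv ℝ r) p).le_opNorm₂ _ _).trans ?_
      rw [mul_assoc, ← pow_two]
      gcongr
      exact hsnd ζ (hsub1 hζ)
    simp only [sub_apply] at t2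
    rw [abs_le] at t1 t2 ⊢
    constructor <;> linarith [t1.1, t1.2, t2.1, t2.2]
  set ℓ : E → E →L[ℂ] ℂ := fun ζ => complexDual (fderiv ℝ r ζ) with hℓ
  set Q := supportQuadratic r p K with hQ
  have hcontr := hr.continuousOn
  set MB := ‖fderiv ℝ (fderiv ℝ r) p‖ with hMB
  set ML := ‖complexDual (E := E)‖ with hML
  refine ⟨{
    P := fun z ζ => ℓ ζ (z - ζ) + Q (z - ζ) (z - ζ)
    c := lam / 2
    C := 1 + MB + lam + ‖Q‖ + ML * M + 2 * ‖Q‖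
    rad := R
    c_pos := by positivity
    C_ge := ?_
    rad_pos := hR
    contDiff := fun ζ => by fun_prop
    re_le := fun z hz hzR ζ hζ hζR => ?_
    re_ge := fun z hz hzR ζ hζ hζR => ?_
    norm_sub_le := fun z hz z' hz' ζ hζ ζ' hζ' => ?_ }⟩
  · have : 0 ≤ ML * M := by positivity
    have : 0 ≤ ‖Q‖ := Q.opNorm_nonneg
    have : 0 ≤ MB := ContinuousLinearMap.opNorm_nonneg _
    linarith
  · have hzU : z ∈ U := hρ₀U (hsub0 hzR)
    have r0 := definingFunction_eq_zero hD hU hcontr hDU hfr hζ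
    have rz := definingFunction_nonpos hU hcontr hDU hz hzU
    have rz' := hsmall z (hsub4 hzR)
    have t := (abs_le.1 (hT z hzR ζ hζR)).1
    have hst := hstrict z (hsub3 hzR) ζ (hsub3 hζR)
    have hp' := hpen (z - ζ)
    rw [Complex.add_re, hℓ, re_complexDual, hQ, re_supportQuadratic]
    rw [r0, sub_zero] at t hst
    set D1 := fderiv ℝ r p (z - ζ)
    set N := ‖z - ζ‖
    have hD1 : D1 ^ 2 ≤ 2 * (r z) ^ 2 + 2 * (η * N) ^ 2 := by
      have : (r z - D1) ^ 2 ≤ (η * N) ^ 2 := by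
        rw [← sq_abs (r z - D1)]
        gcongr
        exact hst
      nlinarith [sq_nonneg (r z + (r z - D1))]
    have hD2 : K * D1 ^ 2 ≤ 2 * K * (r z) ^ 2 + lam / 4 * N ^ 2 := by
      calc K * D1 ^ 2 ≤ K * (2 * (r z) ^ 2 + 2 * (η * N) ^ 2) := by gcongr
        _ = 2 * K * (r z) ^ 2 + (2 * K * η ^ 2) * N ^ 2 := by ring
        _ ≤ _ := by gcongr
    have hrr : r z + 2 * K * (r z) ^ 2 ≤ 0 := by
      have h1 : 0 ≤ 1 + 2 * K * r z := by
        have : 2 * K * (-(1 / (2 * K))) ≤ 2 * K * r z := by gcongr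
        have e : 2 * K * (-(1 / (2 * K))) = -1 := by field_simp
        linarith
      nlinarith
    linarith
  · have r0 := definingFunction_eq_zero hD hU hcontr hDU hfr hζ
    have rz := definingFunction_eq_zero hD hU hcontr hDU hfr hz
    have t := (abs_le.1 (hT z hzR ζ hζR)).2
    rw [r0, rz] at t
    rw [Complex.add_re, hℓ, re_complexDual]
    have q1 := (abs_le.1 ((Complex.abs_re_le_norm _).trans (Q.le_opNorm₂ (z - ζ) (z - ζ)))).1
    have q2 : |fderiv ℝ (fderiv ℝ r) p (z - ζ) (z - ζ)| ≤ MB * ‖z - ζ‖ * ‖z - ζ‖ :=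
      (fderiv ℝ (fderiv ℝ r) p).le_opNorm₂ (z - ζ) (z - ζ)
    have q3 := (abs_le.1 q2).2
    have q4 : 0 ≤ (1 + MB / 2 + lam * (3 / 4) + ML * M + 2 * ‖Q‖) * ‖z - ζ‖ ^ 2 := by
      have hQ0 : 0 ≤ ‖Q‖ := Q.opNorm_nonneg
      have hMB0 : 0 ≤ MB := ContinuousLinearMap.opNorm_nonneg _
      positivity
    linarith
  · have e : (ℓ ζ (z - ζ) + Q (z - ζ) (z - ζ) - (ℓ ζ' (z - ζ') + Q (z - ζ') (z - ζ')))
        - (ℓ ζ (z' - ζ) + Q (z' - ζ) (z' - ζ) - (ℓ ζ' (z' - ζ') + Q (z' - ζ') (z' - ζ')))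
        = (ℓ ζ - ℓ ζ') (z - z') - (Q (z - z') (ζ - ζ') + Q (ζ - ζ') (z - z')) := by
      simp only [map_sub, sub_apply]; ring
    rw [e]
    have n1 : ‖(ℓ ζ - ℓ ζ') (z - z')‖ ≤ ML * M * (‖z - z'‖ * ‖ζ - ζ'‖) := by
      have hl : ‖ℓ ζ - ℓ ζ'‖ ≤ ML * (M * ‖ζ - ζ'‖) := by
        have : ℓ ζ - ℓ ζ' = complexDual (fderiv ℝ r ζ - fderiv ℝ r ζ') := by rw [map_sub]
        rw [this]
        refine (complexDual.le_opNorm _).trans ?_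
        gcongr
        have := hlip.dist_le_mul ζ (hρ₂s (hsub2 hζ)) ζ' (hρ₂s (hsub2 hζ'))
        rwa [dist_eq_norm, dist_eq_norm] at this
      calc ‖(ℓ ζ - ℓ ζ') (z - z')‖ ≤ ‖ℓ ζ - ℓ ζ'‖ * ‖z - z'‖ := ContinuousLinearMap.le_opNorm _ _
        _ ≤ ML * (M * ‖ζ - ζ'‖) * ‖z - z'‖ := by gcongr
        _ = _ := by ring
    have n2 : ‖Q (z - z') (ζ - ζ')‖ ≤ ‖Q‖ * (‖z - z'‖ * ‖ζ - ζ'‖) :=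
      (Q.le_opNorm₂ (z - z') (ζ - ζ')).trans_eq (mul_assoc _ _ _)
    have n3 : ‖Q (ζ - ζ') (z - z')‖ ≤ ‖Q‖ * (‖z - z'‖ * ‖ζ - ζ'‖) :=
      (Q.le_opNorm₂ (ζ - ζ') (z - z')).trans_eq (by ring)
    have hQ0 : 0 ≤ ‖Q‖ := Q.opNorm_nonneg
    have hMB0 : 0 ≤ MB := ContinuousLinearMap.opNorm_nonneg _
    have n6 : 0 ≤ (1 + MB + lam + ‖Q‖) * (‖z - z'‖ * ‖ζ - ζ'‖) := by positivity
    refine (norm_sub_le _ _).trans ((add_le_add n1 ((norm_add_le _ _).trans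
      (add_le_add n2 n3))).trans ?_)
    linarith

end SupportFunction

section Packing

open MeasureTheory

variable {G : Type*} [NormedAddCommGroup G] [NormedSpace ℝ G] [FiniteDimensional ℝ G]

lemma card_mul_pow_le_of_separated {ι : Type*} (s : Finset ι) (f : ι → G) (y : G) {t R : ℝ}
    (ht : 0 < t) (hR : 0 ≤ R) (hsep : ∀ i ∈ s, ∀ j ∈ s, i ≠ j → t ≤ dist (f i) (f j))
    (hs : ∀ i ∈ s, dist (f i) y ≤ R) :
    (s.card : ℝ) * (t / 2) ^ Module.finrank ℝ G ≤ (R + t / 2) ^ Module.finrank ℝ G := by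
  let _ : MeasurableSpace G := borel G
  have _ : BorelSpace G := ⟨rfl⟩
  set μ : Measure G := Measure.addHaar
  have hdisj : (s : Set ι).PairwiseDisjoint fun i => ball (f i) (t / 2) := by
    intro i hi j hj hij
    exact ball_disjoint_ball (by linarith [hsep i hi j hj hij])
  have hsub : (⋃ i ∈ s, ball (f i) (t / 2)) ⊆ ball y (R + t / 2) := by
    refine iUnion₂_subset fun i hi => ball_subset_ball' ?_
    linarith [hs i hi]
  have hle := measure_mono (μ := μ) hsub
  rw [measure_biUnion_finset hdisj fun i _ => measurableSet_ball] at hle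
  have hball : ∀ x : G, ∀ u : ℝ, 0 < u → μ (ball x u)
      = ENNReal.ofReal (u ^ Module.finrank ℝ G) * μ (ball 0 1) :=
    fun x u hu => Measure.addHaar_ball_of_pos μ x hu
  simp only [hball _ _ (half_pos ht), hball _ _ (by positivity : 0 < R + t / 2),
    Finset.sum_const, nsmul_eq_mul, ← mul_assoc] at hle
  have h0 : μ (ball (0 : G) 1) ≠ 0 := (measure_ball_pos μ 0 one_pos).ne'
  have h1 : μ (ball (0 : G) 1) ≠ ⊤ := measure_ball_lt_top.ne
  rw [ENNReal.mul_le_mul_iff_left h0 h1, ← ENNReal.ofReal_natCast,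
    ← ENNReal.ofReal_mul (by positivity), ENNReal.ofReal_le_ofReal_iff (by positivity)] at hle
  exact hle

lemma exists_norm_le_one_forall_lt_dist {ι : Type*} (s : Finset ι) (a : ι → G) {t : ι → ℝ}
    (ht : ∀ i, 0 ≤ t i) (hcard : ∑ i ∈ s, t i ^ Module.finrank ℝ G < 1) :
    ∃ x : G, ‖x‖ ≤ 1 ∧ ∀ i ∈ s, t i < dist x (a i) := by
  let _ : MeasurableSpace G := borel G
  have _ : BorelSpace G := ⟨rfl⟩
  set μ : Measure G := Measure.addHaar
  by_contra! hcon
  have hsub : closedBall (0 : G) 1 ⊆ ⋃ i ∈ s, closedBall (a i) (t i) := by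
    intro x hx
    obtain ⟨i, hi, hix⟩ := hcon x (by simpa using hx)
    exact mem_iUnion₂.2 ⟨i, hi, hix⟩
  have hle := (measure_mono (μ := μ) hsub).trans (measure_biUnion_finset_le _ _)
  have hball : ∀ x : G, ∀ u : ℝ, 0 ≤ u → μ (closedBall x u)
      = ENNReal.ofReal (u ^ Module.finrank ℝ G) * μ (ball 0 1) :=
    fun x u hu => Measure.addHaar_closedBall μ x hu
  simp only [hball _ _ (ht _), hball _ _ zero_le_one, ← Finset.sum_mul] at hle
  have h0 : μ (ball (0 : G) 1) ≠ 0 := (measure_ball_pos μ 0 one_pos).ne'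
  have h1 : μ (ball (0 : G) 1) ≠ ⊤ := measure_ball_lt_top.ne
  have hnn : ∀ i ∈ s, 0 ≤ t i ^ Module.finrank ℝ G := fun i _ => pow_nonneg (ht i) _
  rw [ENNReal.mul_le_mul_iff_left h0 h1, ← ENNReal.ofReal_sum_of_nonneg hnn,
    ENNReal.ofReal_le_ofReal_iff (Finset.sum_nonneg hnn), one_pow] at hle
  linarith

end Packing

section Avoidance

variable {F : Type*} [NormedAddCommGroup F] [NormedSpace ℂ F] [FiniteDimensional ℂ F]

lemma exists_mem_submodule_forall_le_norm_add {ι : Type*} (s : Finset ι) (y : ι → F)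
    (T : Submodule ℂ F) {d : ℕ} (hT : Module.finrank ℂ T = d) (Φ : F →L[ℂ] F) {b : ℝ} {σ : ι → ℝ}
    (hb : 0 < b) (hσ : ∀ i, 0 ≤ σ i) (hΦ : ∀ a ∈ T, b * ‖a‖ ≤ ‖Φ a‖)
    (hcard : ∑ i ∈ s, (4 * σ i / b) ^ (2 * d) < 1) :
    ∃ a ∈ T, ‖a‖ ≤ 1 ∧ ∀ i ∈ s, 2 * σ i ≤ ‖y i + Φ a‖ := by
  classical
  have : FiniteDimensional ℝ T := FiniteDimensional.complexToReal T
  have hdim : Module.finrank ℝ T = 2 * d := by rw [finrank_real_of_complex, hT]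
  set c : ι → T := fun i => if h : ∃ a : T, ‖y i + Φ a‖ < 2 * σ i then h.choose else 0
  obtain ⟨x, hx1, hx⟩ := exists_norm_le_one_forall_lt_dist s c (t := fun i => 4 * σ i / b)
    (fun i => by have := hσ i; positivity) (by rwa [hdim])
  refine ⟨x, x.2, hx1, fun i hi => ?_⟩
  by_contra! hlt
  have hex : ∃ a : T, ‖y i + Φ a‖ < 2 * σ i := ⟨x, hlt⟩
  have hc : ‖y i + Φ (c i)‖ < 2 * σ i := by
    have : c i = hex.choose := dif_pos hex
    rw [this]
    exact hex.choose_spec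
  have h1 := hx i hi
  have h2 : b * ‖(x : F) - c i‖ ≤ ‖Φ ((x : F) - c i)‖ := hΦ _ (T.sub_mem x.2 (c i).2)
  have h3 : ‖Φ ((x : F) - c i)‖ < 4 * σ i := by
    have : Φ ((x : F) - c i) = (y i + Φ x) - (y i + Φ (c i)) := by rw [map_sub]; abel
    rw [this]
    linarith [norm_sub_le (y i + Φ x) (y i + Φ (c i))]
  have h4 : dist x (c i) = ‖(x : F) - c i‖ := by rw [dist_eq_norm]; rfl
  rw [h4, div_lt_iff₀ hb] at h1
  linarith

end Avoidance

section BoundaryPacking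

variable {E : Type*} [NormedAddCommGroup E] [NormedSpace ℝ E] [FiniteDimensional ℝ E]

/-- Separated subsets of `X` near `p` satisfy the packing bound of dimension `k`. -/
def PackingBound (X : Set E) (k : ℕ) (K₁ : ℝ) : Prop :=
  ∀ s : Finset E, ↑s ⊆ X → ∀ t > 0, (∀ x ∈ s, ∀ y ∈ s, x ≠ y → t ≤ dist x y) →
    ∀ y : E, ∀ R ≥ 0, (∀ x ∈ s, dist x y ≤ R) → (s.card : ℝ) ≤ (K₁ * (R / t + 1)) ^ k

lemma exists_packingBound {X : Set E} {r : E → ℝ} {r' : E →L[ℝ] ℝ} {p : E}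
    (hr : HasStrictFDerivAt r r' p) (hr' : r' ≠ 0) (hX : ∀ x ∈ X, r x = 0) {k : ℕ}
    (hk : Module.finrank ℝ E = k + 1) :
    ∃ K₁ ≥ 1, ∃ ρ₀ > 0, PackingBound (X ∩ closedBall p ρ₀) k K₁ := by
  obtain ⟨v₁, hv₁⟩ : ∃ v, r' v ≠ 0 := by
    by_contra! h
    exact hr' (ContinuousLinearMap.ext h)
  obtain ⟨v₀, hv₀⟩ : ∃ v, r' v = 1 := ⟨(r' v₁)⁻¹ • v₁, by simp [hv₁]⟩
  set H : Submodule ℝ E := LinearMap.ker (r' : E →ₗ[ℝ] ℝ)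
  have hH : Module.finrank ℝ H = k := by
    have h1 := Module.Dual.finrank_ker_add_one_of_ne_zero (f := (r' : E →ₗ[ℝ] ℝ))
      (by intro h; apply hv₁; exact LinearMap.congr_fun h v₁)
    have h2 : Module.finrank ℝ H + 1 = Module.finrank ℝ E := h1
    omega
  set Q : E → H := fun x => ⟨x - r' x • v₀, by
    simp only [H, LinearMap.mem_ker, ContinuousLinearMap.coe_coe, map_sub, map_smul, hv₀,
      smul_eq_mul, mul_one, sub_self]⟩
  have hQ : ∀ x y, dist (Q x) (Q y) = ‖(x - y) - r' (x - y) • v₀‖ := fun x y => by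
    have : dist (Q x) (Q y) = dist (x - r' x • v₀) (y - r' y • v₀) := rfl
    rw [this, dist_eq_norm, map_sub, sub_smul]
    congr 1
    abel
  set M := 1 + ‖r'‖ * ‖v₀‖
  have hM : 1 ≤ M := by simp only [M]; linarith [mul_nonneg (norm_nonneg r') (norm_nonneg v₀)]
  have hQle : ∀ x y, dist (Q x) (Q y) ≤ M * dist x y := fun x y => by
    rw [hQ, dist_eq_norm]
    refine (norm_sub_le _ _).trans ?_
    have : ‖r' (x - y) • v₀‖ ≤ ‖r'‖ * ‖x - y‖ * ‖v₀‖ := by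
      rw [norm_smul]; gcongr; exact r'.le_opNorm _
    calc ‖x - y‖ + ‖r' (x - y) • v₀‖ ≤ ‖x - y‖ + ‖r'‖ * ‖x - y‖ * ‖v₀‖ := by gcongr
      _ = _ := by simp only [M]; ring
  obtain ⟨ρ₀, hρ₀, hstrict⟩ : ∃ ρ₀ > 0, ∀ x ∈ closedBall p ρ₀, ∀ y ∈ closedBall p ρ₀,
      ‖r x - r y - r' (x - y)‖ ≤ 1 / (2 * (‖v₀‖ + 1)) * ‖x - y‖ := by
    have := hr.isLittleO.def (c := 1 / (2 * (‖v₀‖ + 1))) (by positivity)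
    rw [nhds_prod_eq] at this
    obtain ⟨t, ht, hsub⟩ := Filter.mem_prod_same_iff.1 this
    obtain ⟨ρ₃, hρ₃, hsub'⟩ := Metric.nhds_basis_closedBall.mem_iff.1 ht
    exact ⟨ρ₃, hρ₃, fun x hx y hy => hsub (mk_mem_prod (hsub' hx) (hsub' hy))⟩
  refine ⟨4 * M + 1, by linarith, ρ₀, hρ₀, fun s hs t ht hsep y R hR hyR => ?_⟩
  have hQge : ∀ x ∈ s, ∀ y ∈ s, dist x y / 2 ≤ dist (Q x) (Q y) := fun x hx y hy => by
    have h1 := hstrict x (hs hx).2 y (hs hy).2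
    rw [hX x (hs hx).1, hX y (hs hy).1, sub_self, zero_sub, norm_neg] at h1
    have h2 : ‖r' (x - y) • v₀‖ ≤ ‖x - y‖ / 2 := by
      rw [norm_smul]
      calc ‖r' (x - y)‖ * ‖v₀‖ ≤ 1 / (2 * (‖v₀‖ + 1)) * ‖x - y‖ * (‖v₀‖ + 1) := by
            gcongr; linarith
        _ = _ := by field_simp
    rw [hQ, dist_eq_norm]
    linarith [norm_sub_norm_le (x - y) (r' (x - y) • v₀)]
  have hcard := card_mul_pow_le_of_separated s Q (Q y) (t := t / 2) (R := M * R) (by positivity)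
    (by positivity) (fun i hi j hj hij => by linarith [hQge i hi j hj, hsep i hi j hj hij])
    (fun i hi => (hQle i y).trans (by gcongr; exact hyR i hi))
  rw [hH, ← le_div_iff₀ (by positivity), ← div_pow] at hcard
  refine hcard.trans ?_
  have : (M * R + t / 2 / 2) / (t / 2 / 2) = 4 * M * (R / t) + 1 := by field_simp; ring
  rw [this]
  have : 0 ≤ R / t := by positivity
  gcongr
  nlinarith

omit [NormedSpace ℝ E] [FiniteDimensional ℝ E] in
lemma PackingBound.mono {X Y : Set E} {k : ℕ} {K₁ : ℝ} (h : PackingBound X k K₁) (hYX : Y ⊆ X) :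
    PackingBound Y k K₁ := fun s hs => h s (hs.trans hYX)

end BoundaryPacking

section Greedy

variable {E : Type*} [NormedAddCommGroup E]

/-- A set satisfying a packing bound contains finite maximal separated subsets of each
bounded subset. -/
lemma PackingBound.exists_net {X : Set E} {k : ℕ} {K₁ : ℝ} (hX : PackingBound X k K₁)
    {Z : Set E} (hZ : Z ⊆ X) {y : E} {R t : ℝ} (hR : 0 ≤ R) (ht : 0 < t)
    (hZR : ∀ z ∈ Z, dist z y ≤ R) :
    ∃ L : Finset E, ↑L ⊆ Z ∧ (∀ x ∈ L, ∀ y ∈ L, x ≠ y → t ≤ dist x y) ∧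
      (∀ z ∈ Z, ∃ l ∈ L, dist z l < t) ∧ (L.card : ℝ) ≤ (K₁ * (R / t + 1)) ^ k := by
  classical
  by_contra! hcon
  have key : ∀ n : ℕ, ∃ L : Finset E, ↑L ⊆ Z ∧
      (∀ x ∈ L, ∀ y ∈ L, x ≠ y → t ≤ dist x y) ∧ L.card = n := by
    intro n
    induction n with
    | zero => exact ⟨∅, by simp, by simp, rfl⟩
    | succ n ih =>
      obtain ⟨L, hL, hsep, hcard⟩ := ih
      have hb := hX L (hL.trans hZ) t ht hsep y R hR fun x hx => hZR x (hL hx)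
      obtain ⟨z, hz, hzL⟩ : ∃ z ∈ Z, ∀ l ∈ L, t ≤ dist z l := by
        by_contra! h
        exact absurd hb (not_le.2 (hcon L hL hsep h))
      have hzn : z ∉ L := fun h => by
        have := hzL z h
        rw [dist_self] at this
        linarith
      refine ⟨insert z L, ?_, ?_, by rw [Finset.card_insert_of_notMem hzn, hcard]⟩
      · rw [Finset.coe_insert]
        exact insert_subset hz hL
      · intro x hx y hy hxy
        rcases Finset.mem_insert.1 hx with rfl | hx' <;>
          rcases Finset.mem_insert.1 hy with rfl | hy'
        · exact absurd rfl hxy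
        · exact hzL y hy'
        · rw [dist_comm]; exact hzL x hx'
        · exact hsep x hx' y hy' hxy
  obtain ⟨n, hn⟩ := exists_nat_gt ((K₁ * (R / t + 1)) ^ k)
  obtain ⟨L, hL, hsep, hcard⟩ := key n
  have hb := hX L (hL.trans hZ) t ht hsep y R hR fun x hx => hZR x (hL hx)
  rw [hcard] at hb
  linarith

variable {F : Type*} [NormedAddCommGroup F] [NormedSpace ℂ F]

/-- If the new coefficient stays away from the negatives of the normalized partial sums at the
points of the nets, then the partial sums with the new term satisfy the lower bound at all points
where the weights are comparable. -/
lemma norm_smul_le_norm_add_of_ratio {ι : Type*} (S : Finset ι) (e₀ : ℂ) (e e' : ι → ℂ) (e₀' : ℂ)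
    (c : ι → F) (c₀ : F) {B η η' lam σ : ℝ} {m : ℕ} (hB : 1 ≤ B) (hη : 0 < η)
    (hη' : 0 < η') (hcard : S.card ≤ m)
    (hc : ∀ i ∈ S, ‖c i‖ ≤ B) (he₀ : e₀ ≠ 0)
    (hlam : lam = η' / (2 * (m + 1) * B)) (hσ : σ = 2 * B * η' / η)
    (hgood' : ∀ i ∈ S, ‖e' i / e₀'‖ ≤ 2 * B / η)
    (hratio : ∀ i ∈ S, ‖e i / e₀ - e' i / e₀'‖ ≤ 2 * lam * ‖e' i / e₀'‖)
    (hlow : 2 * σ ≤ ‖∑ i ∈ S, (e' i / e₀') • c i + c₀‖) :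
    σ * ‖e₀‖ ≤ ‖∑ i ∈ S, e i • c i + e₀ • c₀‖ := by
  have h1 : ∑ i ∈ S, e i • c i + e₀ • c₀ = e₀ • (∑ i ∈ S, (e i / e₀) • c i + c₀) := by
    rw [smul_add, Finset.smul_sum]
    congr 1
    refine Finset.sum_congr rfl fun i _ => ?_
    rw [smul_smul, mul_div_cancel₀ _ he₀]
  have hlam0 : 0 ≤ lam := by rw [hlam]; positivity
  have hdiff : ‖∑ i ∈ S, (e i / e₀) • c i - ∑ i ∈ S, (e' i / e₀') • c i‖ ≤ σ := by
    rw [← Finset.sum_sub_distrib]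
    have hterm : ∀ i ∈ S, ‖(e i / e₀) • c i - (e' i / e₀') • c i‖
        ≤ 2 * lam * (2 * B / η) * B := by
      intro i hi
      rw [← sub_smul, norm_smul]
      have := (hratio i hi).trans
        (mul_le_mul_of_nonneg_left (hgood' i hi) (by positivity : 0 ≤ 2 * lam))
      exact mul_le_mul this (hc i hi) (norm_nonneg _) (by positivity)
    refine (norm_sum_le_of_le _ hterm).trans ?_
    rw [Finset.sum_const, nsmul_eq_mul]
    calc (S.card : ℝ) * (2 * lam * (2 * B / η) * B) ≤ (m + 1) * (2 * lam * (2 * B / η) * B) := by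
          gcongr
          have : (S.card : ℝ) ≤ m := by exact_mod_cast hcard
          linarith
      _ = σ := by
          rw [hlam, hσ]
          field_simp
  rw [h1, norm_smul, mul_comm]
  gcongr
  have : ∑ i ∈ S, (e' i / e₀') • c i + c₀ = (∑ i ∈ S, (e i / e₀) • c i + c₀)
      - (∑ i ∈ S, (e i / e₀) • c i - ∑ i ∈ S, (e' i / e₀') • c i) := by abel
  rw [this] at hlow
  linarith [norm_sub_le (∑ i ∈ S, (e i / e₀) • c i + c₀)
    (∑ i ∈ S, (e i / e₀) • c i - ∑ i ∈ S, (e' i / e₀') • c i)]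

/-- Lower bound for a partial sum when some old weight dominates the new one. -/
lemma norm_smul_le_norm_add_of_dominated {ι : Type*} (S : Finset ι) (e₀ : ℂ) (e : ι → ℂ)
    (c : ι → F) (c₀ : F) {B η η' : ℝ} (hB : 1 ≤ B) (hη : 0 < η)
    (hη1 : η' ≤ 1) (hη2 : 2 * η' ≤ η) (hc₀ : ‖c₀‖ ≤ B)
    (hold : ∀ i ∈ S, η * ‖e i‖ ≤ ‖∑ i ∈ S, e i • c i‖)
    (hbad : ∃ i ∈ S, 2 * B / η * ‖e₀‖ ≤ ‖e i‖) :
    η' * ‖e₀‖ ≤ ‖∑ i ∈ S, e i • c i + e₀ • c₀‖ ∧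
      ∀ i ∈ S, η' * ‖e i‖ ≤ ‖∑ i ∈ S, e i • c i + e₀ • c₀‖ := by
  set W := ∑ i ∈ S, e i • c i
  obtain ⟨j, hj, hjb⟩ := hbad
  have h1 : 2 * (B * ‖e₀‖) ≤ ‖W‖ := by
    refine le_trans ?_ (hold j hj)
    have := mul_le_mul_of_nonneg_left hjb hη.le
    calc 2 * (B * ‖e₀‖) = η * (2 * B / η * ‖e₀‖) := by field_simp
      _ ≤ _ := this
  have h2 : ‖e₀ • c₀‖ ≤ B * ‖e₀‖ := by
    rw [norm_smul, mul_comm]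
    gcongr
  have h3 : ‖W‖ ≤ ‖W + e₀ • c₀‖ + ‖e₀ • c₀‖ := by
    simpa using norm_sub_le (W + e₀ • c₀) (e₀ • c₀)
  have h4 : ‖W‖ ≤ 2 * ‖W + e₀ • c₀‖ := by linarith
  constructor
  · have : η' * ‖e₀‖ ≤ B * ‖e₀‖ := by gcongr; linarith
    linarith
  · intro i hi
    have h5 := hold i hi
    have h6 : 2 * η' * ‖e i‖ ≤ η * ‖e i‖ := by gcongr
    linarith

variable [FiniteDimensional ℂ F]

/-- Greedy choice of coefficients so that all sums of neighbouring weighted terms are bounded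
below by each of their weights. -/
lemma PackingBound.exists_coefficients {X : Set E} {k d m : ℕ} {K₁ R r b B Λ : ℝ} {η : ℕ → ℝ}
    {e : E → E → ℂ} (hX : PackingBound X k K₁) (hk : 2 * d = k + 1) (hr : 0 < r) (hR : 0 ≤ R)
    (hb : 0 < b) (hB : 1 ≤ B) (hΛ : 0 < Λ) (he : ∀ z ζ, e z ζ ≠ 0)
    (hratio : ∀ z ∈ X, ∀ z' ∈ X, ∀ ζ ∈ X, ∀ ζ' ∈ X, ∀ τ ≥ 0, τ * Λ ≤ 1 → dist z z' ≤ τ * r →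
      dist ζ ζ' ≤ 2 * R * r →
      ‖e z ζ / e z ζ' - e z' ζ / e z' ζ'‖ ≤ 2 * (τ * Λ) * ‖e z' ζ / e z' ζ'‖)
    (hη : ∀ j, 0 < η j) (hη1 : ∀ j, η j ≤ 1) (hη2 : ∀ j, 2 * η (j + 1) ≤ η j)
    (hm : (K₁ * (2 * R + 1)) ^ k ≤ m)
    (hsmall : ∀ j ≤ m, 2 ^ m * ((K₁ * (R / (η (j + 1) / (2 * (m + 1) * B * Λ)) + 1)) ^ k *
      (4 * (2 * B * η (j + 1) / η j) / b) ^ (k + 1)) < 1)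
    (s : Finset E) (hs : ↑s ⊆ X) (hsep : ∀ x ∈ s, ∀ y ∈ s, x ≠ y → r ≤ dist x y)
    (T : E → Submodule ℂ F) (Φ : E → F →L[ℂ] F) (hT : ∀ ζ ∈ s, Module.finrank ℂ (T ζ) = d)
    (hTΦ : ∀ ζ ∈ s, ∀ a ∈ T ζ, b * ‖a‖ ≤ ‖Φ ζ a‖) (hΦ : ∀ ζ ∈ s, ‖Φ ζ‖ ≤ B) :
    ∃ a : E → F, (∀ ζ ∈ s, ‖a ζ‖ ≤ 1) ∧ ∀ S ⊆ s, ∀ z ∈ X, (∀ ζ ∈ S, dist z ζ ≤ R * r) →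
      ∀ ζ ∈ S, η S.card * ‖e z ζ‖ ≤ ‖∑ ξ ∈ S, e z ξ • Φ ξ (a ξ)‖ := by
  classical
  induction s using Finset.induction_on with
  | empty =>
    refine ⟨fun _ => 0, by simp, fun S hS z _ _ ζ hζ => ?_⟩
    exact absurd (hS hζ) (Finset.notMem_empty ζ)
  | insert ξ s hξ ih =>
    have hsX : ↑s ⊆ X := fun x hx => hs (Finset.mem_insert_of_mem hx)
    obtain ⟨a, ha1, ha⟩ := ih hsX
      (fun x hx y hy => hsep x (Finset.mem_insert_of_mem hx) y (Finset.mem_insert_of_mem hy))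
      (fun ζ hζ => hT ζ (Finset.mem_insert_of_mem hζ))
      (fun ζ hζ => hTΦ ζ (Finset.mem_insert_of_mem hζ))
      (fun ζ hζ => hΦ ζ (Finset.mem_insert_of_mem hζ))
    have hξX : ξ ∈ X := hs (Finset.mem_insert_self ξ s)
    set c : E → F := fun ζ => Φ ζ (a ζ)
    have hc : ∀ ζ ∈ s, ‖c ζ‖ ≤ B := fun ζ hζ =>
      ((Φ ζ).le_opNorm (a ζ)).trans
        ((mul_le_of_le_one_right (norm_nonneg _) (ha1 ζ hζ)).trans
          (hΦ ζ (Finset.mem_insert_of_mem hζ)))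
    set N := s.filter fun ζ => dist ζ ξ ≤ 2 * R * r
    have hNcard : N.card ≤ m := by
      have h := hX N (fun x hx => hsX (Finset.mem_filter.1 hx).1) r hr
        (fun x hx y hy => hsep x (Finset.mem_insert_of_mem (Finset.mem_filter.1 hx).1) y
          (Finset.mem_insert_of_mem (Finset.mem_filter.1 hy).1)) ξ (2 * R * r) (by positivity)
        (fun x hx => (Finset.mem_filter.1 hx).2)
      rw [mul_div_cancel_right₀ _ hr.ne'] at h
      exact_mod_cast h.trans hm
    set τ : ℕ → ℝ := fun j => η (j + 1) / (2 * (m + 1) * B * Λ)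
    have hτ : ∀ j, 0 < τ j := fun j => div_pos (hη _) (by positivity)
    have hτΛ : ∀ j, τ j * Λ = η (j + 1) / (2 * (m + 1) * B) := fun j => by
      simp only [τ]
      field_simp
    set Z : Finset E → Set E := fun S => {z ∈ X | dist z ξ ≤ R * r ∧
      ∀ i ∈ S, ‖e z i / e z ξ‖ ≤ 2 * B / η S.card}
    have hnet : ∀ S : Finset E, ∃ L : Finset E, ↑L ⊆ Z S ∧
        (∀ z ∈ Z S, ∃ l ∈ L, dist z l < τ S.card * r) ∧
        (L.card : ℝ) ≤ (K₁ * (R / τ S.card + 1)) ^ k := by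
      intro S
      obtain ⟨L, h1, -, h2, h3⟩ := hX.exists_net (Z := Z S) (fun z hz => hz.1) (y := ξ)
        (R := R * r) (t := τ S.card * r) (by positivity) (mul_pos (hτ _) hr) (fun z hz => hz.2.1)
      rw [mul_div_mul_right _ _ hr.ne'] at h3
      exact ⟨L, h1, h2, h3⟩
    choose L hLZ hLnet hLcard using hnet
    set I : Finset (Σ _ : Finset E, E) := N.powerset.sigma L
    set σ : ℕ → ℝ := fun j => 2 * B * η (j + 1) / η j
    have hσ : ∀ j, 0 < σ j := fun j => div_pos (mul_pos (by positivity) (hη _)) (hη _)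
    have hsum : ∑ i ∈ I, (4 * σ i.1.card / b) ^ (2 * d) < 1 := by
      rw [Finset.sum_sigma]
      have hin : ∀ S ∈ N.powerset, ∑ _l ∈ L S, (4 * σ S.card / b) ^ (2 * d) < 1 / 2 ^ m := by
        intro S hS
        rw [Finset.sum_const, nsmul_eq_mul, lt_div_iff₀ (by positivity), mul_comm, hk]
        refine lt_of_le_of_lt ?_ (hsmall S.card
          ((Finset.card_le_card (Finset.mem_powerset.1 hS)).trans hNcard))
        have : 0 ≤ (4 * σ S.card / b) ^ (k + 1) := by have := hσ S.card; positivity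
        gcongr
        exact hLcard S
      refine (Finset.sum_lt_sum_of_nonempty ⟨∅, Finset.empty_mem_powerset N⟩ hin).trans_le ?_
      rw [Finset.sum_const, Finset.card_powerset, nsmul_eq_mul, mul_one_div,
        div_le_one (by positivity)]
      push_cast
      exact pow_le_pow_right₀ one_le_two hNcard
    obtain ⟨a₀, -, ha₀, hlow⟩ := exists_mem_submodule_forall_le_norm_add I
      (fun i => ∑ ζ ∈ i.1, (e i.2 ζ / e i.2 ξ) • c ζ) (T ξ) (hT ξ (Finset.mem_insert_self _ _))
      (Φ ξ) (σ := fun i => σ i.1.card) hb (fun i => (hσ _).le)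
      (hTΦ ξ (Finset.mem_insert_self _ _)) hsum
    have hc₀ : ‖Φ ξ a₀‖ ≤ B := ((Φ ξ).le_opNorm a₀).trans
        ((mul_le_of_le_one_right (norm_nonneg _) ha₀).trans (hΦ ξ (Finset.mem_insert_self _ _)))
    refine ⟨Function.update a ξ a₀, ?_, ?_⟩
    · intro ζ hζ
      by_cases h : ζ = ξ
      · subst h; simpa using ha₀
      · rw [Function.update_of_ne h]
        exact ha1 ζ (Finset.mem_of_mem_insert_of_ne hζ h)
    intro S hS z hz hSz
    by_cases hξS : ξ ∉ S
    · have hS' : S ⊆ s := (Finset.subset_insert_iff_of_notMem hξS).1 hS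
      have : ∑ ζ ∈ S, e z ζ • Φ ζ (Function.update a ξ a₀ ζ) = ∑ ζ ∈ S, e z ζ • Φ ζ (a ζ) :=
        Finset.sum_congr rfl fun ζ hζ => by
          have hne : ζ ≠ ξ := fun h => hξS (h ▸ hζ)
          rw [Function.update_of_ne hne]
      rw [this]
      exact ha S hS' z hz hSz
    rw [not_not] at hξS
    obtain ⟨S', hξS', rfl⟩ : ∃ S', ξ ∉ S' ∧ insert ξ S' = S :=
      ⟨S.erase ξ, Finset.notMem_erase ξ S, Finset.insert_erase hξS⟩
    have hS' : S' ⊆ s := fun ζ hζ => Finset.mem_of_mem_insert_of_ne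
      (hS (Finset.mem_insert_of_mem hζ)) (fun h => hξS' (h ▸ hζ))
    have hsumeq : ∑ ζ ∈ insert ξ S', e z ζ • Φ ζ (Function.update a ξ a₀ ζ)
        = ∑ ζ ∈ S', e z ζ • c ζ + e z ξ • Φ ξ a₀ := by
      rw [Finset.sum_insert hξS', add_comm, Function.update_self]
      congr 1
      exact Finset.sum_congr rfl fun ζ hζ => by
        have hne : ζ ≠ ξ := fun h => hξS' (h ▸ hζ)
        rw [Function.update_of_ne hne]
    rw [hsumeq, Finset.card_insert_of_notMem hξS']
    set j := S'.card
    have hzξ : dist z ξ ≤ R * r := hSz ξ (Finset.mem_insert_self _ _)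
    have hSz' : ∀ ζ ∈ S', dist z ζ ≤ R * r := fun ζ hζ => hSz ζ (Finset.mem_insert_of_mem hζ)
    have hS'N : S' ⊆ N := fun ζ hζ => Finset.mem_filter.2 ⟨hS' hζ, by
      have := dist_triangle_left ζ ξ z
      linarith [hSz' ζ hζ]⟩
    have hold := ha S' hS' z hz hSz'
    suffices hfin : η (j + 1) * ‖e z ξ‖ ≤ ‖∑ ζ ∈ S', e z ζ • c ζ + e z ξ • Φ ξ a₀‖ ∧
        ∀ i ∈ S', η (j + 1) * ‖e z i‖ ≤ ‖∑ ζ ∈ S', e z ζ • c ζ + e z ξ • Φ ξ a₀‖ by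
      intro ζ hζ
      rcases Finset.mem_insert.1 hζ with rfl | hζ
      · exact hfin.1
      · exact hfin.2 ζ hζ
    have heξ : 0 < ‖e z ξ‖ := norm_pos_iff.2 (he z ξ)
    by_cases hbad : ∃ i ∈ S', 2 * B / η j * ‖e z ξ‖ ≤ ‖e z i‖
    · exact norm_smul_le_norm_add_of_dominated S' (e z ξ) (e z) c (Φ ξ a₀) hB (hη j)
        (hη1 _) (hη2 j) hc₀ hold hbad
    push Not at hbad
    have hzZ : z ∈ Z S' := ⟨hz, hzξ, fun i hi => by
      rw [norm_div, div_le_iff₀ heξ]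
      exact (hbad i hi).le⟩
    obtain ⟨l, hl, hzl⟩ := hLnet S' z hzZ
    have hlZ : l ∈ Z S' := hLZ S' hl
    have hlow' := hlow ⟨S', l⟩ (Finset.mem_sigma.2 ⟨Finset.mem_powerset.2 hS'N, hl⟩)
    have hτ1 : τ j * Λ ≤ 1 := by
      rw [hτΛ, div_le_one (by positivity)]
      have h1 := hη1 (j + 1)
      have h2 : (1 : ℝ) ≤ 2 * (m + 1) := by
        have : (0 : ℝ) ≤ m := Nat.cast_nonneg m
        linarith
      have h3 : (1 : ℝ) ≤ 2 * (m + 1) * B := one_le_mul_of_one_le_of_one_le h2 hB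
      linarith
    have hmain : σ j * ‖e z ξ‖ ≤ ‖∑ ζ ∈ S', e z ζ • c ζ + e z ξ • Φ ξ a₀‖ :=
      norm_smul_le_norm_add_of_ratio S' (e z ξ) (e z) (e l) (e l ξ) c (Φ ξ a₀) hB (hη j)
        (hη (j + 1)) ((Finset.card_le_card hS'N).trans hNcard) (fun i hi => hc i (hS' hi))
        (he z ξ) (hτΛ j) rfl hlZ.2.2
        (fun i hi => hratio z hz l hlZ.1 i (hsX (hS' hi)) ξ hξX (τ j) (hτ j).le hτ1 hzl.le
          (Finset.mem_filter.1 (hS'N hi)).2) hlow'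
    have hησ : η (j + 1) ≤ σ j := by
      rw [le_div_iff₀ (hη j)]
      have h1 := mul_le_of_le_one_right (hη (j + 1)).le (hη1 j)
      have h2 : 1 * η (j + 1) ≤ 2 * B * η (j + 1) := by
        have := (hη (j + 1)).le
        gcongr
        linarith
      linarith
    refine ⟨(mul_le_mul_of_nonneg_right hησ heξ.le).trans hmain, fun i hi => ?_⟩
    refine le_trans ?_ hmain
    calc η (j + 1) * ‖e z i‖ ≤ η (j + 1) * (2 * B / η j * ‖e z ξ‖) :=
          mul_le_mul_of_nonneg_left (hbad i hi).le (hη _).le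
      _ = σ j * ‖e z ξ‖ := by simp only [σ]; ring

end Greedy

section Weights

variable {E : Type*} [NormedAddCommGroup E]

lemma summable_mul_add_pow_mul_exp_neg_sq (K : ℝ) (k : ℕ) {c : ℝ} (hc : 0 < c) :
    Summable fun j : ℕ => (K * (j + 2)) ^ k * Real.exp (-(c * (j : ℝ) ^ 2)) := by
  have h0 : Summable fun j : ℕ => |K| ^ k * Real.exp (2 * c) *
      (((j + 2 : ℕ) : ℝ) ^ k * Real.exp (-c * ((j + 2 : ℕ) : ℝ))) :=
    ((summable_nat_add_iff 2).2 (Real.summable_pow_mul_exp_neg_nat_mul k hc)).mul_left _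
  refine Summable.of_norm_bounded h0 fun j => ?_
  have hj : (j : ℝ) ≤ (j : ℝ) ^ 2 := by exact_mod_cast Nat.le_self_pow two_ne_zero j
  rw [norm_mul, norm_pow, norm_mul, Real.norm_eq_abs K, Real.norm_of_nonneg (by positivity),
    Real.norm_of_nonneg (Real.exp_pos _).le, mul_pow]
  have he : Real.exp (-(c * (j : ℝ) ^ 2)) ≤
      Real.exp (2 * c) * Real.exp (-c * ((j + 2 : ℕ) : ℝ)) := by
    rw [← Real.exp_add, Real.exp_le_exp]
    push_cast
    nlinarith
  calc |K| ^ k * ((j : ℝ) + 2) ^ k * Real.exp (-(c * (j : ℝ) ^ 2))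
      ≤ |K| ^ k * ((j : ℝ) + 2) ^ k *
        (Real.exp (2 * c) * Real.exp (-c * ((j + 2 : ℕ) : ℝ))) := by gcongr
    _ = _ := by push_cast; ring

/-- Gaussian sums over separated subsets are bounded uniformly in the scale. -/
lemma PackingBound.exists_sum_exp_le {X : Set E} {k : ℕ} {K₁ c : ℝ} (hX : PackingBound X k K₁)
    (hK₁ : 0 ≤ K₁) (hc : 0 < c) :
    ∃ C₁ ≥ 1, ∀ s : Finset E, ↑s ⊆ X → ∀ r > 0, (∀ x ∈ s, ∀ y ∈ s, x ≠ y → r ≤ dist x y) →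
      ∀ z, ∑ ζ ∈ s, Real.exp (-(c * (dist z ζ / r) ^ 2)) ≤ C₁ := by
  classical
  have hsm := summable_mul_add_pow_mul_exp_neg_sq K₁ k hc
  set u : ℕ → ℝ := fun j => (K₁ * (j + 2)) ^ k * Real.exp (-(c * (j : ℝ) ^ 2))
  have hu : ∀ j, 0 ≤ u j := fun j => by positivity
  refine ⟨max 1 (∑' j, u j), le_max_left _ _, fun s hs r hr hsep z => ?_⟩
  refine le_trans ?_ (le_max_right _ _)
  set φ : E → ℕ := fun ζ => ⌊dist z ζ / r⌋₊
  rw [← Finset.sum_fiberwise_of_maps_to (g := φ) (t := s.image φ)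
    (fun ζ hζ => Finset.mem_image_of_mem φ hζ)]
  refine le_trans (Finset.sum_le_sum fun j _ => ?_) (hsm.sum_le_tsum (s.image φ) fun j _ => hu j)
  have hterm : ∀ ζ ∈ s.filter (fun ζ => φ ζ = j),
      Real.exp (-(c * (dist z ζ / r) ^ 2)) ≤ Real.exp (-(c * (j : ℝ) ^ 2)) := by
    intro ζ hζ
    have h : (j : ℝ) ≤ dist z ζ / r := by
      rw [← (Finset.mem_filter.1 hζ).2]
      exact Nat.floor_le (by positivity)
    gcongr
  refine (Finset.sum_le_sum hterm).trans ?_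
  rw [Finset.sum_const, nsmul_eq_mul]
  have hcard := hX (s.filter (fun ζ => φ ζ = j))
    (fun x hx => hs (Finset.mem_filter.1 hx).1) r hr
    (fun x hx y hy => hsep x (Finset.mem_filter.1 hx).1 y (Finset.mem_filter.1 hy).1) z
    ((j + 1) * r) (by positivity) (fun ζ hζ => by
      have h : dist z ζ / r < j + 1 := by
        rw [← (Finset.mem_filter.1 hζ).2]
        exact Nat.lt_floor_add_one _
      rw [dist_comm]
      exact ((div_lt_iff₀ hr).1 h).le)
  rw [mul_div_cancel_right₀ _ hr.ne'] at hcard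
  have : ((j : ℝ) + 1 + 1) = j + 2 := by ring
  rw [this] at hcard
  exact mul_le_mul_of_nonneg_right hcard (Real.exp_pos _).le

lemma exists_scale (k : ℕ) (V Y : ℝ) {θ : ℝ} (hθ : 0 < θ) :
    ∃ A : ℝ, 1 ≤ A ∧ 1 ≤ θ * A ∧ Y ≤ A ∧ V * (A ^ k * Real.exp (-(θ * A))) < 1 := by
  have h1 : Filter.Tendsto (fun A : ℝ => V * (A ^ k * Real.exp (-(θ * A)))) Filter.atTop
      (nhds 0) := by
    have h := tendsto_rpow_mul_exp_neg_mul_atTop_nhds_zero (k : ℝ) θ hθ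
    have h2 := h.const_mul V
    rw [mul_zero] at h2
    refine h2.congr fun A => ?_
    rw [Real.rpow_natCast, neg_mul]
  have h2 := h1.eventually (gt_mem_nhds one_pos)
  have h3 := (Filter.tendsto_id.const_mul_atTop hθ).eventually_ge_atTop (1 : ℝ)
  obtain ⟨A, hA⟩ := (((Filter.eventually_ge_atTop (1 : ℝ)).and h3).and
    ((Filter.eventually_ge_atTop Y).and h2)).exists
  exact ⟨A, hA.1.1, hA.1.2, hA.2.1, hA.2.2⟩

/-- The superexponentially decreasing thresholds make the excluded volumes small. -/
lemma excluded_volume_lt_one {k m : ℕ} {K₁ R B b C A η η' Q : ℝ} (hK₁ : 0 ≤ K₁)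
    (hR : 0 < R) (hB : 1 ≤ B) (hb : 0 < b) (hC : 1 ≤ C) (hA : 1 ≤ A) (hη : 0 < η) (hη1 : η ≤ 1)
    (hη' : η' = η ^ (k + 2)) (hQ : Q = K₁ * (4 * (m + 1) * B * C * R ^ 2 + 1))
    (hsmall : 2 ^ m * Q ^ k * (8 * B / b) ^ (k + 1) * (A ^ k * η) < 1) :
    2 ^ m * ((K₁ * (R / (η' / (2 * (m + 1) * B * (2 * C * R * A))) + 1)) ^ k *
      (4 * (2 * B * η' / η) / b) ^ (k + 1)) < 1 := by
  have hη'0 : 0 < η' := by rw [hη']; positivity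
  have hη'1 : η' ≤ 1 := by rw [hη']; exact pow_le_one₀ hη.le hη1
  have h1 : K₁ * (R / (η' / (2 * (m + 1) * B * (2 * C * R * A))) + 1) ≤ Q * A / η' := by
    rw [hQ]
    have e1 : R / (η' / (2 * (m + 1) * B * (2 * C * R * A)))
        = 4 * (m + 1) * B * C * R ^ 2 * A / η' := by field_simp; ring
    have e2 : 1 ≤ A / η' := by rw [le_div_iff₀ hη'0]; linarith
    rw [e1]
    calc K₁ * (4 * (m + 1) * B * C * R ^ 2 * A / η' + 1)
        ≤ K₁ * (4 * (m + 1) * B * C * R ^ 2 * A / η' + A / η') := by gcongr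
      _ = _ := by ring
  refine lt_of_le_of_lt ?_ hsmall
  calc 2 ^ m * ((K₁ * (R / (η' / (2 * (m + 1) * B * (2 * C * R * A))) + 1)) ^ k *
      (4 * (2 * B * η' / η) / b) ^ (k + 1))
      ≤ 2 ^ m * ((Q * A / η') ^ k * (4 * (2 * B * η' / η) / b) ^ (k + 1)) := by gcongr
    _ = 2 ^ m * Q ^ k * (8 * B / b) ^ (k + 1) * (A ^ k * (η' / η ^ (k + 1))) := by
        have e3 : 4 * (2 * B * η' / η) / b = (8 * B / b) * (η' / η) := by ring
        rw [e3, mul_pow, div_pow (Q * A), div_pow η', mul_pow, pow_succ η' k]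
        field_simp
    _ = _ := by
        rw [hη', pow_succ η (k + 1), mul_div_cancel_left₀ _ (by positivity)]

variable [NormedSpace ℂ E]

/-- The peaking exponentials centred at `ζ`. -/
def SupportData.weight {D : Set E} {p : E} (sd : SupportData D p) (N : ℝ) (z ζ : E) : ℂ :=
  Complex.exp (N * sd.P z ζ)

namespace SupportData

variable {D : Set E} {p : E} (sd : SupportData D p)

lemma weight_ne_zero (N : ℝ) (z ζ : E) : sd.weight N z ζ ≠ 0 := Complex.exp_ne_zero _

lemma contDiff_weight (N : ℝ) (ζ : E) : ContDiff ℂ (⊤ : ℕ∞) fun z => sd.weight N z ζ :=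
  (contDiff_const.mul (sd.contDiff ζ)).cexp

lemma norm_weight (N : ℝ) (z ζ : E) :
    ‖sd.weight N z ζ‖ = Real.exp (N * (sd.P z ζ).re) := by
  rw [weight, Complex.norm_exp, Complex.re_ofReal_mul]

lemma norm_weight_le {A r : ℝ} (hA : 0 ≤ A) {z ζ : E} (hz : z ∈ closure D)
    (hz' : z ∈ closedBall p sd.rad) (hζ : ζ ∈ frontier D) (hζ' : ζ ∈ closedBall p sd.rad) :
    ‖sd.weight (A / r ^ 2) z ζ‖ ≤ Real.exp (-(sd.c * A * (dist z ζ / r) ^ 2)) := by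
  rw [norm_weight, Real.exp_le_exp]
  calc A / r ^ 2 * (sd.P z ζ).re ≤ A / r ^ 2 * (-(sd.c * ‖z - ζ‖ ^ 2)) := by
        gcongr
        exact sd.re_le z hz hz' ζ hζ hζ'
    _ = _ := by rw [dist_eq_norm, div_pow]; ring

lemma le_norm_weight {A r : ℝ} (hA : 0 ≤ A) {z ζ : E} (hz : z ∈ frontier D)
    (hz' : z ∈ closedBall p sd.rad) (hζ : ζ ∈ frontier D) (hζ' : ζ ∈ closedBall p sd.rad) :
    Real.exp (-(sd.C * A * (dist z ζ / r) ^ 2)) ≤ ‖sd.weight (A / r ^ 2) z ζ‖ := by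
  rw [norm_weight, Real.exp_le_exp]
  calc -(sd.C * A * (dist z ζ / r) ^ 2) = A / r ^ 2 * (-(sd.C * ‖z - ζ‖ ^ 2)) := by
        rw [dist_eq_norm, div_pow]; ring
    _ ≤ _ := by
        gcongr
        exact sd.re_ge z hz hz' ζ hζ hζ'

lemma norm_weight_div_sub_le {A r R τ : ℝ} (hA : 0 ≤ A) (hr : 0 < r) (hτ : 0 ≤ τ)
    (hτ1 : τ * (2 * sd.C * R * A) ≤ 1) {z z' ζ ζ' : E} (hz : z ∈ closedBall p sd.rad)
    (hz' : z' ∈ closedBall p sd.rad) (hζ : ζ ∈ closedBall p sd.rad)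
    (hζ' : ζ' ∈ closedBall p sd.rad) (hzz : dist z z' ≤ τ * r) (hζζ : dist ζ ζ' ≤ 2 * R * r) :
    ‖sd.weight (A / r ^ 2) z ζ / sd.weight (A / r ^ 2) z ζ'
      - sd.weight (A / r ^ 2) z' ζ / sd.weight (A / r ^ 2) z' ζ'‖
      ≤ 2 * (τ * (2 * sd.C * R * A)) *
        ‖sd.weight (A / r ^ 2) z' ζ / sd.weight (A / r ^ 2) z' ζ'‖ := by
  set N : ℝ := A / r ^ 2 with hN
  have hC : 0 ≤ sd.C := zero_le_one.trans sd.C_ge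
  have hdiv : ∀ x, sd.weight N x ζ / sd.weight N x ζ'
      = Complex.exp (N * (sd.P x ζ - sd.P x ζ')) := fun x => by
    rw [weight, weight, ← Complex.exp_sub, mul_sub]
  rw [hdiv, hdiv]
  set v : ℂ := N * ((sd.P z ζ - sd.P z ζ') - (sd.P z' ζ - sd.P z' ζ')) with hv
  have hvn : ‖v‖ ≤ τ * (2 * sd.C * R * A) := by
    rw [hv, norm_mul, Complex.norm_real, Real.norm_of_nonneg (by positivity)]
    have h := sd.norm_sub_le z hz z' hz' ζ hζ ζ' hζ'
    rw [← dist_eq_norm z z', ← dist_eq_norm ζ ζ'] at h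
    calc N * ‖(sd.P z ζ - sd.P z ζ') - (sd.P z' ζ - sd.P z' ζ')‖
        ≤ N * (sd.C * (dist z z' * dist ζ ζ')) := by gcongr
      _ ≤ N * (sd.C * ((τ * r) * (2 * R * r))) := by gcongr
      _ = τ * (2 * sd.C * R * A) := by rw [hN]; field_simp
  have hsplit : Complex.exp (N * (sd.P z ζ - sd.P z ζ'))
      = Complex.exp (N * (sd.P z' ζ - sd.P z' ζ')) * Complex.exp v := by
    rw [← Complex.exp_add, hv]
    congr 1
    ring
  rw [hsplit, ← mul_sub_one, norm_mul, mul_comm]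
  gcongr
  have := Complex.norm_exp_sub_one_le (hvn.trans hτ1)
  linarith

end SupportData

end Weights

section PeakFamily

variable {E : Type*} [NormedAddCommGroup E] [NormedSpace ℂ E]

/-- Holomorphic weights at scale `r`, concentrated near their centres in `X`, together with
coefficients for which the weighted sums stay bounded below near the centres. -/
structure PeakFamily (X Y : Set E) (F : Type*) [NormedAddCommGroup F] [NormedSpace ℂ F]
    (d : ℕ) (b B κ C₁ c r : ℝ) where
  e : E → E → ℂ
  contDiff : ∀ ζ, ContDiff ℂ (⊤ : ℕ∞) fun z => e z ζ
  sum_le : ∀ s : Finset E, ↑s ⊆ X → (∀ x ∈ s, ∀ y ∈ s, x ≠ y → r ≤ dist x y) → ∀ z ∈ Y,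
    ∀ R ≥ 0, (∀ ζ ∈ s, R * r ≤ dist z ζ) → ∑ ζ ∈ s, ‖e z ζ‖ ≤ C₁ * Real.exp (-(c * R ^ 2))
  exists_coeff : ∀ s : Finset E, ↑s ⊆ X → (∀ x ∈ s, ∀ y ∈ s, x ≠ y → r ≤ dist x y) →
    ∀ (T : E → Submodule ℂ F) (Φ : E → F →L[ℂ] F), (∀ ζ ∈ s, Module.finrank ℂ (T ζ) = d) →
    (∀ ζ ∈ s, ∀ a ∈ T ζ, b * ‖a‖ ≤ ‖Φ ζ a‖) → (∀ ζ ∈ s, ‖Φ ζ‖ ≤ B) →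
    ∃ a : E → F, (∀ ζ ∈ s, ‖a ζ‖ ≤ 1) ∧ ∀ z ∈ X, (∃ ζ ∈ s, dist z ζ ≤ r) →
      κ ≤ ‖∑ ζ ∈ s, e z ζ • Φ ζ (a ζ)‖

variable {F : Type*} [NormedAddCommGroup F] [NormedSpace ℂ F] [FiniteDimensional ℂ F]

lemma SupportData.exists_peakFamily {D : Set E} {p : E} (sd : SupportData D p) {X Y : Set E}
    (hXD : X ⊆ frontier D) (hXp : X ⊆ closedBall p sd.rad) (hYD : Y ⊆ closure D)
    (hYp : Y ⊆ closedBall p sd.rad) {k d : ℕ} {K₁ b B : ℝ} (hX : PackingBound X k K₁)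
    (hK₁ : 1 ≤ K₁) (hk : 2 * d = k + 1) (hb : 0 < b) (hB : 1 ≤ B) :
    ∃ κ > 0, ∃ C₁ ≥ 1, ∃ c > 0, ∀ r > 0, Nonempty (PeakFamily X Y F d b B κ C₁ c r) := by
  classical
  have hc := sd.c_pos
  have hC := sd.C_ge
  obtain ⟨C₁, hC₁, hsum⟩ := hX.exists_sum_exp_le (by linarith) (half_pos hc)
  obtain ⟨R, hR1, hR⟩ : ∃ R : ℝ, 1 ≤ R ∧ sd.C + 2 ≤ sd.c / 2 * R ^ 2 := by
    refine ⟨2 * (sd.C + 2) / sd.c + 1, ?_, ?_⟩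
    · have : 0 ≤ 2 * (sd.C + 2) / sd.c := by positivity
      linarith
    · have h0 : 0 ≤ 2 * (sd.C + 2) / sd.c := by positivity
      have h1 : 2 * (sd.C + 2) / sd.c ≤ (2 * (sd.C + 2) / sd.c + 1) ^ 2 := by nlinarith
      calc sd.C + 2 = sd.c / 2 * (2 * (sd.C + 2) / sd.c) := by field_simp
        _ ≤ _ := by gcongr
  have hR0 : 0 < R := by linarith
  set m : ℕ := ⌈(K₁ * (2 * R + 1)) ^ k⌉₊
  have hm : (K₁ * (2 * R + 1)) ^ k ≤ m := Nat.le_ceil _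
  set θ : ℝ := 1 / (2 * ((k : ℝ) + 2) ^ m) with hθ
  have hθ0 : 0 < θ := by positivity
  set Q : ℝ := K₁ * (4 * (m + 1) * B * sd.C * R ^ 2 + 1) with hQ
  obtain ⟨A, hA1, hAθ, hAY, hAsmall⟩ := exists_scale k
    (2 ^ m * Q ^ k * (8 * B / b) ^ (k + 1)) (2 * B * C₁) hθ0
  have hA0 : 0 < A := by linarith
  set η : ℕ → ℝ := fun j => Real.exp (-(θ * A * ((k : ℝ) + 2) ^ j)) with hηdef
  have hk2 : (1 : ℝ) ≤ (k : ℝ) + 2 := by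
    have : (0 : ℝ) ≤ k := Nat.cast_nonneg k
    linarith
  have hpow : ∀ j : ℕ, (1 : ℝ) ≤ ((k : ℝ) + 2) ^ j := fun j => one_le_pow₀ hk2
  have hη0 : ∀ j, 0 < η j := fun j => Real.exp_pos _
  have hηle : ∀ j, η j ≤ Real.exp (-(θ * A)) := fun j => by
    rw [Real.exp_le_exp, neg_le_neg_iff]
    exact le_mul_of_one_le_right (by positivity) (hpow j)
  have hη1 : ∀ j, η j ≤ 1 := fun j =>
    (hηle j).trans (Real.exp_le_one_iff.2 (by have : 0 ≤ θ * A := by positivity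
                                              linarith))
  have hηsucc : ∀ j, η (j + 1) = η j ^ (k + 2) := fun j => by
    simp only [hηdef, ← Real.exp_nat_mul]
    congr 1
    push_cast
    ring
  have hηhalf : ∀ j, η j ≤ 1 / 2 := fun j => by
    refine (hηle j).trans ((Real.exp_le_exp.2 (neg_le_neg hAθ)).trans ?_)
    have h2 : (2 : ℝ) ≤ Real.exp 1 := by linarith [Real.add_one_le_exp (1 : ℝ)]
    rw [Real.exp_neg, inv_eq_one_div]
    exact one_div_le_one_div_of_le two_pos h2
  have hη2 : ∀ j, 2 * η (j + 1) ≤ η j := fun j => by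
    have h1 : η (j + 1) ≤ η j ^ 2 := by
      rw [hηsucc]
      exact pow_le_pow_of_le_one (hη0 j).le (hη1 j) (by omega)
    nlinarith [hηhalf j, hη0 j]
  have hηm : ∀ j ≤ m, Real.exp (-(A / 2)) ≤ η j := fun j hj => by
    rw [Real.exp_le_exp, neg_le_neg_iff]
    calc θ * A * ((k : ℝ) + 2) ^ j ≤ θ * A * ((k : ℝ) + 2) ^ m := by
          gcongr
      _ = A / 2 := by rw [hθ]; field_simp
  have hsmall : ∀ j ≤ m, 2 ^ m * ((K₁ * (R / (η (j + 1) / (2 * (m + 1) * B *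
      (2 * sd.C * R * A))) + 1)) ^ k * (4 * (2 * B * η (j + 1) / η j) / b) ^ (k + 1)) < 1 := by
    intro j _
    refine excluded_volume_lt_one (by linarith) hR0 hB hb hC hA1 (hη0 j) (hη1 j) (hηsucc j) hQ ?_
    refine lt_of_le_of_lt ?_ hAsmall
    gcongr
    exact hηle j
  have htail : ∀ r > 0, ∀ s : Finset E, ↑s ⊆ X → (∀ x ∈ s, ∀ y ∈ s, x ≠ y → r ≤ dist x y) →
      ∀ z ∈ closure D, z ∈ closedBall p sd.rad → ∀ R' ≥ 0, (∀ ζ ∈ s, R' * r ≤ dist z ζ) →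
      ∑ ζ ∈ s, ‖sd.weight (A / r ^ 2) z ζ‖ ≤ C₁ * Real.exp (-(sd.c / 2 * A * R' ^ 2)) := by
    intro r hr s hs hsep z hz hz' R' hR' hfar
    have hterm : ∀ ζ ∈ s, ‖sd.weight (A / r ^ 2) z ζ‖ ≤
        Real.exp (-(sd.c / 2 * (dist z ζ / r) ^ 2)) * Real.exp (-(sd.c / 2 * A * R' ^ 2)) := by
      intro ζ hζ
      refine (sd.norm_weight_le hA0.le hz hz' (hXD (hs hζ)) (hXp (hs hζ))).trans ?_
      rw [← Real.exp_add, Real.exp_le_exp]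
      have h1 : R' ≤ dist z ζ / r := (le_div_iff₀ hr).2 (hfar ζ hζ)
      have h2 : R' ^ 2 ≤ (dist z ζ / r) ^ 2 := by gcongr
      have h3 : sd.c / 2 * A * R' ^ 2 ≤ sd.c / 2 * A * (dist z ζ / r) ^ 2 := by gcongr
      have h4 : sd.c / 2 * 1 * (dist z ζ / r) ^ 2 ≤ sd.c / 2 * A * (dist z ζ / r) ^ 2 := by
        gcongr
      linarith
    refine (Finset.sum_le_sum hterm).trans ?_
    rw [← Finset.sum_mul]
    gcongr
    exact hsum s hs r hr hsep z
  refine ⟨Real.exp (-((sd.C + 1 / 2) * A)) / 2, by positivity, C₁, hC₁, sd.c / 2, half_pos hc,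
    fun r hr => ⟨⟨sd.weight (A / r ^ 2), sd.contDiff_weight _, ?_, ?_⟩⟩⟩
  · intro s hs hsep z hz R' hR' hfar
    refine (htail r hr s hs hsep z (hYD hz) (hYp hz) R' hR' hfar).trans ?_
    gcongr
    have : sd.c / 2 * 1 ≤ sd.c / 2 * A := by gcongr
    linarith
  · intro s hs hsep T Φ hT hTΦ hΦ
    obtain ⟨a, ha1, ha⟩ := hX.exists_coefficients hk hr hR0.le hb hB
      (by positivity : 0 < 2 * sd.C * R * A) (sd.weight_ne_zero (A / r ^ 2))
      (fun z hz z' hz' ζ hζ ζ' hζ' τ hτ hτ1 h1 h2 => sd.norm_weight_div_sub_le hA0.le hr hτ hτ1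
        (hXp hz) (hXp hz') (hXp hζ) (hXp hζ') h1 h2) hη0 hη1 hη2 hm hsmall s hs hsep T Φ hT hTΦ hΦ
    refine ⟨a, ha1, fun z hz hnear => ?_⟩
    obtain ⟨ζ₀, hζ₀, hzζ₀⟩ := hnear
    set S := s.filter fun ζ => dist z ζ ≤ R * r
    have hSs : S ⊆ s := Finset.filter_subset _ _
    have hζ₀S : ζ₀ ∈ S := Finset.mem_filter.2 ⟨hζ₀, by nlinarith⟩
    have hScard : S.card ≤ m := by
      have h := hX S (fun x hx => hs (hSs hx)) r hr
        (fun x hx y hy => hsep x (hSs hx) y (hSs hy)) z (R * r) (by positivity)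
        (fun x hx => by rw [dist_comm]; exact (Finset.mem_filter.1 hx).2)
      rw [mul_div_cancel_right₀ _ hr.ne'] at h
      have h' : (K₁ * (R + 1)) ^ k ≤ (K₁ * (2 * R + 1)) ^ k := by gcongr; linarith
      exact_mod_cast (h.trans h').trans hm
    have hlow := ha S hSs z hz (fun ζ hζ => (Finset.mem_filter.1 hζ).2) ζ₀ hζ₀S
    have hw : Real.exp (-(sd.C * A)) ≤ ‖sd.weight (A / r ^ 2) z ζ₀‖ := by
      refine le_trans ?_ (sd.le_norm_weight hA0.le (hXD hz) (hXp hz) (hXD (hs hζ₀)) (hXp (hs hζ₀)))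
      rw [Real.exp_le_exp, neg_le_neg_iff]
      refine mul_le_of_le_one_right (by positivity) ?_
      exact pow_le_one₀ (by positivity) ((div_le_one hr).2 hzζ₀)
    have hmain : Real.exp (-((sd.C + 1 / 2) * A)) ≤ η S.card * ‖sd.weight (A / r ^ 2) z ζ₀‖ := by
      calc Real.exp (-((sd.C + 1 / 2) * A)) = Real.exp (-(A / 2)) * Real.exp (-(sd.C * A)) := by
            rw [← Real.exp_add]; congr 1; ring
        _ ≤ _ := mul_le_mul (hηm _ hScard) hw (Real.exp_pos _).le (hη0 _).le
    set S' := s.filter fun ζ => ¬ dist z ζ ≤ R * r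
    have hS's : S' ⊆ s := Finset.filter_subset _ _
    have hsplit : ∑ ζ ∈ S, sd.weight (A / r ^ 2) z ζ • Φ ζ (a ζ)
        + ∑ ζ ∈ S', sd.weight (A / r ^ 2) z ζ • Φ ζ (a ζ)
        = ∑ ζ ∈ s, sd.weight (A / r ^ 2) z ζ • Φ ζ (a ζ) :=
      Finset.sum_filter_add_sum_filter_not s _ _
    have hfar : ‖∑ ζ ∈ S', sd.weight (A / r ^ 2) z ζ • Φ ζ (a ζ)‖
        ≤ Real.exp (-((sd.C + 1 / 2) * A)) / 2 := by
      have hterm : ∀ ζ ∈ S', ‖sd.weight (A / r ^ 2) z ζ • Φ ζ (a ζ)‖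
          ≤ ‖sd.weight (A / r ^ 2) z ζ‖ * B := by
        intro ζ hζ
        rw [norm_smul]
        gcongr
        exact ((Φ ζ).le_opNorm (a ζ)).trans ((mul_le_of_le_one_right (norm_nonneg _)
          (ha1 ζ (hS's hζ))).trans (hΦ ζ (hS's hζ)))
      refine (norm_sum_le_of_le _ hterm).trans ?_
      rw [← Finset.sum_mul]
      have h1 := htail r hr S' (fun x hx => hs (hS's hx))
        (fun x hx y hy => hsep x (hS's hx) y (hS's hy)) z (hXD hz).1 (hXp hz) R hR0.le
        (fun ζ hζ => (not_le.1 (Finset.mem_filter.1 hζ).2).le)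
      have h2 : sd.c / 2 * A * R ^ 2 = sd.c / 2 * R ^ 2 * A := by ring
      have h3 : (sd.C + 2) * A ≤ sd.c / 2 * R ^ 2 * A := by gcongr
      have h4 : 2 * B * C₁ ≤ Real.exp A := hAY.trans (by linarith [Real.add_one_le_exp A])
      calc (∑ ζ ∈ S', ‖sd.weight (A / r ^ 2) z ζ‖) * B
          ≤ C₁ * Real.exp (-((sd.C + 2) * A)) * B := by
            gcongr
            rw [h2] at h1
            refine h1.trans (mul_le_mul_of_nonneg_left (Real.exp_le_exp.2 ?_) (by linarith))
            exact neg_le_neg h3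
        _ = 2 * B * C₁ * Real.exp (-((sd.C + 2) * A)) / 2 := by ring
        _ ≤ Real.exp A * Real.exp (-((sd.C + 2) * A)) / 2 := by gcongr
        _ ≤ _ := by
            rw [← Real.exp_add]
            gcongr
            nlinarith
    rw [← hsplit]
    have := _root_.norm_sub_le (∑ ζ ∈ S, sd.weight (A / r ^ 2) z ζ • Φ ζ (a ζ)
        + ∑ ζ ∈ S', sd.weight (A / r ^ 2) z ζ • Φ ζ (a ζ))
      (∑ ζ ∈ S', sd.weight (A / r ^ 2) z ζ • Φ ζ (a ζ))
    rw [add_sub_cancel_right] at this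
    linarith

end PeakFamily

section Perturbation

variable {ι F : Type*} [NormedAddCommGroup F] [NormedSpace ℂ F]

/-- The linear part `∑ eᵢ γᵢ cᵢ` of a perturbation. -/
def linearPart (s : Finset ι) (e : ι → ℂ) (γ : ι → ℝ) (c : ι → F) : F :=
  ∑ i ∈ s, (e i * γ i) • c i

/-- The linear part of a perturbation, corrected by its quadratic part. -/
def perturbation (s : Finset ι) (e : ι → ℂ) (γ : ι → ℝ) (c : ι → F)
    (S : ι → F →L[ℂ] F →L[ℂ] F) : F :=
  linearPart s e γ c + linearPart s e γ fun i => S i (c i) (linearPart s e γ c)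

lemma norm_linearPart_le (s : Finset ι) (e : ι → ℂ) (γ : ι → ℝ) (c : ι → F) {ψ : ι → ℝ}
    (h : ∀ i ∈ s, |γ i| * ‖c i‖ ≤ ψ i) : ‖linearPart s e γ c‖ ≤ ∑ i ∈ s, ‖e i‖ * ψ i := by
  refine norm_sum_le_of_le _ fun i hi => ?_
  rw [norm_smul, norm_mul, Complex.norm_real, Real.norm_eq_abs, mul_assoc]
  exact mul_le_mul_of_nonneg_left (h i hi) (norm_nonneg _)

lemma norm_linearPart_le_mul {s : Finset ι} {e : ι → ℂ} {γ : ι → ℝ} {c : ι → F} {M t : ℝ}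
    (he : ∑ i ∈ s, ‖e i‖ ≤ t) (hM : 0 ≤ M) (h : ∀ i ∈ s, |γ i| * ‖c i‖ ≤ M) :
    ‖linearPart s e γ c‖ ≤ t * M := by
  refine (norm_linearPart_le s e γ c (ψ := fun _ => M) h).trans ?_
  rw [← Finset.sum_mul]
  gcongr

lemma norm_apply_apply_le (S : F →L[ℂ] F →L[ℂ] F) {B : ℝ} (hS : ‖S‖ ≤ B) (x y : F) :
    ‖S x y‖ ≤ B * ‖x‖ * ‖y‖ :=
  (S.le_opNorm₂ x y).trans (by gcongr)

/-- The quadratic part is at most half of the linear part. -/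
lemma norm_quadraticPart_le {s : Finset ι} {e : ι → ℂ} {γ : ι → ℝ} {c : ι → F}
    {S : ι → F →L[ℂ] F →L[ℂ] F} {B C₁ γ₀ : ℝ} (hB : 1 ≤ B) (hγ₀ : 0 ≤ γ₀)
    (he : ∑ i ∈ s, ‖e i‖ ≤ C₁) (hγ : ∀ i ∈ s, |γ i| ≤ γ₀) (hc : ∀ i ∈ s, ‖c i‖ ≤ B)
    (hS : ∀ i ∈ s, ‖S i‖ ≤ B) (hsmall : C₁ * (γ₀ * (B * B)) ≤ 1 / 2) (x : F) :
    ‖linearPart s e γ fun i => S i (c i) x‖ ≤ ‖x‖ / 2 := by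
  refine (norm_linearPart_le_mul (M := γ₀ * (B * B * ‖x‖)) he (by positivity)
    fun i hi => ?_).trans ?_
  · have h1 := norm_apply_apply_le (S i) (hS i hi) (c i) x
    have h2 : B * ‖c i‖ * ‖x‖ ≤ B * B * ‖x‖ := by
      have := hc i hi
      gcongr
    exact mul_le_mul (hγ i hi) (h1.trans h2) (norm_nonneg _) hγ₀
  · calc C₁ * (γ₀ * (B * B * ‖x‖)) = C₁ * (γ₀ * (B * B)) * ‖x‖ := by ring
      _ ≤ 1 / 2 * ‖x‖ := by gcongr
      _ = _ := by ring

/-- Comparison of a perturbation with the model perturbation having constant operators. -/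
lemma norm_perturbation_sub_le {s : Finset ι} {e : ι → ℂ} {γ : ι → ℝ} {a : ι → F}
    {Φ : ι → F →L[ℂ] F} {S : ι → F →L[ℂ] F →L[ℂ] F} (Φ₀ : F →L[ℂ] F)
    (S₀ : F →L[ℂ] F →L[ℂ] F) {B β : ℝ} (hB : 1 ≤ B)
    (hγ : ∀ i ∈ s, |γ i| ≤ 1) (ha : ∀ i ∈ s, ‖a i‖ ≤ 1) (hΦ : ∀ i ∈ s, ‖Φ i‖ ≤ B)
    (hS₀ : ‖S₀‖ ≤ B) (hΦβ : ∑ i ∈ s, ‖e i‖ * ‖Φ i - Φ₀‖ ≤ β)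
    (hSβ : ∑ i ∈ s, ‖e i‖ * ‖S i - S₀‖ ≤ β)
    (hlin : ‖linearPart s e γ fun i => Φ i (a i)‖ ≤ 1)
    (hv : ‖Φ₀ (linearPart s e γ a)‖ ≤ 1) :
    ‖perturbation s e γ (fun i => Φ i (a i)) S
      - (Φ₀ (linearPart s e γ a)
        + S₀ (Φ₀ (linearPart s e γ a)) (Φ₀ (linearPart s e γ a)))‖ ≤ β * (1 + 3 * B) := by
  set c : ι → F := fun i => Φ i (a i) with hcdef
  set l := linearPart s e γ c with hl
  set v := Φ₀ (linearPart s e γ a) with hv'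
  have hc : ∀ i ∈ s, ‖c i‖ ≤ B := fun i hi => ((Φ i).le_opNorm (a i)).trans
    ((mul_le_of_le_one_right (norm_nonneg _) (ha i hi)).trans (hΦ i hi))
  have hβ : 0 ≤ β := le_trans (Finset.sum_nonneg fun i _ => by positivity) hΦβ
  have h1 : ‖l - v‖ ≤ β := by
    have heq : l - v = linearPart s e γ fun i => (Φ i - Φ₀) (a i) := by
      simp only [hl, hv', linearPart, hcdef, map_sum, map_smul, sub_apply, smul_sub,
        Finset.sum_sub_distrib]
    rw [heq]
    refine (norm_linearPart_le s e γ _ fun i hi => ?_).trans hΦβ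
    have := ((Φ i - Φ₀).le_opNorm (a i)).trans
      (mul_le_of_le_one_right (norm_nonneg _) (ha i hi))
    exact (mul_le_of_le_one_left (norm_nonneg _) (hγ i hi)).trans this
  have h2 : ‖(linearPart s e γ fun i => S i (c i) l) - S₀ l l‖ ≤ β * B := by
    have heq : (linearPart s e γ fun i => S i (c i) l) - S₀ l l
        = linearPart s e γ fun i => (S i - S₀) (c i) l := by
      have h : ∀ x, S₀ l x = linearPart s e γ fun i => S₀ (c i) x := fun x => by
        simp only [hl, linearPart, map_sum, map_smul, sum_apply, smul_apply]
      rw [h l]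
      simp only [linearPart, sub_apply, smul_sub, Finset.sum_sub_distrib]
    rw [heq]
    refine (norm_linearPart_le s e γ _ (ψ := fun i => ‖S i - S₀‖ * B) fun i hi => ?_).trans ?_
    · have h3 := (S i - S₀).le_opNorm₂ (c i) l
      have h4 : ‖S i - S₀‖ * ‖c i‖ * ‖l‖ ≤ ‖S i - S₀‖ * B * 1 := by
        have := hc i hi
        gcongr
      exact (mul_le_of_le_one_left (norm_nonneg _) (hγ i hi)).trans (by linarith)
    · simp only [← mul_assoc]
      rw [← Finset.sum_mul]
      gcongr
  have h3 : ‖S₀ l l - S₀ v v‖ ≤ 2 * B * β := by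
    have heq : S₀ l l - S₀ v v = S₀ (l - v) l + S₀ v (l - v) := by
      simp only [map_sub, sub_apply]; abel
    rw [heq]
    refine (norm_add_le _ _).trans ?_
    have i1 := norm_apply_apply_le S₀ hS₀ (l - v) l
    have i2 := norm_apply_apply_le S₀ hS₀ v (l - v)
    have i3 : B * ‖l - v‖ * ‖l‖ ≤ B * β * 1 := by gcongr
    have i4 : B * ‖v‖ * ‖l - v‖ ≤ B * 1 * β := by gcongr
    linarith
  have heq : perturbation s e γ c S - (v + S₀ v v) = (l - v)
      + (((linearPart s e γ fun i => S i (c i) l) - S₀ l l) + (S₀ l l - S₀ v v)) := by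
    simp only [perturbation, ← hl]
    abel
  rw [heq]
  refine (norm_add_le _ _).trans ?_
  have := norm_add_le ((linearPart s e γ fun i => S i (c i) l) - S₀ l l) (S₀ l l - S₀ v v)
  linarith

lemma linearPart_sub_smul (s : Finset ι) (e : ι → ℂ) (γ : ι → ℝ) (c : ι → F) (t : ℝ) :
    linearPart s e γ c - (t : ℂ) • ∑ i ∈ s, e i • c i
      = linearPart s e (fun i => γ i - t) c := by
  simp only [linearPart, Finset.smul_sum, ← Finset.sum_sub_distrib, smul_smul, ← sub_smul]
  refine Finset.sum_congr rfl fun i _ => ?_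
  push_cast
  congr 1
  ring

variable {E : Type*} [NormedAddCommGroup E] [NormedSpace ℂ E]

lemma contDiff_perturbation {s : Finset ι} {e : E → ι → ℂ} {γ : ι → ℝ} {c : ι → F}
    {S : ι → F →L[ℂ] F →L[ℂ] F} (he : ∀ i, ContDiff ℂ (⊤ : ℕ∞) fun z => e z i) :
    ContDiff ℂ (⊤ : ℕ∞) fun z => perturbation s (e z) γ c S := by
  have h1 : ContDiff ℂ (⊤ : ℕ∞) fun z => linearPart s (e z) γ c :=
    ContDiff.sum fun i _ => ((he i).mul contDiff_const).smul contDiff_const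
  refine h1.add (ContDiff.sum fun i _ => ((he i).mul contDiff_const).smul ?_)
  exact (S i (c i)).contDiff.comp h1

/-- Weighted averages of a function which is small near `z`. -/
lemma PeakFamily.sum_mul_le {X Y : Set E} {d : ℕ} {b B κ C₁ c r : ℝ}
    (pf : PeakFamily X Y F d b B κ C₁ c r) (hr : 0 < r) (hC₁ : 0 ≤ C₁) {s : Finset E}
    (hs : ↑s ⊆ X) (hsep : ∀ x ∈ s, ∀ y ∈ s, x ≠ y → r ≤ dist x y) {z : E} (hz : z ∈ Y)
    {δ ν M : ℝ} (hδ : 0 ≤ δ) (hν : Real.exp (-(c * (δ / r) ^ 2)) ≤ ν) (hM : 0 ≤ M) {ψ : E → ℝ}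
    (hψM : ∀ ζ ∈ s, ψ ζ ≤ M) (hψν : ∀ ζ ∈ s, dist z ζ < δ → ψ ζ ≤ ν) :
    ∑ ζ ∈ s, ‖pf.e z ζ‖ * ψ ζ ≤ C₁ * (1 + M) * ν := by
  classical
  have hν0 : 0 ≤ ν := (Real.exp_pos _).le.trans hν
  rw [← Finset.sum_filter_add_sum_filter_not s (fun ζ => dist z ζ < δ)]
  have h1 : ∑ ζ ∈ s with dist z ζ < δ, ‖pf.e z ζ‖ * ψ ζ ≤ C₁ * ν := by
    calc ∑ ζ ∈ s with dist z ζ < δ, ‖pf.e z ζ‖ * ψ ζ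
        ≤ ∑ ζ ∈ s with dist z ζ < δ, ‖pf.e z ζ‖ * ν := Finset.sum_le_sum fun ζ hζ => by
          have := hψν ζ (Finset.mem_filter.1 hζ).1 (Finset.mem_filter.1 hζ).2
          gcongr
      _ = (∑ ζ ∈ s with dist z ζ < δ, ‖pf.e z ζ‖) * ν := by rw [Finset.sum_mul]
      _ ≤ C₁ * ν := by
          gcongr
          have h := pf.sum_le (s.filter fun ζ => dist z ζ < δ)
            (fun x hx => hs (Finset.mem_filter.1 hx).1)
            (fun x hx y hy => hsep x (Finset.mem_filter.1 hx).1 y (Finset.mem_filter.1 hy).1)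
            z hz 0 le_rfl (fun ζ _ => by simp)
          simpa using h
  have h2 : ∑ ζ ∈ s with ¬ dist z ζ < δ, ‖pf.e z ζ‖ * ψ ζ ≤ C₁ * ν * M := by
    calc ∑ ζ ∈ s with ¬ dist z ζ < δ, ‖pf.e z ζ‖ * ψ ζ
        ≤ ∑ ζ ∈ s with ¬ dist z ζ < δ, ‖pf.e z ζ‖ * M := Finset.sum_le_sum fun ζ hζ => by
          have := hψM ζ (Finset.mem_filter.1 hζ).1
          gcongr
      _ = (∑ ζ ∈ s with ¬ dist z ζ < δ, ‖pf.e z ζ‖) * M := by rw [Finset.sum_mul]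
      _ ≤ C₁ * ν * M := by
          gcongr
          have h := pf.sum_le (s.filter fun ζ => ¬ dist z ζ < δ)
            (fun x hx => hs (Finset.mem_filter.1 hx).1)
            (fun x hx y hy => hsep x (Finset.mem_filter.1 hx).1 y (Finset.mem_filter.1 hy).1)
            z hz (δ / r) (by positivity) (fun ζ hζ => by
              rw [div_mul_cancel₀ _ hr.ne']
              exact not_lt.1 (Finset.mem_filter.1 hζ).2)
          exact h.trans (by gcongr)
  linarith

end Perturbation

section Assembly

lemma IsCompact.exists_modulus {α β : Type*} [PseudoMetricSpace α] [PseudoMetricSpace β]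
    {A : Set α} {f : α → β} (hA : IsCompact A) (hf : ContinuousOn f A) {ν : ℝ} (hν : 0 < ν) :
    ∃ δ > 0, ∀ x ∈ A, ∀ y ∈ A, dist x y < δ → dist (f x) (f y) < ν :=
  Metric.uniformContinuousOn_iff.1 (hA.uniformContinuousOn_of_continuous hf) ν hν

lemma exists_exp_neg_mul_sq_le {c ν : ℝ} (hc : 0 < c) (hν : 0 < ν) :
    ∃ R > 0, Real.exp (-(c * R ^ 2)) ≤ ν := by
  refine ⟨1 / (c * ν) + 1, by positivity, ?_⟩
  set R := 1 / (c * ν) + 1 with hR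
  have h0 : 0 < 1 / (c * ν) := by positivity
  have h1 : 1 / ν ≤ c * R ^ 2 := by
    have h2 : 1 / (c * ν) ≤ R ^ 2 := by nlinarith
    calc 1 / ν = c * (1 / (c * ν)) := by field_simp
      _ ≤ c * R ^ 2 := by gcongr
  have h3 : 1 / ν ≤ Real.exp (c * R ^ 2) := by
    linarith [Real.add_one_le_exp (c * R ^ 2)]
  rw [Real.exp_neg]
  rw [one_div] at h3
  exact inv_le_of_inv_le₀ hν h3

variable {F : Type*} [NormedAddCommGroup F]

/-- Transfer of quadratic growth from a nearby model increment `u` at `x₀` to `w` at `x`. -/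
lemma growth_of_close {ρ : F → ℝ} {𝒦 : Set F} {ε τ β μ : ℝ} {x x₀ u w : F} (hμ : 0 ≤ μ)
    (hτ : ∀ a ∈ 𝒦, ∀ b ∈ 𝒦, dist a b < τ → dist (ρ a) (ρ b) < ε / 4) (hx : x ∈ 𝒦)
    (hx₀ : x₀ ∈ 𝒦) (hxw : x + w ∈ 𝒦) (hxu : x₀ + u ∈ 𝒦) (hβτ : 2 * β < τ)
    (hβ : μ * β ^ 2 ≤ ε / 4) (hwu : ‖w - u‖ ≤ β) (hxx₀ : dist x x₀ ≤ β)
    (hgrowth : μ * ‖u‖ ^ 2 ≤ ρ (x₀ + u) - ρ x₀) :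
    μ / 2 * ‖w‖ ^ 2 - ε < ρ (x + w) - ρ x := by
  have hβ0 : 0 ≤ β := (norm_nonneg _).trans hwu
  have h1 : dist (x + w) (x₀ + u) < τ := by
    rw [dist_eq_norm] at hxx₀ ⊢
    have h : x + w - (x₀ + u) = (x - x₀) + (w - u) := by abel
    rw [h]
    linarith [norm_add_le (x - x₀) (w - u)]
  have h2 := hτ _ hxw _ hxu h1
  have h3 := hτ _ hx _ hx₀ (by linarith)
  rw [Real.dist_eq, abs_lt] at h2 h3
  have h4 : ‖w‖ ≤ ‖u‖ + β := by
    have h : w = u + (w - u) := by abel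
    have := norm_add_le u (w - u)
    rw [← h] at this
    linarith
  have h5 : ‖w‖ ^ 2 ≤ 2 * ‖u‖ ^ 2 + 2 * β ^ 2 := by
    have h6 : ‖w‖ ^ 2 ≤ (‖u‖ + β) ^ 2 := by gcongr
    nlinarith [sq_nonneg (‖u‖ - β)]
  have h7 : μ / 2 * ‖w‖ ^ 2 ≤ μ / 2 * (2 * ‖u‖ ^ 2 + 2 * β ^ 2) := by gcongr
  linarith [h2.1, h3.2]

variable [InnerProductSpace ℂ F] [FiniteDimensional ℂ F]
variable {E : Type*} [NormedAddCommGroup E] [NormedSpace ℂ E]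

set_option maxHeartbeats 1000000 in
lemma GrowthData.exists_perturbation {ρ : F → ℝ} {K ω : Set F} {d k : ℕ}
    (gd : GrowthData ρ K d) (hω : IsOpen ω) (hρ : ContinuousOn ρ ω) (hK : IsCompact K)
    (hKω : K ⊆ ω) {X Y : Set E} {p : E} {R₀ K₁ κ C₁ c : ℝ} (hX : PackingBound X k K₁)
    (hR₀ : 0 ≤ R₀) (hXp : X ⊆ closedBall p R₀) (hκ : 0 < κ) (hC₁ : 1 ≤ C₁) (hc : 0 < c)
    (hpf : ∀ r > 0, Nonempty (PeakFamily X Y F d gd.b gd.B κ C₁ c r)) :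
    ∃ εp ∈ Ioo (0 : ℝ) 1, ∃ μ₀ > 0, ∃ γ₀ ∈ Ioo (0 : ℝ) 1, ∀ W Γ C : Set E, IsCompact W →
      W ⊆ Y → IsCompact Γ → Γ ⊆ W → Γ ⊆ X → C ⊆ Γ → ∀ f : E → F, ContinuousOn f W →
      MapsTo f W ω → ∀ ε > 0, ∀ γ : E → ℝ, ContinuousOn γ Γ → (∀ z ∈ Γ, γ z ∈ Ioc 0 γ₀) →
      ∃ w : E → F, ContDiff ℂ (⊤ : ℕ∞) w ∧
        (∀ z ∈ W, f z + w z ∈ ω) ∧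
        (∀ z ∈ W, μ₀ * ‖w z‖ ^ 2 - ε < ρ (f z + w z) - ρ (f z)) ∧
        (∀ z ∈ C, f z ∈ K → εp * γ z < ‖w z‖) ∧
        (∀ z ∈ Γ, ‖w z‖ < εp⁻¹ * γ z) ∧
        (∀ z ∈ W, (∀ ζ ∈ C, ε ≤ dist z ζ) → ‖w z‖ < ε) := by
  classical
  have : ProperSpace F := FiniteDimensional.proper ℂ F
  obtain ⟨δ₁, hδ₁, hδ₁ω⟩ := hK.exists_cthickening_subset_open hω hKω
  have hB := gd.B_ge
  have hμ := gd.μ_pos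
  have hδ := gd.δ_pos
  set B := gd.B
  set μ := gd.μ
  have hBC : 1 ≤ B * C₁ := one_le_mul_of_one_le_of_one_le hB hC₁
  have hB0 : 0 < B := by linarith
  have hC₁0 : 0 < C₁ := by linarith
  obtain ⟨γ₀, hγ₀, hγ₀1, hγ₀half, hγ₀δ, hγ₀δ₁⟩ : ∃ γ₀ > 0, γ₀ < 1 ∧
      C₁ * (γ₀ * (B * B)) ≤ 1 / 2 ∧ C₁ * (γ₀ * B) ≤ gd.δ ∧ 2 * (C₁ * (γ₀ * B)) ≤ δ₁ / 2 := by
    refine ⟨min (1 / (2 * (C₁ * (B * B)))) (min (gd.δ / (C₁ * B)) (δ₁ / (4 * (C₁ * B)))),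
      by positivity, ?_, ?_, ?_, ?_⟩
    · refine (min_le_left _ _).trans_lt ((div_lt_one (by positivity)).2 ?_)
      have : 1 ≤ C₁ * (B * B) :=
        one_le_mul_of_one_le_of_one_le hC₁ (one_le_mul_of_one_le_of_one_le hB hB)
      linarith
    · have h := min_le_left (1 / (2 * (C₁ * (B * B))))
        (min (gd.δ / (C₁ * B)) (δ₁ / (4 * (C₁ * B))))
      rw [le_div_iff₀ (by positivity)] at h
      linarith
    · have h := (min_le_right (1 / (2 * (C₁ * (B * B))))
        (min (gd.δ / (C₁ * B)) (δ₁ / (4 * (C₁ * B))))).trans (min_le_left _ _)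
      rw [le_div_iff₀ (by positivity)] at h
      linarith
    · have h := (min_le_right (1 / (2 * (C₁ * (B * B))))
        (min (gd.δ / (C₁ * B)) (δ₁ / (4 * (C₁ * B))))).trans (min_le_right _ _)
      rw [le_div_iff₀ (by positivity)] at h
      linarith
  have hγ₀B : C₁ * (γ₀ * B) ≤ 1 / 2 := by
    refine le_trans ?_ hγ₀half
    gcongr
    exact le_mul_of_one_le_left hB0.le hB
  obtain ⟨εp, hεp, hεp1, hεpBC, hεpκ⟩ : ∃ εp > 0, εp < 1 ∧ 4 * (C₁ * B) ≤ εp⁻¹ ∧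
      εp < κ / 4 := by
    refine ⟨min (1 / (4 * (C₁ * B))) (κ / 8), by positivity, ?_, ?_, ?_⟩
    · refine (min_le_left _ _).trans_lt ((div_lt_one (by positivity)).2 ?_)
      linarith
    · have h := min_le_left (1 / (4 * (C₁ * B))) (κ / 8)
      rw [one_div] at h ⊢
      exact (le_inv_comm₀ (by positivity) (by positivity)).1 h
    · exact (min_le_right _ _).trans_lt (by linarith)
  refine ⟨εp, ⟨hεp, hεp1⟩, μ / 2, half_pos hμ, γ₀, ⟨hγ₀, hγ₀1⟩, ?_⟩
  intro W Γ C hW hWY hΓ hΓW hΓX hCΓ f hf hfω ε hε γ hγ hγ₀'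
  obtain ⟨δ₂, hδ₂, hδ₂ω⟩ := (hW.image_of_continuousOn hf).exists_cthickening_subset_open hω
    hfω.image_subset
  set 𝒦 : Set F := cthickening δ₁ K ∪ cthickening δ₂ (f '' W)
  have h𝒦ω : 𝒦 ⊆ ω := union_subset hδ₁ω hδ₂ω
  have h𝒦 : IsCompact 𝒦 := hK.cthickening.union (hW.image_of_continuousOn hf).cthickening
  obtain ⟨τ, hτ, hρτ⟩ := h𝒦.exists_modulus (hρ.mono h𝒦ω) (by positivity : 0 < ε / 4)
  obtain ⟨γm, hγm, hγmΓ⟩ : ∃ γm > 0, ∀ z ∈ Γ, γm ≤ γ z := by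
    rcases Γ.eq_empty_or_nonempty with h | h
    · exact ⟨1, one_pos, by simp [h]⟩
    · obtain ⟨z, hz, hmin⟩ := hΓ.exists_isMinOn h hγ
      exact ⟨γ z, (hγ₀' z hz).1, fun y hy => hmin hy⟩
  obtain ⟨β, hβ, hβδ₁, hβδ₂, hβε, hβτ, hβ1, hβμ, hβγ, hβκ⟩ : ∃ β > 0, β ≤ δ₁ / 4 ∧ β ≤ δ₂ ∧
      β ≤ ε / 2 ∧ β ≤ τ / 4 ∧ β ≤ 1 ∧ β ≤ ε / (4 * μ) ∧ β ≤ γm / 2 ∧ β ≤ κ * γm / 4 := by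
    have hev : ∀ t > (0 : ℝ), ∀ᶠ β in nhdsWithin (0 : ℝ) (Ioi 0), β ≤ t := fun t ht =>
      (eventually_le_nhds ht).filter_mono nhdsWithin_le_nhds
    have hpos : ∀ᶠ β in nhdsWithin (0 : ℝ) (Ioi 0), 0 < β := self_mem_nhdsWithin
    obtain ⟨β, h0, h1, h2, h3, h4, h5, h6, h7, h8⟩ := (hpos.and <| (hev (δ₁ / 4) (by positivity)).and <|
      (hev δ₂ hδ₂).and <| (hev (ε / 2) (by positivity)).and <| (hev (τ / 4) (by positivity)).and <|
      (hev 1 one_pos).and <| (hev (ε / (4 * μ)) (by positivity)).and <|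
      (hev (γm / 2) (by positivity)).and (hev (κ * γm / 4) (by positivity))).exists
    exact ⟨β, h0, h1, h2, h3, h4, h5, h6, h7, h8⟩
  have hβμ' : μ * β ^ 2 ≤ ε / 4 := by
    rw [le_div_iff₀ (by positivity)] at hβμ
    nlinarith
  set C₃ : ℝ := C₁ * (1 + 2 * B) * (1 + 3 * B) with hC₃
  have hC₃BC : 2 * (C₁ * B) ≤ C₃ := by nlinarith
  have hC₃1 : 1 ≤ C₃ := by linarith
  set ν : ℝ := β / C₃ with hν'
  have hνβ : C₃ * ν = β := by rw [hν']; field_simp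
  have hν : 0 < ν := by positivity
  have hνβ' : ν ≤ β := by nlinarith
  have hBCν : 2 * (C₁ * B) * ν ≤ β := by rw [← hνβ]; gcongr
  set ΓK : Set E := Γ ∩ f ⁻¹' K
  have hΓK : IsCompact ΓK := hΓ.of_isClosed_subset
    ((hf.mono hΓW).preimage_isClosed_of_isClosed hΓ.isClosed hK.isClosed) inter_subset_left
  have hfΓK : ContinuousOn f ΓK := hf.mono (inter_subset_left.trans hΓW)
  obtain ⟨δa, hδa, hmodΦ⟩ := hΓK.exists_modulus
    (gd.continuousOn_Φ.comp hfΓK fun z hz => hz.2) hν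
  obtain ⟨δb, hδb, hmodS⟩ := hΓK.exists_modulus
    (gd.continuousOn_S.comp hfΓK fun z hz => hz.2) hν
  obtain ⟨δc, hδc, hmodγ⟩ := hΓ.exists_modulus hγ hν
  obtain ⟨δd, hδd, hmodf⟩ := hW.exists_modulus hf hν
  obtain ⟨δ, hδ0, hδa', hδb', hδc', hδd', hδε⟩ : ∃ δ > 0, 2 * δ ≤ δa ∧ 2 * δ ≤ δb ∧ δ ≤ δc ∧
      δ ≤ δd ∧ δ ≤ ε := by
    refine ⟨min (min (δa / 2) (δb / 2)) (min (min δc δd) ε), by positivity, ?_, ?_, ?_, ?_, ?_⟩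
    · linarith [(min_le_left (min (δa / 2) (δb / 2)) (min (min δc δd) ε)).trans (min_le_left _ _)]
    · linarith [(min_le_left (min (δa / 2) (δb / 2)) (min (min δc δd) ε)).trans (min_le_right _ _)]
    · exact ((min_le_right _ _).trans (min_le_left _ _)).trans (min_le_left _ _)
    · exact ((min_le_right _ _).trans (min_le_left _ _)).trans (min_le_right _ _)
    · exact (min_le_right _ _).trans (min_le_right _ _)
  obtain ⟨R, hR, hRν⟩ := exists_exp_neg_mul_sq_le hc hν
  set r : ℝ := δ / R with hr'
  have hr : 0 < r := by positivity
  have hδr : δ / r = R := by rw [hr']; field_simp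
  rw [← hδr] at hRν
  obtain ⟨pf⟩ := hpf r hr
  set X' : Set E := {z ∈ C | f z ∈ K}
  have hX'K : X' ⊆ ΓK := fun z hz => ⟨hCΓ hz.1, hz.2⟩
  have hX'X : X' ⊆ X := fun z hz => hΓX (hCΓ hz.1)
  obtain ⟨s, hsX', hsep, hnet, -⟩ := hX.exists_net hX'X (y := p) hR₀ hr
    (fun z hz => hXp (hX'X hz))
  have hsX : ↑s ⊆ X := hsX'.trans hX'X
  have hsK : ∀ ζ ∈ s, f ζ ∈ K := fun ζ hζ => (hsX' hζ).2
  have hsΓ : ∀ ζ ∈ s, ζ ∈ Γ := fun ζ hζ => hCΓ (hsX' hζ).1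
  have hT : ∀ ζ, ∃ T : Submodule ℂ F, ζ ∈ s → Module.finrank ℂ T = d ∧
      ∀ a ∈ T, gd.b * ‖a‖ ≤ ‖gd.Φ (f ζ) a‖ := fun ζ => by
    by_cases hζ : ζ ∈ s
    · obtain ⟨T, h⟩ := gd.exists_subspace (f ζ) (hsK ζ hζ)
      exact ⟨T, fun _ => h⟩
    · exact ⟨⊥, fun h => absurd h hζ⟩
  choose T hT using hT
  have hΦB : ∀ ζ ∈ s, ‖gd.Φ (f ζ)‖ ≤ B := fun ζ hζ => gd.norm_Φ_le _ (hsK ζ hζ)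
  have hSB : ∀ ζ ∈ s, ‖gd.S (f ζ)‖ ≤ B := fun ζ hζ => gd.norm_S_le _ (hsK ζ hζ)
  obtain ⟨a, ha1, hlow⟩ := pf.exists_coeff s hsX hsep T (fun ζ => gd.Φ (f ζ))
    (fun ζ hζ => (hT ζ hζ).1) (fun ζ hζ => (hT ζ hζ).2) hΦB
  set v : E → F := fun ζ => gd.Φ (f ζ) (a ζ) with hv
  have hvB : ∀ ζ ∈ s, ‖v ζ‖ ≤ B := fun ζ hζ => ((gd.Φ (f ζ)).le_opNorm (a ζ)).trans
    ((mul_le_of_le_one_right (norm_nonneg _) (ha1 ζ hζ)).trans (hΦB ζ hζ))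
  have hγabs : ∀ ζ ∈ s, |γ ζ| ≤ γ₀ := fun ζ hζ => by
    rw [abs_of_pos (hγ₀' ζ (hsΓ ζ hζ)).1]
    exact (hγ₀' ζ (hsΓ ζ hζ)).2
  have hE : ∀ z ∈ W, ∑ ζ ∈ s, ‖pf.e z ζ‖ ≤ C₁ := fun z hz => by
    simpa using pf.sum_le s hsX hsep z (hWY hz) 0 le_rfl (fun ζ _ => by simp)
  set lin : E → F := fun z => linearPart s (pf.e z) γ v with hlin
  set w : E → F := fun z => perturbation s (pf.e z) γ v fun ζ => gd.S (f ζ) with hw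
  have hlinB : ∀ z ∈ W, ∀ t, ∑ ζ ∈ s, ‖pf.e z ζ‖ ≤ t → ‖lin z‖ ≤ t * (γ₀ * B) :=
    fun z hz t ht => norm_linearPart_le_mul ht (by positivity) fun ζ hζ =>
      mul_le_mul (hγabs ζ hζ) (hvB ζ hζ) (norm_nonneg _) hγ₀.le
  have hwlin : ∀ z ∈ W, ‖w z - lin z‖ ≤ ‖lin z‖ / 2 := fun z hz => by
    have h : w z - lin z = linearPart s (pf.e z) γ fun ζ => gd.S (f ζ) (v ζ) (lin z) := by
      simp only [hw, perturbation, hlin]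
      abel
    rw [h]
    exact norm_quadraticPart_le hB hγ₀.le (hE z hz) hγabs hvB hSB hγ₀half _
  have hwle : ∀ z ∈ W, ‖w z‖ ≤ 3 / 2 * ‖lin z‖ := fun z hz => by
    have h := norm_add_le (w z - lin z) (lin z)
    rw [sub_add_cancel] at h
    linarith [hwlin z hz]
  have hlew : ∀ z ∈ W, ‖lin z‖ ≤ 2 * ‖w z‖ := fun z hz => by
    have h := norm_sub_le (w z) (w z - lin z)
    rw [sub_sub_cancel] at h
    linarith [hwlin z hz]
  have hfar : ∀ z ∈ W, (∀ ζ ∈ s, δ ≤ dist z ζ) → ‖w z‖ ≤ β := fun z hz hzs => by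
    have h1 : ∑ ζ ∈ s, ‖pf.e z ζ‖ ≤ C₁ * ν :=
      (pf.sum_le s hsX hsep z (hWY hz) (δ / r) (by positivity) fun ζ hζ => by
        rw [div_mul_cancel₀ _ hr.ne']; exact hzs ζ hζ).trans (by gcongr)
    have h2 := hlinB z hz _ h1
    have h3 : C₁ * ν * (γ₀ * B) ≤ C₁ * ν * (1 * B) := by gcongr
    linarith [hwle z hz, norm_nonneg (lin z)]
  have hγavg : ∀ z ∈ Γ, ‖lin z - (γ z : ℂ) • ∑ ζ ∈ s, pf.e z ζ • v ζ‖ ≤ 2 * β := by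
    intro z hz
    simp only [hlin]
    rw [linearPart_sub_smul]
    refine (norm_linearPart_le s _ _ _ (ψ := fun ζ => |γ ζ - γ z| * B) fun ζ hζ =>
      mul_le_mul_of_nonneg_left (hvB ζ hζ) (abs_nonneg _)).trans ?_
    simp only [← mul_assoc]
    rw [← Finset.sum_mul]
    have h1 : ∑ ζ ∈ s, ‖pf.e z ζ‖ * |γ ζ - γ z| ≤ C₁ * (1 + 1) * ν := by
      refine pf.sum_mul_le hr hC₁0.le hsX hsep (hWY (hΓW hz)) hδ0.le hRν zero_le_one
        (fun ζ hζ => ?_) fun ζ hζ hzζ => ?_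
      · have h2 := hγ₀' ζ (hsΓ ζ hζ)
        have h3 := hγ₀' z hz
        rw [abs_le]
        constructor <;> linarith [h2.1, h2.2, h3.1, h3.2]
      · rw [← Real.dist_eq]
        exact (hmodγ ζ (hsΓ ζ hζ) z hz (by rw [dist_comm]; linarith)).le
    have h2 := mul_le_mul_of_nonneg_right h1 hB0.le
    linarith
  have hnear : ∀ z ∈ W, ∀ ζ₀ ∈ s, dist z ζ₀ < δ → ∃ u, ‖w z - u‖ ≤ β ∧ ‖u‖ ≤ δ₁ / 2 ∧
      μ * ‖u‖ ^ 2 ≤ ρ (f ζ₀ + u) - ρ (f ζ₀) := by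
    intro z hz ζ₀ hζ₀ hzζ₀
    have hdist : ∀ ζ ∈ s, dist z ζ < δ → dist ζ ζ₀ < 2 * δ := fun ζ _ hzζ => by
      have := dist_triangle_left ζ ζ₀ z
      linarith
    have hΦβ : ∑ ζ ∈ s, ‖pf.e z ζ‖ * ‖gd.Φ (f ζ) - gd.Φ (f ζ₀)‖ ≤ C₁ * (1 + 2 * B) * ν := by
      refine pf.sum_mul_le hr hC₁0.le hsX hsep (hWY hz) hδ0.le hRν (by positivity)
        (fun ζ hζ => ?_) fun ζ hζ hzζ => ?_
      · refine (norm_sub_le _ _).trans ?_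
        linarith [hΦB ζ hζ, hΦB ζ₀ hζ₀]
      · exact (dist_eq_norm (gd.Φ (f ζ)) (gd.Φ (f ζ₀))).symm.trans_le
          (hmodΦ ζ (hX'K (hsX' hζ)) ζ₀ (hX'K (hsX' hζ₀)) (by linarith [hdist ζ hζ hzζ])).le
    have hSβ : ∑ ζ ∈ s, ‖pf.e z ζ‖ * ‖gd.S (f ζ) - gd.S (f ζ₀)‖ ≤ C₁ * (1 + 2 * B) * ν := by
      refine pf.sum_mul_le hr hC₁0.le hsX hsep (hWY hz) hδ0.le hRν (by positivity)
        (fun ζ hζ => ?_) fun ζ hζ hzζ => ?_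
      · refine (norm_sub_le _ _).trans ?_
        linarith [hSB ζ hζ, hSB ζ₀ hζ₀]
      · exact (dist_eq_norm (gd.S (f ζ)) (gd.S (f ζ₀))).symm.trans_le
          (hmodS ζ (hX'K (hsX' hζ)) ζ₀ (hX'K (hsX' hζ₀)) (by linarith [hdist ζ hζ hzζ])).le
    set α : F := linearPart s (pf.e z) γ a with hα
    have hαn : ‖α‖ ≤ C₁ * γ₀ := norm_linearPart_le_mul (hE z hz) hγ₀.le fun ζ hζ =>
      (mul_le_of_le_one_right (abs_nonneg _) (ha1 ζ hζ)).trans (hγabs ζ hζ)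
    have hv₀ : ‖gd.Φ (f ζ₀) α‖ ≤ C₁ * (γ₀ * B) := by
      refine ((gd.Φ (f ζ₀)).le_opNorm α).trans ?_
      have := mul_le_mul (hΦB ζ₀ hζ₀) hαn (norm_nonneg _) hB0.le
      linarith
    refine ⟨gd.Φ (f ζ₀) α + gd.S (f ζ₀) (gd.Φ (f ζ₀) α) (gd.Φ (f ζ₀) α), ?_, ?_,
      gd.growth (f ζ₀) (hsK ζ₀ hζ₀) α (hv₀.trans hγ₀δ)⟩
    · refine (norm_perturbation_sub_le (gd.Φ (f ζ₀)) (gd.S (f ζ₀)) hB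
        (fun ζ hζ => (hγabs ζ hζ).trans hγ₀1.le) ha1 hΦB (hSB ζ₀ hζ₀) hΦβ hSβ ?_ ?_).trans ?_
      · have := hlinB z hz _ (hE z hz)
        exact this.trans (by linarith)
      · exact hv₀.trans (by linarith)
      · rw [← hνβ, hC₃]
        exact le_of_eq (by ring)
    · refine (norm_add_le _ _).trans ?_
      have h1 := norm_apply_apply_le (gd.S (f ζ₀)) (hSB ζ₀ hζ₀) (gd.Φ (f ζ₀) α)
        (gd.Φ (f ζ₀) α)
      have h2 : B * ‖gd.Φ (f ζ₀) α‖ ≤ 1 := by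
        have := mul_le_mul_of_nonneg_left hv₀ hB0.le
        linarith
      have h3 := mul_le_mul_of_nonneg_right h2 (norm_nonneg (gd.Φ (f ζ₀) α))
      linarith
  have hmodel : ∀ z ∈ W, f z ∈ 𝒦 ∧ f z + w z ∈ 𝒦 ∧ ∃ x₀ u, x₀ ∈ 𝒦 ∧ x₀ + u ∈ 𝒦 ∧
      ‖w z - u‖ ≤ β ∧ dist (f z) x₀ ≤ β ∧ μ * ‖u‖ ^ 2 ≤ ρ (x₀ + u) - ρ x₀ := by
    intro z hz
    have hfz : f z ∈ 𝒦 := Or.inr (self_subset_cthickening _ (mem_image_of_mem f hz))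
    refine ⟨hfz, ?_⟩
    by_cases hzs : ∃ ζ₀ ∈ s, dist z ζ₀ < δ
    · obtain ⟨ζ₀, hζ₀, hzζ₀⟩ := hzs
      obtain ⟨u, hu, huδ, hgrowth⟩ := hnear z hz ζ₀ hζ₀ hzζ₀
      have hff : dist (f z) (f ζ₀) < ν :=
        hmodf z hz ζ₀ (hΓW (hsΓ ζ₀ hζ₀)) (by linarith)
      have hclose : ∀ y, dist y (f ζ₀) ≤ δ₁ → y ∈ 𝒦 := fun y hy =>
        Or.inl (mem_cthickening_of_dist_le _ _ _ _ (hsK ζ₀ hζ₀) hy)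
      refine ⟨hclose _ ?_, f ζ₀, u, hclose _ ?_, hclose _ ?_, hu, by linarith, hgrowth⟩
      · rw [dist_eq_norm] at hff ⊢
        have h : f z + w z - f ζ₀ = (f z - f ζ₀) + ((w z - u) + u) := by abel
        rw [h]
        linarith [norm_add_le (f z - f ζ₀) ((w z - u) + u), norm_add_le (w z - u) u]
      · rw [dist_self]; exact hδ₁.le
      · rw [dist_eq_norm, add_sub_cancel_left]; linarith
    · push Not at hzs
      have hwz := hfar z hz hzs
      refine ⟨Or.inr (mem_cthickening_of_dist_le _ (f z) _ _ (mem_image_of_mem f hz) ?_),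
        f z, 0, hfz, by rwa [add_zero], by rwa [sub_zero], by rw [dist_self]; exact hβ.le, ?_⟩
      · rw [dist_eq_norm, add_sub_cancel_left]; linarith
      · simp
  refine ⟨w, contDiff_perturbation pf.contDiff, fun z hz => h𝒦ω (hmodel z hz).2.1, ?_, ?_, ?_, ?_⟩
  · intro z hz
    obtain ⟨h1, h2, x₀, u, h3, h4, h5, h6, h7⟩ := hmodel z hz
    exact growth_of_close hμ.le hρτ h1 h3 h2 h4 (by linarith) hβμ' h5 h6 h7
  · intro z hz hzK
    have hzΓ := hCΓ hz
    obtain ⟨ζ₀, hζ₀, hzζ₀⟩ := hnet z ⟨hz, hzK⟩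
    have h1 := hlow z (hΓX hzΓ) ⟨ζ₀, hζ₀, hzζ₀.le⟩
    have h2 := hγavg z hzΓ
    have hγz := hγmΓ z hzΓ
    have hγz0 : 0 < γ z := by linarith
    have h3 : γ z * κ ≤ ‖(γ z : ℂ) • ∑ ζ ∈ s, pf.e z ζ • v ζ‖ := by
      rw [norm_smul, Complex.norm_real, Real.norm_of_nonneg hγz0.le]
      gcongr
    have h4 := norm_sub_le (lin z) (lin z - (γ z : ℂ) • ∑ ζ ∈ s, pf.e z ζ • v ζ)
    rw [sub_sub_cancel] at h4
    have h5 := hlew z (hΓW hzΓ)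
    have h6 : κ * γm ≤ κ * γ z := by gcongr
    have h7 : εp * γ z < κ / 4 * γ z := by gcongr
    linarith
  · intro z hz
    have h2 := hγavg z hz
    have hγz := hγmΓ z hz
    have hγz0 : 0 < γ z := by linarith
    have h3 : ‖(γ z : ℂ) • ∑ ζ ∈ s, pf.e z ζ • v ζ‖ ≤ γ z * (C₁ * B) := by
      rw [norm_smul, Complex.norm_real, Real.norm_of_nonneg hγz0.le]
      gcongr
      refine (norm_sum_le_of_le _ (f := fun ζ => pf.e z ζ • v ζ)
        (n := fun ζ => ‖pf.e z ζ‖ * B) fun ζ hζ => ?_).trans ?_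
      · rw [norm_smul]
        exact mul_le_mul_of_nonneg_left (hvB ζ hζ) (norm_nonneg _)
      · rw [← Finset.sum_mul]
        exact mul_le_mul_of_nonneg_right (hE z (hΓW hz)) hB0.le
    have h4 := norm_add_le (lin z - (γ z : ℂ) • ∑ ζ ∈ s, pf.e z ζ • v ζ)
      ((γ z : ℂ) • ∑ ζ ∈ s, pf.e z ζ • v ζ)
    rw [sub_add_cancel] at h4
    have h5 := hwle z (hΓW hz)
    have h6 : 4 * (C₁ * B) * γ z ≤ εp⁻¹ * γ z := by gcongr
    have h7 : γ z * 1 ≤ γ z * (C₁ * B) := by gcongr; linarith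
    linarith
  · intro z hz hzC
    have := hfar z hz fun ζ hζ => hδε.trans (hzC ζ (hsX' hζ).1)
    linarith

end Assembly

/-- Lemma 5.2: the local version of Dor's lemma near a strongly pseudoconvex
boundary point `p` of a smoothly bounded domain `D ⊂ ℂ^d`. -/
theorem dor_lemma_local
    {d n q : ℕ} (hd : 2 ≤ d) (hn : d + 1 ≤ n) (hq : q ≤ n - d)
    {ω : Set (EuclideanSpace ℂ (Fin n))} (hωopen : IsOpen ω) (hωconn : IsConnected ω)
    {ρ : EuclideanSpace ℂ (Fin n) → ℝ} (hρ : ContDiffOn ℝ (⊤ : ℕ∞) ρ ω)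
    (hρlevi : ∀ x ∈ ω, LeviPosEigenAtLeast ρ x (n - q + 1))
    {Kω : Set (EuclideanSpace ℂ (Fin n))} (hKωcomp : IsCompact Kω) (hKωω : Kω ⊆ ω)
    (hKωnoncrit : ∀ x ∈ Kω, fderiv ℝ ρ x ≠ 0)
    -- `D` is a bounded domain with smooth boundary …
    {D : Set (EuclideanSpace ℂ (Fin d))}
    (hDopen : IsOpen D) (hDconn : IsConnected D) (hDbdd : IsBounded D)
    {U : Set (EuclideanSpace ℂ (Fin d))} {rD : EuclideanSpace ℂ (Fin d) → ℝ}
    (hUopen : IsOpen U) (hfrU : frontier D ⊆ U) (hrD : ContDiffOn ℝ (⊤ : ℕ∞) rD U)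
    (hDU : D ∩ U = {x ∈ U | rD x < 0})
    (hgrad : ∀ x ∈ frontier D, fderiv ℝ rD x ≠ 0)
    -- … and `p` is a strongly pseudoconvex boundary point of `D`
    {p : EuclideanSpace ℂ (Fin d)} (hp : p ∈ frontier D)
    (hpspc : ∀ v : EuclideanSpace ℂ (Fin d), v ≠ 0 → fderiv ℝ rD p v = 0 →
      fderiv ℝ rD p (Complex.I • v) = 0 → 0 < leviForm rD p v) :
    ∃ (rV rU εp μ₀ γ₀ : ℝ),
      0 < rV ∧ rV < rU ∧
      εp ∈ Set.Ioo (0 : ℝ) 1 ∧ 0 < μ₀ ∧ γ₀ ∈ Set.Ioo (0 : ℝ) 1 ∧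
      ∀ D₁ : Set (EuclideanSpace ℂ (Fin d)), IsOpen D₁ → D₁ ⊆ ball p rU ∩ D →
      ∀ C : Set (EuclideanSpace ℂ (Fin d)),
        (∃ O : Set (EuclideanSpace ℂ (Fin d)), IsOpen O ∧ C = O ∩ frontier D) →
        C ⊆ ball p rV →
        (∃ δ : ℝ, 0 < δ ∧ ∀ a ∈ closure C, ∀ b ∈ frontier D₁ \ frontier D, δ ≤ dist a b) →
      ∀ f : EuclideanSpace ℂ (Fin d) → EuclideanSpace ℂ (Fin n),
        ContDiffOn ℝ (⊤ : ℕ∞) f (closure D₁) → DifferentiableOn ℂ f D₁ →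
        MapsTo f (closure D₁) ω →
      ∀ ε : ℝ, 0 < ε →
      ∀ γ : EuclideanSpace ℂ (Fin d) → ℝ,
        ContinuousOn γ (frontier D ∩ frontier D₁) →
        (∀ z ∈ frontier D ∩ frontier D₁, γ z ∈ Set.Ioc (0 : ℝ) γ₀) →
        ∃ g : EuclideanSpace ℂ (Fin d) → EuclideanSpace ℂ (Fin n),
          ContDiffOn ℝ (⊤ : ℕ∞) g (closure D₁) ∧ DifferentiableOn ℂ g D₁ ∧
          MapsTo g (closure D₁) ω ∧
          -- (i)
          (∀ z ∈ closure D₁, μ₀ * ‖g z - f z‖ ^ 2 - ε < ρ (g z) - ρ (f z)) ∧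
          -- (ii)
          (∀ z ∈ C, f z ∈ Kω → εp * γ z < ‖g z - f z‖) ∧
          -- (iii)
          (∀ z ∈ frontier D ∩ frontier D₁, ‖g z - f z‖ < εp⁻¹ * γ z) ∧
          -- (iv)
          (∀ z ∈ closure D₁, ε < infDist z C → ‖g z - f z‖ < ε) := by
  have h2 : (2 : WithTop ℕ∞) ≤ ((⊤ : ℕ∞) : WithTop ℕ∞) :=
    WithTop.coe_le_coe.2 (le_top : (2 : ℕ∞) ≤ ⊤)
  obtain ⟨gd⟩ := exists_growthData hωopen (hρ.of_le h2) hKωcomp hKωω hKωnoncrit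
    (d := d) fun x hx => by
      obtain ⟨V, hV, hpos⟩ := hρlevi x (hKωω hx)
      exact ⟨V, by omega, hpos⟩
  have hrD2 : ContDiffOn ℝ 2 rD U := hrD.of_le h2
  obtain ⟨sd⟩ := exists_supportData hDopen hUopen hfrU hrD2 hDU hp hpspc
  have hstrict : HasStrictFDerivAt rD (fderiv ℝ rD p) p :=
    (hrD2.contDiffAt (hUopen.mem_nhds (hfrU hp))).hasStrictFDerivAt (by norm_num)
  have hfin : Module.finrank ℝ (EuclideanSpace ℂ (Fin d)) = (2 * d - 1) + 1 := by
    rw [finrank_real_of_complex, finrank_euclideanSpace, Fintype.card_fin]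
    omega
  obtain ⟨K₁, hK₁, ρ₀, hρ₀, hpack⟩ := exists_packingBound hstrict (hgrad p hp)
    (X := frontier D)
    (fun x hx => definingFunction_eq_zero hDopen hUopen hrD.continuousOn hDU hfrU hx) hfin
  set rU := min sd.rad ρ₀
  have hrU : 0 < rU := lt_min sd.rad_pos hρ₀
  have hrad : closedBall p rU ⊆ closedBall p sd.rad := closedBall_subset_closedBall (min_le_left _ _)
  have hX : PackingBound (frontier D ∩ closedBall p rU) (2 * d - 1) K₁ :=
    hpack.mono (inter_subset_inter_right _ (closedBall_subset_closedBall (min_le_right _ _)))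
  obtain ⟨κ, hκ, C₁, hC₁, c, hc, hpf⟩ := sd.exists_peakFamily
    (F := EuclideanSpace ℂ (Fin n)) (X := frontier D ∩ closedBall p rU)
    (Y := closure D ∩ closedBall p rU) inter_subset_left (inter_subset_right.trans hrad)
    inter_subset_left (inter_subset_right.trans hrad) hX hK₁ (by omega : 2 * d = 2 * d - 1 + 1)
    gd.b_pos gd.B_ge
  obtain ⟨εp, hεp, μ₀, hμ₀, γ₀, hγ₀, H⟩ := gd.exists_perturbation hωopen hρ.continuousOn hKωcomp
    hKωω hX hrU.le inter_subset_right hκ hC₁ hc hpf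
  refine ⟨rU / 2, rU, εp, μ₀, γ₀, half_pos hrU, half_lt_self hrU, hεp, hμ₀, hγ₀, ?_⟩
  intro D₁ hD₁ hD₁D C ⟨O, _, hCO⟩ _ _ f hf hfD hfω ε hε γ hγ hγ₀'
  have hWY : closure D₁ ⊆ closure D ∩ closedBall p rU := fun z hz =>
    ⟨closure_mono (fun x hx => (hD₁D hx).2) hz,
      closure_ball_subset_closedBall (closure_mono (fun x hx => (hD₁D hx).1) hz)⟩
  have hW : IsCompact (closure D₁) := (isCompact_closedBall p rU).of_isClosed_subset
    isClosed_closure (hWY.trans inter_subset_right)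
  have hΓW : frontier D ∩ frontier D₁ ⊆ closure D₁ :=
    inter_subset_right.trans frontier_subset_closure
  have hCΓ : C ∩ closure D₁ ⊆ frontier D ∩ frontier D₁ := fun z hz => by
    have hzD : z ∈ frontier D := by
      have := hz.1
      rw [hCO] at this
      exact this.2
    refine ⟨hzD, ?_⟩
    rw [hD₁.frontier_eq]
    rw [hDopen.frontier_eq] at hzD
    exact ⟨hz.2, fun h => hzD.2 (hD₁D h).2⟩
  obtain ⟨w, hw, hwω, hgrowth, hlow, hup, hfar⟩ := H (closure D₁) (frontier D ∩ frontier D₁)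
    (C ∩ closure D₁) hW hWY (hW.of_isClosed_subset (isClosed_frontier.inter isClosed_frontier) hΓW)
    hΓW (fun z hz => ⟨hz.1, (hWY (hΓW hz)).2⟩) hCΓ f hf.continuousOn hfω ε hε γ hγ hγ₀'
  classical
  set e : EuclideanSpace ℂ (Fin n) := EuclideanSpace.single ⟨0, by omega⟩ 1 with he
  have he1 : ‖e‖ = 1 := by simp [he]
  -- Off `closure D₁` the map only has to move far.
  set g : EuclideanSpace ℂ (Fin d) → EuclideanSpace ℂ (Fin n) := fun z =>
    if z ∈ closure D₁ then f z + w z else f z + ((|εp * γ z| + 1 : ℝ) : ℂ) • e with hg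
  have hgW : ∀ z ∈ closure D₁, g z = f z + w z := fun z hz => if_pos hz
  have hgf : ∀ z ∈ closure D₁, g z - f z = w z := fun z hz => by
    rw [hgW z hz, add_sub_cancel_left]
  refine ⟨g, ?_, ?_, ?_, ?_, ?_, ?_, ?_⟩
  · exact (hf.add (hw.restrict_scalars ℝ).contDiffOn).congr hgW
  · exact (hfD.add (hw.differentiable (by simp)).differentiableOn).congr
      fun z hz => hgW z (subset_closure hz)
  · intro z hz
    rw [hgW z hz]
    exact hwω z hz
  · intro z hz
    rw [hgf z hz, hgW z hz]
    exact hgrowth z hz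
  · intro z hz hzK
    by_cases hzW : z ∈ closure D₁
    · rw [hgf z hzW]
      exact hlow z ⟨hz, hzW⟩ hzK
    · have h : g z - f z = ((|εp * γ z| + 1 : ℝ) : ℂ) • e := by
        simp only [hg, if_neg hzW, add_sub_cancel_left]
      rw [h, norm_smul, he1, mul_one, Complex.norm_real,
        Real.norm_of_nonneg (by positivity)]
      linarith [le_abs_self (εp * γ z)]
  · intro z hz
    rw [hgf z (hΓW hz)]
    exact hup z hz
  · intro z hz hzC
    rw [hgf z hz]
    exact hfar z hz fun ζ hζ => hzC.le.trans (infDist_le_dist_of_mem hζ.1)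

end
end

section
/- Let ℓ ≥ 2, r ∈ {0,…,ℓ}, and k ≥ 0 be integers. Let D ⊂ ℂ^d be a bounded strongly pseudoconvex domain with C^ℓ boundary, let σ ⊂ D be a finite set, and let X ⊆ ℂⁿ be open. Given a map f₀ : cl(D) → X of class A^r(D) (i.e., of class C^r on cl(D) and holomorphic on D), there exist an integer m ≥ 1, an open set P ⊆ ℂ^m containing 0, and a spray of maps f : cl(D) × P → X of class A^r(D) with values in X and exceptional set σ of order k such that f(·,0) = f₀. -/
open Set Metric Complex Bornology

noncomputable section

/-- `f` and `g` agree to order `k` at `p`: all iterated real Fréchet derivatives of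
orders `0, …, k` coincide at `p`. -/
def AgreeToOrder {E F : Type*} [NormedAddCommGroup E] [NormedSpace ℂ E]
    [NormedAddCommGroup F] [NormedSpace ℂ F] (k : ℕ) (f g : E → F) (p : E) : Prop :=
  ∀ j : ℕ, j ≤ k → iteratedFDeriv ℝ j f p = iteratedFDeriv ℝ j g p

/-- A spray of maps of class `A^r(D)` with values in `X` and exceptional set `σ`
of order `k`, with parameter set `P ⊆ ℂ^m`. -/
def IsSpray {d n m : ℕ} (r k : ℕ) (D σ : Set (EuclideanSpace ℂ (Fin d)))
    (X : Set (EuclideanSpace ℂ (Fin n))) (P : Set (EuclideanSpace ℂ (Fin m)))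
    (f : EuclideanSpace ℂ (Fin d) → EuclideanSpace ℂ (Fin m) →
      EuclideanSpace ℂ (Fin n)) : Prop :=
  (∀ z ∈ closure D, ∀ t ∈ P, f z t ∈ X) ∧
  DifferentiableOn ℂ
    (fun q : EuclideanSpace ℂ (Fin d) × EuclideanSpace ℂ (Fin m) => f q.1 q.2)
    (D ×ˢ P) ∧
  ContDiffOn ℝ (r : ℕ∞)
    (fun q : EuclideanSpace ℂ (Fin d) × EuclideanSpace ℂ (Fin m) => f q.1 q.2)
    (closure D ×ˢ P) ∧
  (∀ t ∈ P, ∀ p ∈ σ, AgreeToOrder k (fun z => f z t) (fun z => f z 0) p) ∧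
  (∀ z ∈ closure D \ σ, ∀ t ∈ P, Function.Surjective (fderiv ℝ (f z) t))

open Filter Topology MeasureTheory ContDiff

/-- The directional derivatives of a map that is complex differentiable on an open set of a
finite-dimensional space are complex differentiable. -/
theorem differentiableOn_fderiv_apply_of_isOpen {E F : Type*}
    [NormedAddCommGroup E] [NormedSpace ℂ E] [FiniteDimensional ℂ E]
    [NormedAddCommGroup F] [NormedSpace ℂ F] [FiniteDimensional ℂ F]
    {f : E → F} {s : Set E} (hs : IsOpen s) (hf : DifferentiableOn ℂ f s) (v : E) :
    DifferentiableOn ℂ (fun z => fderiv ℂ f z v) s := by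
  have : CompleteSpace F := FiniteDimensional.complete ℂ F
  have : ProperSpace E := FiniteDimensional.proper ℂ E
  borelize E
  borelize F
  borelize (E →L[ℂ] F)
  intro z₀ hz₀
  obtain ⟨ε, hε, hεs⟩ := Metric.nhds_basis_closedBall.mem_iff.1 (hs.mem_nhds hz₀)
  obtain ⟨M, hM⟩ := ((isCompact_closedBall z₀ ε).image_of_continuousOn
    (hf.continuousOn.mono hεs)).isBounded.subset_closedBall 0
  have hMf : ∀ z ∈ closedBall z₀ ε, ‖f z‖ ≤ M := fun z hz => by
    simpa using hM (mem_image_of_mem f hz)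
  obtain ⟨ρ, hρ, hρv⟩ : ∃ ρ : ℝ, 0 < ρ ∧ ρ * ‖v‖ ≤ ε / 4 := by
    refine ⟨ε / (4 * (‖v‖ + 1)), by positivity, ?_⟩
    rw [div_mul_eq_mul_div, div_le_div_iff₀ (by positivity) (by norm_num)]
    nlinarith [norm_nonneg v]
  have hmem : ∀ z ∈ ball z₀ (ε / 4), ∀ ζ ∈ closedBall (0 : ℂ) ρ,
      z + ζ • v ∈ ball z₀ (ε / 2) := fun z hz ζ hζ => by
    rw [mem_ball_iff_norm] at hz ⊢
    have h1 : ‖ζ • v‖ ≤ ε / 4 := by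
      rw [norm_smul]
      exact (mul_le_mul_of_nonneg_right (by simpa using hζ) (norm_nonneg v)).trans hρv
    calc ‖z + ζ • v - z₀‖ = ‖(z - z₀) + ζ • v‖ := by congr 1; abel
      _ ≤ ‖z - z₀‖ + ‖ζ • v‖ := norm_add_le _ _
      _ < ε / 2 := by linarith
  have hsub : ball z₀ (ε / 2) ⊆ s :=
    (ball_subset_closedBall.trans (closedBall_subset_closedBall (by linarith))).trans hεs
  have hdiff : ∀ z ∈ ball z₀ (ε / 2), DifferentiableAt ℂ f z := fun z hz =>
    hf.differentiableAt (hs.mem_nhds (hsub hz))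
  have hbound : ∀ z ∈ ball z₀ (ε / 2), ‖fderiv ℂ f z‖ ≤ (2 * M + 1) / (ε / 2) := fun z hz => by
    have hzε : ball z (ε / 2) ⊆ closedBall z₀ ε := fun w hw => by
      have := dist_triangle w z z₀
      rw [mem_ball] at hw hz
      rw [mem_closedBall]
      linarith
    refine Complex.norm_fderiv_le_div_of_mapsTo_ball (hf.mono (hzε.trans hεs)) ?_ (by positivity)
    intro w hw
    have h1 := hMf w (hzε hw)
    have h2 := hMf z (hzε (mem_ball_self (by positivity)))
    rw [mem_closedBall, dist_eq_norm]
    linarith [norm_sub_le (f w) (f z)]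
  have hcauchy : ∀ z ∈ ball z₀ (ε / 4), fderiv ℂ f z v = (2 * Real.pi * I : ℂ)⁻¹ •
      ∫ θ in (0 : ℝ)..2 * Real.pi, (deriv (circleMap 0 ρ) θ * ((circleMap 0 ρ θ) ^ 2)⁻¹) •
        f (z + circleMap 0 ρ θ • v) := fun z hz => by
    have hline : ∀ ζ : ℂ, HasDerivAt (fun ζ : ℂ => z + ζ • v) v ζ := fun ζ => by
      simpa using ((hasDerivAt_id ζ).smul_const v).const_add z
    have hopen : IsOpen ((fun ζ : ℂ => z + ζ • v) ⁻¹' ball z₀ (ε / 2)) :=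
      isOpen_ball.preimage (by fun_prop)
    have h := Complex.cderiv_eq_deriv (f := fun ζ : ℂ => f (z + ζ • v)) (z := 0) hopen
      (fun ζ hζ => ((hdiff _ hζ).comp ζ (hline ζ).differentiableAt).differentiableWithinAt)
      hρ (hmem z hz)
    have h0 : HasDerivAt (fun ζ : ℂ => f (z + ζ • v)) (fderiv ℂ f z v) 0 := by
      have hz' : HasFDerivAt f (fderiv ℂ f z) (z + (0 : ℂ) • v) := by
        simpa using (hdiff z (ball_subset_ball (by linarith) hz)).hasFDerivAt
      exact hz'.comp_hasDerivAt 0 (hline 0)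
    rw [h0.deriv] at h
    rw [← h, Complex.cderiv, circleIntegral]
    simp only [sub_zero, smul_smul]
  have hc : Continuous fun θ : ℝ => deriv (circleMap 0 ρ) θ * ((circleMap 0 ρ θ) ^ 2)⁻¹ := by
    simp only [deriv_circleMap]
    refine Continuous.mul (by fun_prop) (Continuous.inv₀ (by fun_prop) fun θ => ?_)
    exact pow_ne_zero _ (circleMap_ne_center hρ.ne')
  have hcircle : ∀ θ : ℝ, circleMap 0 ρ θ ∈ closedBall (0 : ℂ) ρ :=
    fun θ => circleMap_mem_closedBall _ hρ.le θ
  have hnhds : ball z₀ (ε / 4) ∈ 𝓝 z₀ := ball_mem_nhds _ (by positivity)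
  have hFcont : ∀ z ∈ ball z₀ (ε / 4), Continuous fun θ : ℝ =>
      (deriv (circleMap 0 ρ) θ * ((circleMap 0 ρ θ) ^ 2)⁻¹) • f (z + circleMap 0 ρ θ • v) :=
    fun z hz => hc.smul <| (hf.continuousOn.mono hsub).comp_continuous (by fun_prop)
      fun θ => hmem z hz _ (hcircle θ)
  have hline₀ : Continuous fun θ : ℝ => z₀ + circleMap 0 ρ θ • v := by fun_prop
  have hder := intervalIntegral.hasFDerivAt_integral_of_dominated_of_fderiv_le
    (μ := volume) (a := 0) (b := 2 * Real.pi) (𝕜 := ℂ) (x₀ := z₀) (s := ball z₀ (ε / 4))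
    (F := fun z θ => (deriv (circleMap 0 ρ) θ * ((circleMap 0 ρ θ) ^ 2)⁻¹) •
        f (z + circleMap 0 ρ θ • v))
    (F' := fun z θ => (deriv (circleMap 0 ρ) θ * ((circleMap 0 ρ θ) ^ 2)⁻¹) •
        fderiv ℂ f (z + circleMap 0 ρ θ • v))
    (bound := fun θ => ‖deriv (circleMap 0 ρ) θ * ((circleMap 0 ρ θ) ^ 2)⁻¹‖ *
        ((2 * M + 1) / (ε / 2)))
    hnhds
    (eventually_of_mem hnhds fun z hz => (hFcont z hz).aestronglyMeasurable)
    ((hFcont z₀ (mem_ball_self (by positivity))).intervalIntegrable _ _)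
    (hc.measurable.smul ((measurable_fderiv ℂ f).comp hline₀.measurable)).aestronglyMeasurable
    (Eventually.of_forall fun θ _ z hz => by
      rw [norm_smul]
      exact mul_le_mul_of_nonneg_left (hbound _ (hmem z hz _ (hcircle θ))) (norm_nonneg _))
    ((hc.norm.mul continuous_const).intervalIntegrable _ _)
    (Eventually.of_forall fun θ _ z hz => by
      have h1 := (hdiff _ (hmem z hz _ (hcircle θ))).hasFDerivAt
      exact ((hasFDerivAt_comp_add_right (circleMap 0 ρ θ • v)).2 h1).const_smul _)
  refine DifferentiableAt.differentiableWithinAt ?_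
  refine (hder.differentiableAt.const_smul (2 * Real.pi * I : ℂ)⁻¹).congr_of_eventuallyEq ?_
  exact eventually_of_mem hnhds hcauchy

/-- A map that is complex differentiable on an open set of a finite-dimensional space is
smooth there. -/
theorem DifferentiableOn.contDiffOn_of_finiteDimensional {E F : Type*}
    [NormedAddCommGroup E] [NormedSpace ℂ E] [FiniteDimensional ℂ E]
    [NormedAddCommGroup F] [NormedSpace ℂ F] [FiniteDimensional ℂ F]
    {f : E → F} {s : Set E} (hs : IsOpen s) (hf : DifferentiableOn ℂ f s) (n : ℕ) :
    ContDiffOn ℂ n f s := by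
  induction n generalizing f with
  | zero => exact contDiffOn_zero.2 hf.continuousOn
  | succ n ih =>
    rw [Nat.cast_succ, contDiffOn_succ_iff_fderiv_of_isOpen hs]
    exact ⟨hf, by simp, contDiffOn_clm_apply.2 fun v =>
      ih (differentiableOn_fderiv_apply_of_isOpen hs hf v)⟩

/-- The derivatives of order less than `N` of `u ^ N • G` vanish at a zero of `u`. -/
theorem iteratedFDeriv_pow_smul_eq_zero {E F : Type*}
    [NormedAddCommGroup E] [NormedSpace ℝ E] [NormedAddCommGroup F] [NormedSpace ℂ F]
    {u : E → ℂ} {G : E → F} {p : E} (hu : ContDiff ℝ ∞ u) (hG : ContDiff ℝ ∞ G) (hp : u p = 0)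
    {N j : ℕ} (hj : j < N) : iteratedFDeriv ℝ j (fun z => u z ^ N • G z) p = 0 := by
  induction N generalizing j with
  | zero => omega
  | succ N ih =>
    have hGN : ContDiff ℝ ∞ fun z => u z ^ N • G z := (hu.pow N).smul hG
    have h := norm_iteratedFDeriv_smul_le (𝕜 := ℝ) hu hGN p (n := j) (by exact_mod_cast le_top)
    rw [Finset.sum_eq_zero fun i hi => ?_] at h
    · rw [← norm_le_zero_iff]
      simpa only [pow_succ', mul_smul] using h
    · rcases i.eq_zero_or_pos with rfl | hi0
      · simp [hp]
      · rw [ih (j := j - i) (by rw [Finset.mem_range] at hi; omega)]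
        simp

/-- For a finite set `σ ⊆ ℂ^d` there are finitely many holomorphic functions whose common zero
set is contained in `σ` and all of whose derivatives up to order `k` vanish on `σ`. -/
theorem exists_finite_family_vanishing_to_order {d : ℕ} (k : ℕ)
    {σ : Set (EuclideanSpace ℂ (Fin d))} (hσ : σ.Finite) :
    ∃ (ι : Type) (_ : Fintype ι) (g : ι → EuclideanSpace ℂ (Fin d) → ℂ),
      (∀ i, ContDiff ℂ ∞ (g i)) ∧ (∀ z ∉ σ, ∃ i, g i z ≠ 0) ∧
      ∀ i, ∀ p ∈ σ, ∀ {F : Type} [NormedAddCommGroup F] [NormedSpace ℂ F] (w : F), ∀ j ≤ k,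
        iteratedFDeriv ℝ j (fun z => g i z • w) p = 0 := by
  classical
  have := hσ.fintype
  have hcoord : ∀ (q : EuclideanSpace ℂ (Fin d)) (i : Fin d),
      ContDiff ℂ ∞ fun z : EuclideanSpace ℂ (Fin d) => z i - q i := fun q i => by fun_prop
  refine ⟨σ → Fin d, inferInstance, fun c z => ∏ q : σ, (z (c q) - q.1 (c q)) ^ (k + 1),
    fun c => contDiff_prod fun q _ => (hcoord q.1 (c q)).pow _, fun z hz => ?_, ?_⟩
  · have hne : ∀ q : σ, ∃ i, z i ≠ q.1 i := fun q => by
      by_contra! h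
      exact hz ((PiLp.ext h : z = q.1) ▸ q.2)
    choose c hc using hne
    exact ⟨c, Finset.prod_ne_zero_iff.2 fun q _ => pow_ne_zero _ (sub_ne_zero.2 (hc q))⟩
  · intro c p hp F _ _ w j hj
    have h := iteratedFDeriv_pow_smul_eq_zero (p := p)
      (u := fun z => z (c ⟨p, hp⟩) - p (c ⟨p, hp⟩))
      (G := fun z => (∏ q ∈ Finset.univ.erase (⟨p, hp⟩ : σ),
        (z (c q) - q.1 (c q)) ^ (k + 1)) • w)
      ((hcoord _ _).restrict_scalars ℝ)
      (((contDiff_prod fun q _ => (hcoord q.1 (c q)).pow _).smul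
        contDiff_const).restrict_scalars ℝ) (sub_self _) (Nat.lt_succ_of_le hj)
    rw [← h]
    congr 1
    ext1 z
    rw [smul_smul, Finset.mul_prod_erase Finset.univ
      (fun q : σ => (z (c q) - q.1 (c q)) ^ (k + 1)) (Finset.mem_univ _)]

/-- Lemma 4.2 (Euclidean version): existence of sprays with a given core map. -/
theorem exists_spray
    {d n ℓ r k : ℕ} (hd : 1 ≤ d) (hℓ : 2 ≤ ℓ) (hrℓ : r ≤ ℓ)
    {D : Set (EuclideanSpace ℂ (Fin d))} (hD : IsSPCDomain D (ℓ : ℕ∞))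
    {σ : Set (EuclideanSpace ℂ (Fin d))} (hσfin : σ.Finite) (hσD : σ ⊆ D)
    {X : Set (EuclideanSpace ℂ (Fin n))} (hX : IsOpen X)
    {f₀ : EuclideanSpace ℂ (Fin d) → EuclideanSpace ℂ (Fin n)}
    (hf₀cont : ContDiffOn ℝ (r : ℕ∞) f₀ (closure D))
    (hf₀hol : DifferentiableOn ℂ f₀ D)
    (hf₀X : MapsTo f₀ (closure D) X) :
    ∃ m : ℕ, 1 ≤ m ∧
      ∃ P : Set (EuclideanSpace ℂ (Fin m)), IsOpen P ∧ 0 ∈ P ∧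
        ∃ f : EuclideanSpace ℂ (Fin d) → EuclideanSpace ℂ (Fin m) →
            EuclideanSpace ℂ (Fin n),
          IsSpray r k D σ X P f ∧ ∀ z ∈ closure D, f z 0 = f₀ z := by
  obtain ⟨hDo, -, hDb, -⟩ := hD
  obtain ⟨ι, _, g, hg, hgne, hgσ⟩ := exists_finite_family_vanishing_to_order k hσfin
  classical
  let W := (ι → EuclideanSpace ℂ (Fin n)) × ℂ
  let m := Module.finrank ℂ W
  let e : EuclideanSpace ℂ (Fin m) ≃L[ℂ] W := ContinuousLinearEquiv.ofFinrankEq (by simp [m])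
  let w : ι → EuclideanSpace ℂ (Fin m) →L[ℂ] EuclideanSpace ℂ (Fin n) := fun i =>
    (ContinuousLinearMap.proj i ∘L ContinuousLinearMap.fst ℂ _ ℂ) ∘L
      (e : EuclideanSpace ℂ (Fin m) →L[ℂ] W)
  let h : EuclideanSpace ℂ (Fin d) → EuclideanSpace ℂ (Fin m) → EuclideanSpace ℂ (Fin n) :=
    fun z t => ∑ i, g i z • w i t
  have hh : ContDiff ℂ ∞ fun q : EuclideanSpace ℂ (Fin d) × EuclideanSpace ℂ (Fin m) =>
      h q.1 q.2 :=
    ContDiff.sum fun i _ => ((hg i).comp contDiff_fst).smul ((w i).contDiff.comp contDiff_snd)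
  have hh0 : ∀ z, h z 0 = 0 := fun z => by simp [h]
  have hcompact : CompactSpace (closure D) := isCompact_iff_compactSpace.1 hDb.isCompact_closure
  have hcont : Continuous fun q : closure D × EuclideanSpace ℂ (Fin m) =>
      f₀ q.1 + h q.1 q.2 :=
    ((continuousOn_iff_continuous_domRestrict.1 hf₀cont.continuousOn).comp continuous_fst).add
      (hh.continuous.comp (by fun_prop :
        Continuous fun q : closure D × EuclideanSpace ℂ (Fin m) => (q.1.1, q.2)))
  obtain ⟨A, P, -, hPo, hA, h0P, hAP⟩ := generalized_tube_lemma
    (isCompact_univ (X := closure D)) (isCompact_singleton (x := (0 : EuclideanSpace ℂ (Fin m))))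
    (hX.preimage hcont) (by
      rintro ⟨z, t⟩ ⟨-, rfl⟩
      simpa [hh0] using hf₀X z.2)
  refine ⟨m, Module.finrank_pos, P, hPo, h0P rfl, fun z t => f₀ z + h z t,
    ⟨fun z hz t ht => ?_, ?_, ?_, fun t _ p hp => ?_, fun z hz t _ => ?_⟩,
    fun z _ => by simp [hh0]⟩
  · exact hAP (mk_mem_prod (hA (mem_univ (⟨z, hz⟩ : closure D))) ht)
  · exact (hf₀hol.comp differentiableOn_fst fun q hq => hq.1).add
      (hh.differentiable (by simp)).differentiableOn
  · exact (hf₀cont.comp contDiffOn_fst fun q hq => hq.1).add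
      ((hh.restrict_scalars ℝ).of_le (by exact_mod_cast le_top)).contDiffOn
  · have hagree : ∀ t j, j ≤ k →
        iteratedFDeriv ℝ j (fun z => f₀ z + h z t) p = iteratedFDeriv ℝ j f₀ p := by
      intro t j hj
      have h1 : ContDiffAt ℝ j f₀ p :=
        ((hf₀hol.contDiffOn_of_finiteDimensional hDo j).contDiffAt
          (hDo.mem_nhds (hσD hp))).restrict_scalars ℝ
      have h2 : ∀ i, ContDiff ℝ j fun z => g i z • w i t := fun i =>
        (((hg i).smul contDiff_const).restrict_scalars ℝ).of_le (by exact_mod_cast le_top)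
      rw [fun_iteratedFDeriv_add_apply h1 (ContDiff.sum fun i _ => h2 i).contDiffAt,
        iteratedFDeriv_fun_sum_apply fun i _ => (h2 i).contDiffAt]
      simp [fun i => hgσ i p hp (w i t) j hj]
    intro j hj
    rw [hagree t j hj, hagree 0 j hj]
  · have hder : HasFDerivAt (fun t => f₀ z + h z t)
        ((∑ i, g i z • w i).restrictScalars ℝ) t := by
      have h1 : HasFDerivAt (fun t => f₀ z + (∑ i, g i z • w i) t) (∑ i, g i z • w i) t :=
        (∑ i, g i z • w i).hasFDerivAt.const_add _
      simpa [h] using h1.restrictScalars ℝ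
    rw [hder.fderiv]
    intro y
    obtain ⟨i, hi⟩ := hgne z hz.2
    refine ⟨e.symm (Pi.single i ((g i z)⁻¹ • y), 0), ?_⟩
    simp [w, Pi.single_apply, hi]

end
end
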